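/- Let q ≥ 3 be an integer and fix 0 ≤ β < β_c(q) = (q−1)log(q−1)/(q−2), and set α₁ = α₁(β,q) = 1/(2(1−2β/q)). Then there exist constants C₁, C₂ > 0 and subsets Σ̃_n ⊆ Σ_n with μ_n(Σ_n ∖ Σ̃_n) ≤ C₁ e^{−C₂ n} for all n, such that the Glauber dynamics restricted to initial configurations in Σ̃_n exhibits cutoff at time α₁ n log n with window of order n: for every ε ∈ (0,1/2) there exists γ = γ(ε) > 0 such that for all sufficiently large n, t^{Σ̃_n}_mix(ε)(n) ≤ α₁ n log n + γ n and t^{Σ̃_n}_mix(1−ε)(n) ≥ α₁ n log n − γ n. -/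

import Mathlib

open Finset Filter

/-- The (unnormalized) Curie–Weiss Potts weight of a configuration
`σ : Fin n → Fin q` at inverse temperature `β`:
`exp((β/n) * Σ_{u,v} 1[σ u = σ v])`. -/
noncomputable def pottsWeight (q n : ℕ) (β : ℝ) (σ : Fin n → Fin q) : ℝ :=
  Real.exp ((β / (n : ℝ)) * ∑ u : Fin n, ∑ v : Fin n, if σ u = σ v then (1 : ℝ) else 0)

/-- The Curie–Weiss Potts probability measure `μ_n` on configurations. -/
noncomputable def pottsMeasure (q n : ℕ) (β : ℝ) (σ : Fin n → Fin q) : ℝ :=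
  pottsWeight q n β σ / ∑ τ : Fin n → Fin q, pottsWeight q n β τ

/-- The transition matrix `P_n` of the Glauber dynamics: pick a uniform vertex `u`
and resample its color according to the conditional Potts distribution given the
colors of all other vertices. -/
noncomputable def glauberKernel (q n : ℕ) (β : ℝ) :
    Matrix (Fin n → Fin q) (Fin n → Fin q) ℝ :=
  fun σ τ =>
    (1 / (n : ℝ)) * ∑ u : Fin n,
      if ∀ v : Fin n, v ≠ u → τ v = σ v then
        pottsMeasure q n β τ / ∑ k : Fin q, pottsMeasure q n β (Function.update σ u k)
      else 0

/-- Total-variation distance between two (probability) functions on a finite set: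
`max_{A ⊆ S} |ν(A) − ν'(A)|`. -/
noncomputable def tvDist {S : Type*} [Fintype S] (ν ν' : S → ℝ) : ℝ :=
  ⨆ A : Finset S, |∑ x ∈ A, ν x - ∑ x ∈ A, ν' x|

/-- Worst-case total-variation distance to stationarity after `t` steps:
`d_t(n) = max_{σ₀} ‖P_n^t(σ₀,·) − μ_n‖_TV`. -/
noncomputable def glauberDist (q n : ℕ) (β : ℝ) (t : ℕ) : ℝ :=
  ⨆ σ₀ : Fin n → Fin q,
    tvDist (fun τ => (glauberKernel q n β ^ t) σ₀ τ) (pottsMeasure q n β)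

/-- The `ε`-mixing time `t_mix(ε)(n) = inf {t : d_t(n) ≤ ε}`. -/
noncomputable def mixingTime (q n : ℕ) (β : ℝ) (ε : ℝ) : ℕ :=
  sInf {t : ℕ | glauberDist q n β t ≤ ε}

/-- The drift function `D_β(x) = −x + (1 + (q−1) e^{2β(1−qx)/(q−1)})⁻¹`. -/
noncomputable def Dfun (q : ℕ) (β x : ℝ) : ℝ :=
  -x + (1 + ((q : ℝ) - 1) * Real.exp (2 * β * (1 - (q : ℝ) * x) / ((q : ℝ) - 1)))⁻¹

/-- The dynamical (spinodal) critical inverse temperature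
`β_s(q) = sup {β ≥ 0 : D_β(x) ≠ 0 for all x ∈ (1/q,1)}`. -/
noncomputable def betaS (q : ℕ) : ℝ :=
  sSup {β : ℝ | 0 ≤ β ∧ ∀ x ∈ Set.Ioo (1 / (q : ℝ)) 1, Dfun q β x ≠ 0}

/-- The constant `α₁(β,q) = 1/(2(1 − 2β/q))`. -/
noncomputable def alpha1 (β : ℝ) (q : ℕ) : ℝ := 1 / (2 * (1 - 2 * β / (q : ℝ)))

/-- The static critical inverse temperature `β_c(q) = (q−1)log(q−1)/(q−2)`
for `q ≥ 3`, with `β_c(2) = 1`. -/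
noncomputable def betaC (q : ℕ) : ℝ :=
  if q = 2 then 1 else ((q : ℝ) - 1) * Real.log ((q : ℝ) - 1) / ((q : ℝ) - 2)

/-- Worst-case total-variation distance to stationarity after `t` steps, over
initial configurations restricted to a subset `A ⊆ Σ_n`. -/
noncomputable def glauberDistRes (q n : ℕ) (β : ℝ) (A : Set (Fin n → Fin q)) (t : ℕ) : ℝ :=
  ⨆ σ₀ : A, tvDist (fun τ => (glauberKernel q n β ^ t) (σ₀ : Fin n → Fin q) τ)
    (pottsMeasure q n β)

/-- The restricted (essential) mixing time
`t^{A}_mix(ε)(n) = inf {t : d^{A}_t(n) ≤ ε}`. -/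
noncomputable def mixingTimeRes (q n : ℕ) (β : ℝ) (A : Set (Fin n → Fin q)) (ε : ℝ) : ℕ :=
  sInf {t : ℕ | glauberDistRes q n β A t ≤ ε}

namespace EM

/-- softmax -/
noncomputable def sm {q : ℕ} (a : Fin q → ℝ) (k : Fin q) : ℝ :=
  Real.exp (a k) / ∑ j, Real.exp (a j)

lemma sumexp_pos {q : ℕ} [NeZero q] (a : Fin q → ℝ) : 0 < ∑ j, Real.exp (a j) :=
  Finset.sum_pos (fun _ _ => Real.exp_pos _) ⟨0, Finset.mem_univ _⟩

lemma sm_pos {q : ℕ} [NeZero q] (a : Fin q → ℝ) (k : Fin q) : 0 < sm a k :=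
  div_pos (Real.exp_pos _) (sumexp_pos a)

lemma sm_sum {q : ℕ} [NeZero q] (a : Fin q → ℝ) : ∑ k, sm a k = 1 := by
  unfold sm
  rw [← Finset.sum_div, div_self (sumexp_pos a).ne']

lemma sm_le_one {q : ℕ} [NeZero q] (a : Fin q → ℝ) (k : Fin q) : sm a k ≤ 1 := by
  rw [← sm_sum a]
  exact Finset.single_le_sum (f := sm a) (fun i _ => (sm_pos a i).le) (Finset.mem_univ k)

lemma sm_const {q : ℕ} [NeZero q] (e : ℝ) (k : Fin q) : sm (fun _ : Fin q => e) k = 1 / q := by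
  unfold sm
  have : Real.exp e ≠ 0 := (Real.exp_pos e).ne'
  have hq : (q : ℝ) ≠ 0 := by exact_mod_cast NeZero.ne q
  simp
  field_simp

lemma sm_mvt {q : ℕ} [NeZero q] (w b c : Fin q → ℝ) :
    ∃ ξ ∈ Set.Ioo (0 : ℝ) 1,
      ∑ k, w k * sm (fun j => b j + c j) k - ∑ k, w k * sm b k =
        ∑ k, w k * (sm (fun j => b j + ξ * c j) k *
          (c k - ∑ i, sm (fun j => b j + ξ * c j) i * c i)) := by
  have hd : ∀ t : ℝ, HasDerivAt (fun t : ℝ => ∑ k, w k * sm (fun j => b j + t * c j) k)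
      (∑ k, w k * (sm (fun j => b j + t * c j) k *
          (c k - ∑ i, sm (fun j => b j + t * c j) i * c i))) t := by
    intro t
    have he : ∀ k, HasDerivAt (fun t : ℝ => Real.exp (b k + t * c k))
        (Real.exp (b k + t * c k) * c k) t := by
      intro k
      have h1 : HasDerivAt (fun t : ℝ => b k + t * c k) (c k) t := by
        simpa using ((hasDerivAt_id t).mul_const (c k)).const_add (b k)
      exact h1.exp
    have hs : HasDerivAt (fun t : ℝ => ∑ j, Real.exp (b j + t * c j))
        (∑ j, Real.exp (b j + t * c j) * c j) t :=
      HasDerivAt.fun_sum (fun j _ => he j)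
    apply HasDerivAt.fun_sum
    intro k _
    apply HasDerivAt.const_mul
    have hne := (sumexp_pos (fun j => b j + t * c j)).ne'
    have h := (he k).div hs hne
    refine (show HasDerivAt (fun y => sm (fun j => b j + y * c j) k) _ t from h).congr_deriv ?_
    unfold sm
    have : ∑ i, Real.exp (b i + t * c i) / (∑ j, Real.exp (b j + t * c j)) * c i
       = (∑ i, Real.exp (b i + t * c i) * c i) / (∑ j, Real.exp (b j + t * c j)) := by
      rw [Finset.sum_div]
      exact Finset.sum_congr rfl (fun i _ => by ring)
    rw [this]
    field_simp
  obtain ⟨ξ, hξ, h⟩ := exists_hasDerivAt_eq_slope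
    (fun t : ℝ => ∑ k, w k * sm (fun j => b j + t * c j) k) _ (zero_lt_one)
    (fun t _ => (hd t).continuousAt.continuousWithinAt) (fun t _ => hd t)
  refine ⟨ξ, hξ, ?_⟩
  rw [h]
  simp

lemma sm_avg_abs {q : ℕ} [NeZero q] (a c : Fin q → ℝ) (A : ℝ) (h : ∀ j, |c j| ≤ A) :
    |∑ i, sm a i * c i| ≤ A := by
  calc |∑ i, sm a i * c i| ≤ ∑ i, |sm a i * c i| := Finset.abs_sum_le_sum_abs _ _
    _ ≤ ∑ i, sm a i * A := by
        apply Finset.sum_le_sum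
        intro i _
        rw [abs_mul, abs_of_pos (sm_pos a i)]
        exact mul_le_mul_of_nonneg_left (h i) (sm_pos a i).le
    _ = A := by rw [← Finset.sum_mul, sm_sum, one_mul]

lemma sm_lip {q : ℕ} [NeZero q] (b c : Fin q → ℝ) (A : ℝ) (h : ∀ j, |c j| ≤ A) (k : Fin q) :
    |sm (fun j => b j + c j) k - sm b k| ≤ 2 * A := by
  obtain ⟨ξ, _, he⟩ := sm_mvt (fun j => if j = k then 1 else 0) b c
  simp only [ite_mul, one_mul, zero_mul, Finset.sum_ite_eq', Finset.mem_univ, if_true] at he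
  rw [he, abs_mul, abs_of_pos (sm_pos _ _)]
  have h1 := sm_avg_abs (fun j => b j + ξ * c j) c A h
  have h2 : |c k - ∑ i, sm (fun j => b j + ξ * c j) i * c i| ≤ 2 * A :=
    (abs_sub _ _).trans (by linarith [h k])
  have := sm_le_one (fun j => b j + ξ * c j) k
  have := sm_pos (fun j => b j + ξ * c j) k
  nlinarith [abs_nonneg (c k - ∑ i, sm (fun j => b j + ξ * c j) i * c i)]

lemma sm_near {q : ℕ} [NeZero q] (a : Fin q → ℝ) (e A : ℝ) (h : ∀ j, |a j - e| ≤ A) (k : Fin q) :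
    |sm a k - 1 / q| ≤ 2 * A := by
  have := sm_lip (fun _ => e) (fun j => a j - e) A h k
  simpa [sm_const] using this

lemma seg_near (x c e A ξ : ℝ) (hξ : ξ ∈ Set.Ioo (0 : ℝ) 1) (h1 : |x - e| ≤ A)
    (h2 : |x + c - e| ≤ A) : |x + ξ * c - e| ≤ A := by
  obtain ⟨h0, h1'⟩ := hξ
  rw [abs_le] at *
  constructor <;> nlinarith

lemma sm_onesided {q : ℕ} [NeZero q] (b c : Fin q → ℝ) (e A : ℝ) (h1 : ∀ j, |b j - e| ≤ A)
    (h2 : ∀ j, |b j + c j - e| ≤ A) :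
    ∑ k, c k * sm (fun j => b j + c j) k - ∑ k, c k * sm b k ≤
      (1 / q + 2 * A) * ∑ k, c k ^ 2 := by
  obtain ⟨ξ, hξ, he⟩ := sm_mvt c b c
  rw [he]
  set p := sm (fun j => b j + ξ * c j) with hp
  have hn : ∀ k, |p k - 1 / q| ≤ 2 * A := fun k =>
    sm_near _ e A (fun j => seg_near _ _ _ _ _ hξ (h1 j) (h2 j)) k
  have : ∑ k, c k * (p k * (c k - ∑ i, p i * c i)) =
      ∑ k, p k * c k ^ 2 - (∑ i, p i * c i) ^ 2 := by
    rw [sq (∑ i, p i * c i), Finset.sum_mul, ← Finset.sum_sub_distrib]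
    exact Finset.sum_congr rfl (fun i _ => by ring)
  rw [this, Finset.mul_sum]
  have : ∑ k, p k * c k ^ 2 ≤ ∑ k, (1 / (q : ℝ) + 2 * A) * c k ^ 2 := by
    apply Finset.sum_le_sum
    intro k _
    apply mul_le_mul_of_nonneg_right _ (sq_nonneg _)
    linarith [(abs_le.1 (hn k)).2]
  nlinarith [sq_nonneg (∑ i, p i * c i)]

lemma sm_l1 {q : ℕ} [NeZero q] (b c : Fin q → ℝ) (e A : ℝ) (hc : ∑ k, c k = 0)
    (h1 : ∀ j, |b j - e| ≤ A) (h2 : ∀ j, |b j + c j - e| ≤ A) :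
    ∑ k, |sm (fun j => b j + c j) k - sm b k| ≤ (1 / q + 4 * A) * ∑ k, |c k| := by
  set w : Fin q → ℝ := fun k => if 0 ≤ sm (fun j => b j + c j) k - sm b k then 1 else -1 with hw
  have hw1 : ∀ k, |w k| ≤ 1 := by intro k; simp only [hw]; split_ifs <;> simp
  obtain ⟨ξ, hξ, he⟩ := sm_mvt w b c
  have hL : ∑ k, |sm (fun j => b j + c j) k - sm b k| =
      ∑ k, w k * sm (fun j => b j + c j) k - ∑ k, w k * sm b k := by
    rw [← Finset.sum_sub_distrib]
    apply Finset.sum_congr rfl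
    intro k _
    simp only [hw]
    split_ifs with h
    · rw [abs_of_nonneg h]; ring
    · rw [abs_of_neg (not_le.1 h)]; ring
  rw [hL, he]
  set p := sm (fun j => b j + ξ * c j) with hp
  have hn : ∀ k, |p k - 1 / q| ≤ 2 * A := fun k =>
    sm_near _ e A (fun j => seg_near _ _ _ _ _ hξ (h1 j) (h2 j)) k
  set wb := ∑ i, p i * w i with hwb
  have hwb1 : |wb| ≤ 1 := sm_avg_abs _ w 1 hw1
  have e1 : ∑ k, w k * (p k * (c k - ∑ i, p i * c i)) = ∑ k, p k * (w k - wb) * c k := by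
    have l : ∑ k, w k * (p k * (c k - ∑ i, p i * c i)) =
        ∑ k, w k * p k * c k - wb * ∑ i, p i * c i := by
      rw [hwb, Finset.sum_mul, ← Finset.sum_sub_distrib]
      exact Finset.sum_congr rfl (fun i _ => by ring)
    have r : ∑ k, p k * (w k - wb) * c k = ∑ k, w k * p k * c k - wb * ∑ i, p i * c i := by
      rw [Finset.mul_sum, ← Finset.sum_sub_distrib]
      exact Finset.sum_congr rfl (fun i _ => by ring)
    rw [l, r]
  have e2 : ∑ k, p k * (w k - wb) * c k =
      ∑ k, ((1 / q) * (w k * c k) + (p k - 1 / q) * (w k - wb) * c k) := by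
    have : ∑ k, (p k * (w k - wb) * c k -
       ((1 / q) * (w k * c k) + (p k - 1 / q) * (w k - wb) * c k)) = - (1/q) * wb * ∑ k, c k := by
      rw [Finset.mul_sum]
      exact Finset.sum_congr rfl (fun i _ => by ring)
    rw [hc, mul_zero, Finset.sum_sub_distrib] at this
    linarith
  rw [e1, e2, Finset.mul_sum]
  apply Finset.sum_le_sum
  intro k _
  have a1 : w k * c k ≤ |c k| := by
    calc w k * c k ≤ |w k * c k| := le_abs_self _
      _ = |w k| * |c k| := abs_mul _ _
      _ ≤ 1 * |c k| := mul_le_mul_of_nonneg_right (hw1 k) (abs_nonneg _)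
      _ = |c k| := one_mul _
  have a2 : |w k - wb| ≤ 2 := (abs_sub _ _).trans (by linarith [hw1 k])
  have a3 : (p k - 1 / q) * (w k - wb) * c k ≤ 4 * A * |c k| := by
    calc _ ≤ |(p k - 1 / q) * (w k - wb) * c k| := le_abs_self _
      _ = |p k - 1 / q| * |w k - wb| * |c k| := by rw [abs_mul, abs_mul]
      _ ≤ (2 * A) * 2 * |c k| := by
          apply mul_le_mul_of_nonneg_right _ (abs_nonneg _)
          exact mul_le_mul (hn k) a2 (abs_nonneg _) ((abs_nonneg _).trans (hn k))
      _ = 4 * A * |c k| := by ring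
  have hq : 0 ≤ 1 / (q : ℝ) := by positivity
  nlinarith [mul_le_mul_of_nonneg_left a1 hq]

lemma sm_taylor {q : ℕ} [NeZero q] (c : Fin q → ℝ) (e A : ℝ) (hc : ∑ k, c k = 0)
    (h : ∀ j, |c j| ≤ A) (k : Fin q) :
    |sm (fun j => e + c j) k - 1 / q - c k / q| ≤ (2 + 2 * q) * A ^ 2 := by
  have hA : 0 ≤ A := (abs_nonneg _).trans (h k)
  obtain ⟨ξ, hξ, he⟩ := sm_mvt (fun j => if j = k then 1 else 0) (fun _ => e) c
  simp only [ite_mul, one_mul, zero_mul, Finset.sum_ite_eq', Finset.mem_univ, if_true,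
    sm_const] at he
  set p := sm (fun j => e + ξ * c j) with hp
  have hn : ∀ k, |p k - 1 / q| ≤ 2 * A := fun k =>
    sm_near _ e A (fun j => seg_near _ _ _ _ _ hξ (by simpa using hA) (by simpa using h j)) k
  have e1 : ∑ i, p i * c i = ∑ i, (p i - 1 / q) * c i := by
    have : ∑ i, (p i - 1 / q) * c i = ∑ i, p i * c i - (1 / q) * ∑ i, c i := by
      rw [Finset.mul_sum, ← Finset.sum_sub_distrib]
      exact Finset.sum_congr rfl (fun i _ => by ring)
    rw [this, hc]; ring
  have e2 : |∑ i, p i * c i| ≤ q * (2 * A * A) := by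
    rw [e1]
    calc _ ≤ ∑ i, |(p i - 1 / q) * c i| := Finset.abs_sum_le_sum_abs _ _
      _ ≤ ∑ i : Fin q, (2 * A * A) := by
        apply Finset.sum_le_sum
        intro i _
        rw [abs_mul]
        exact mul_le_mul (hn i) (h i) (abs_nonneg _) (by linarith)
      _ = _ := by simp
  have : sm (fun j => e + c j) k - 1 / q - c k / q =
      (p k - 1 / q) * c k - p k * ∑ i, p i * c i := by
    rw [he]; ring
  rw [this]
  have b1 : |(p k - 1 / q) * c k| ≤ 2 * A * A := by
    rw [abs_mul]
    exact mul_le_mul (hn k) (h k) (abs_nonneg _) (by linarith)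
  have b2 : |p k * ∑ i, p i * c i| ≤ q * (2 * A * A) := by
    rw [abs_mul, abs_of_pos (sm_pos _ k)]
    calc _ ≤ 1 * |∑ i, p i * c i| :=
        mul_le_mul_of_nonneg_right (sm_le_one _ k) (abs_nonneg _)
      _ ≤ _ := by rw [one_mul]; exact e2
  calc _ ≤ _ := abs_sub _ _
    _ ≤ 2 * A * A + q * (2 * A * A) := add_le_add b1 b2
    _ = _ := by ring

end EM

namespace EM

/-- number of vertices with color `k` -/
noncomputable def cnt {q n : ℕ} (σ : Fin n → Fin q) (k : Fin q) : ℝ :=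
  ∑ v, if σ v = k then (1 : ℝ) else 0

/-- deviation of the proportion of color `k` from `1/q` -/
noncomputable def X {q n : ℕ} (σ : Fin n → Fin q) (k : Fin q) : ℝ := cnt σ k / n - 1 / q

/-- squared deviation of the proportion vector -/
noncomputable def V {q n : ℕ} (σ : Fin n → Fin q) : ℝ := ∑ k, X σ k ^ 2

/-- local field at `u` -/
noncomputable def fld {q n : ℕ} (β : ℝ) (σ : Fin n → Fin q) (u : Fin n) (k : Fin q) : ℝ :=
  2 * β / n * (cnt σ k - if σ u = k then 1 else 0)

/-- the Glauber dynamics as an operator on functions -/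
noncomputable def Pop (q n : ℕ) (β : ℝ) :
    ((Fin n → Fin q) → ℝ) →ₗ[ℝ] ((Fin n → Fin q) → ℝ) where
  toFun f σ := (1 / n) * ∑ u, ∑ k, sm (fld β σ u) k * f (Function.update σ u k)
  map_add' f g := by
    ext σ
    simp only [Pi.add_apply, mul_add, Finset.sum_add_distrib]
  map_smul' c f := by
    ext σ
    simp only [Pi.smul_apply, smul_eq_mul, RingHom.id_apply]
    rw [← mul_assoc, mul_comm c, mul_assoc]
    congr 1
    rw [Finset.mul_sum]
    apply Finset.sum_congr rfl; intro u _
    rw [Finset.mul_sum]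
    apply Finset.sum_congr rfl; intro k _
    ring

lemma Pop_apply {q n : ℕ} (β : ℝ) (f : (Fin n → Fin q) → ℝ) (σ) :
    Pop q n β f σ = (1 / n) * ∑ u, ∑ k, sm (fld β σ u) k * f (Function.update σ u k) := rfl

lemma energy_eq {q n : ℕ} (σ : Fin n → Fin q) :
    (∑ u : Fin n, ∑ v : Fin n, if σ u = σ v then (1 : ℝ) else 0) = ∑ k, cnt σ k ^ 2 := by
  have h : ∀ u v, (if σ u = σ v then (1 : ℝ) else 0) =
      ∑ k, (if σ u = k then (1 : ℝ) else 0) * (if σ v = k then 1 else 0) := by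
    intro u v
    simp [eq_comm]
  simp_rw [h]
  simp_rw [Finset.sum_comm (s := (univ : Finset (Fin n))) (t := (univ : Finset (Fin q)))]
  apply Finset.sum_congr rfl
  intro k _
  unfold cnt
  rw [sq, Finset.sum_mul_sum]

lemma cnt_update {q n : ℕ} (σ : Fin n → Fin q) (u : Fin n) (k j : Fin q) :
    cnt (Function.update σ u k) j =
      cnt σ j - (if σ u = j then 1 else 0) + (if k = j then 1 else 0) := by
  unfold cnt
  rw [← Finset.add_sum_erase _ _ (Finset.mem_univ u),
    ← Finset.add_sum_erase _ (fun v => if σ v = j then (1 : ℝ) else 0) (Finset.mem_univ u)]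
  have : ∑ x ∈ univ.erase u, (if Function.update σ u k x = j then (1 : ℝ) else 0) =
      ∑ x ∈ univ.erase u, (if σ x = j then (1 : ℝ) else 0) := by
    apply Finset.sum_congr rfl
    intro x hx
    rw [Function.update_of_ne (Finset.ne_of_mem_erase hx)]
  rw [this, Function.update_self]
  ring

lemma cnt_sum {q n : ℕ} (σ : Fin n → Fin q) : ∑ k, cnt σ k = n := by
  unfold cnt
  rw [Finset.sum_comm]
  simp

lemma weight_update {q n : ℕ} (β : ℝ) (σ : Fin n → Fin q) (u : Fin n) (k : Fin q) :
    pottsWeight q n β (Function.update σ u k) =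
      Real.exp (β / n * (∑ j, (cnt σ j - if σ u = j then 1 else 0) ^ 2 + 1)) *
        Real.exp (fld β σ u k) := by
  unfold pottsWeight
  rw [energy_eq, ← Real.exp_add]
  congr 1
  have : ∑ j, cnt (Function.update σ u k) j ^ 2 =
      ∑ j, (cnt σ j - if σ u = j then 1 else 0) ^ 2 +
        (2 * (cnt σ k - if σ u = k then 1 else 0) + 1) := by
    have : ∀ j, cnt (Function.update σ u k) j ^ 2 =
      (cnt σ j - if σ u = j then 1 else 0) ^ 2 +
        (if k = j then 2 * (cnt σ j - if σ u = j then 1 else 0) + 1 else 0) := by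
      intro j
      rw [cnt_update]
      split_ifs <;> ring
    simp_rw [this]
    rw [Finset.sum_add_distrib]
    simp
  rw [this]
  unfold fld
  ring

lemma weight_pos (q n : ℕ) (β : ℝ) (σ) : 0 < pottsWeight q n β σ := Real.exp_pos _

lemma Z_pos (q n : ℕ) [NeZero q] (β : ℝ) : 0 < ∑ τ : Fin n → Fin q, pottsWeight q n β τ :=
  Finset.sum_pos (fun _ _ => weight_pos _ _ _ _) ⟨fun _ => 0, Finset.mem_univ _⟩

lemma mu_pos (q n : ℕ) [NeZero q] (β : ℝ) (σ) : 0 < pottsMeasure q n β σ :=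
  div_pos (weight_pos _ _ _ _) (Z_pos q n β)

lemma mu_sum (q n : ℕ) [NeZero q] (β : ℝ) : ∑ σ, pottsMeasure q n β σ = 1 := by
  unfold pottsMeasure
  rw [← Finset.sum_div, div_self (Z_pos q n β).ne']

lemma cond_eq {q n : ℕ} [NeZero q] (β : ℝ) (σ : Fin n → Fin q) (u : Fin n) (k : Fin q) :
    pottsMeasure q n β (Function.update σ u k) /
      ∑ j, pottsMeasure q n β (Function.update σ u j) = sm (fld β σ u) k := by
  unfold pottsMeasure sm
  simp_rw [weight_update]
  rw [← Finset.sum_div, ← Finset.mul_sum]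
  have h1 := (Z_pos q n β).ne'
  have h2 := (sumexp_pos (fld β σ u)).ne'
  have h3 := (Real.exp_pos (β / n * (∑ j, (cnt σ j - if σ u = j then 1 else 0) ^ 2 + 1))).ne'
  field_simp

lemma kernel_mulVec {q n : ℕ} [NeZero q] (β : ℝ) (f : (Fin n → Fin q) → ℝ) :
    (glauberKernel q n β).mulVec f = Pop q n β f := by
  ext σ
  rw [Pop_apply]
  unfold Matrix.mulVec dotProduct glauberKernel
  simp_rw [mul_assoc]
  rw [← Finset.mul_sum]
  congr 1
  simp_rw [Finset.sum_mul]
  rw [Finset.sum_comm]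
  apply Finset.sum_congr rfl
  intro u _
  simp_rw [ite_mul, zero_mul]
  rw [← Finset.sum_filter]
  symm
  apply Finset.sum_nbij' (fun k => Function.update σ u k) (fun τ => τ u)
  · intro k _
    simp only [Finset.mem_filter, Finset.mem_univ, true_and]
    intro v hv
    rw [Function.update_of_ne hv]
  · intro τ _; exact Finset.mem_univ _
  · intro k _; simp
  · intro τ hτ
    simp only [Finset.mem_filter, Finset.mem_univ, true_and] at hτ
    ext v
    by_cases hv : v = u
    · subst hv; simp
    · rw [Function.update_of_ne hv, hτ v hv]
  · intro k _
    rw [← cond_eq]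

lemma kernel_pow {q n : ℕ} [NeZero q] (β : ℝ) (t : ℕ) (f : (Fin n → Fin q) → ℝ) :
    (glauberKernel q n β ^ t).mulVec f = (Pop q n β ^ t) f := by
  induction t generalizing f with
  | zero => simp
  | succ t ih =>
    rw [pow_succ, pow_succ, ← Matrix.mulVec_mulVec, kernel_mulVec, ih]
    rfl

/-- Markov operator on functions -/
def IsMarkov {α : Type*} (K : (α → ℝ) →ₗ[ℝ] (α → ℝ)) : Prop :=
  (∀ f, (∀ x, 0 ≤ f x) → ∀ x, 0 ≤ K f x) ∧ K (fun _ => 1) = fun _ => 1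

/-- positive normalised functional -/
def IsState {α : Type*} (φ : (α → ℝ) →ₗ[ℝ] ℝ) : Prop :=
  (∀ f, (∀ x, 0 ≤ f x) → 0 ≤ φ f) ∧ φ (fun _ => 1) = 1

lemma IsState.mono {α : Type*} {φ : (α → ℝ) →ₗ[ℝ] ℝ} (h : IsState φ) {f g : α → ℝ}
    (hfg : ∀ x, f x ≤ g x) : φ f ≤ φ g := by
  have := h.1 (g - f) (fun x => by simpa using hfg x)
  rw [map_sub] at this
  linarith

lemma IsState.const {α : Type*} {φ : (α → ℝ) →ₗ[ℝ] ℝ} (h : IsState φ) (c : ℝ) :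
    φ (fun _ => c) = c := by
  have : (fun _ : α => c) = c • (fun _ : α => (1 : ℝ)) := by ext; simp
  rw [this, map_smul, h.2]; simp

lemma IsMarkov.comp {α : Type*} {K L : (α → ℝ) →ₗ[ℝ] (α → ℝ)} (hK : IsMarkov K)
    (hL : IsMarkov L) : IsMarkov (K * L) :=
  ⟨fun f hf x => hK.1 _ (hL.1 f hf) x, by
    rw [Module.End.mul_apply, hL.2, hK.2]⟩

lemma IsMarkov.pow {α : Type*} {K : (α → ℝ) →ₗ[ℝ] (α → ℝ)} (hK : IsMarkov K) (t : ℕ) :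
    IsMarkov (K ^ t) := by
  induction t with
  | zero => exact ⟨fun f hf x => by simpa using hf x, by simp⟩
  | succ t ih => rw [pow_succ]; exact ih.comp hK

/-- evaluation functional -/
def ev {α : Type*} (x : α) : (α → ℝ) →ₗ[ℝ] ℝ := LinearMap.proj x

lemma IsMarkov.ev {α : Type*} {K : (α → ℝ) →ₗ[ℝ] (α → ℝ)} (hK : IsMarkov K) (x : α) :
    IsState (ev x ∘ₗ K) :=
  ⟨fun f hf => hK.1 f hf x, by
    show K (fun _ => 1) x = 1
    rw [hK.2]⟩

lemma IsState.comp {α : Type*} {φ : (α → ℝ) →ₗ[ℝ] ℝ} {K : (α → ℝ) →ₗ[ℝ] (α → ℝ)}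
    (h : IsState φ) (hK : IsMarkov K) : IsState (φ ∘ₗ K) :=
  ⟨fun f hf => h.1 _ (hK.1 f hf), by rw [LinearMap.comp_apply, hK.2, h.2]⟩

lemma Pop_markov {q n : ℕ} [NeZero q] [NeZero n] (β : ℝ) : IsMarkov (Pop q n β) := by
  refine ⟨fun f hf σ => ?_, ?_⟩
  · rw [Pop_apply]
    exact mul_nonneg (by positivity) (Finset.sum_nonneg fun u _ => Finset.sum_nonneg fun k _ =>
      mul_nonneg (sm_pos _ _).le (hf _))
  · ext σ
    rw [Pop_apply]
    have : (n : ℝ) ≠ 0 := by exact_mod_cast NeZero.ne n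
    simp [sm_sum, this]

/-- the stationary state -/
noncomputable def muF (q n : ℕ) (β : ℝ) : ((Fin n → Fin q) → ℝ) →ₗ[ℝ] ℝ where
  toFun f := ∑ σ, pottsMeasure q n β σ * f σ
  map_add' f g := by simp [mul_add, Finset.sum_add_distrib]
  map_smul' c f := by
    simp only [Pi.smul_apply, smul_eq_mul, RingHom.id_apply]
    rw [Finset.mul_sum]
    exact Finset.sum_congr rfl (fun i _ => by ring)

lemma muF_apply {q n : ℕ} (β : ℝ) (f) :
    muF q n β f = ∑ σ, pottsMeasure q n β σ * f σ := rfl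

lemma muF_state (q n : ℕ) [NeZero q] (β : ℝ) : IsState (muF q n β) :=
  ⟨fun f hf => Finset.sum_nonneg fun σ _ => mul_nonneg (mu_pos q n β σ).le (hf σ), by
    rw [muF_apply]; simpa using mu_sum q n β⟩

lemma sum_update_swap {q n : ℕ} (u : Fin n) (F : (Fin n → Fin q) → (Fin n → Fin q) → ℝ) :
    ∑ σ, ∑ k, F σ (Function.update σ u k) = ∑ σ, ∑ k, F (Function.update σ u k) σ := by
  rw [← Finset.sum_product', ← Finset.sum_product']
  apply Finset.sum_nbij' (fun x => (Function.update x.1 u x.2, x.1 u))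
    (fun x => (Function.update x.1 u x.2, x.1 u)) <;> simp

lemma muF_stat {q n : ℕ} [NeZero q] [NeZero n] (β : ℝ) (f) :
    muF q n β (Pop q n β f) = muF q n β f := by
  have hn : (n : ℝ) ≠ 0 := by exact_mod_cast NeZero.ne n
  have key : ∀ u : Fin n, ∑ σ, pottsMeasure q n β σ *
      ∑ k, sm (fld β σ u) k * f (Function.update σ u k) = muF q n β f := by
    intro u
    have hinv : ∀ (σ : Fin n → Fin q) (k : Fin q),
        ∑ j, pottsMeasure q n β (Function.update (Function.update σ u k) u j) =
          ∑ j, pottsMeasure q n β (Function.update σ u j) := by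
      intro σ k; simp
    set g : (Fin n → Fin q) → ℝ := fun τ => pottsMeasure q n β τ * f τ /
      ∑ j, pottsMeasure q n β (Function.update τ u j) with hg
    have h1 : ∀ σ, pottsMeasure q n β σ * ∑ k, sm (fld β σ u) k * f (Function.update σ u k) =
        ∑ k, pottsMeasure q n β σ * g (Function.update σ u k) := by
      intro σ
      rw [Finset.mul_sum]
      apply Finset.sum_congr rfl
      intro k _
      simp only [hg]
      rw [hinv, ← cond_eq]
      ring
    simp_rw [h1]
    rw [sum_update_swap u (fun σ τ => pottsMeasure q n β σ * g τ), muF_apply]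
    apply Finset.sum_congr rfl
    intro σ _
    rw [← Finset.sum_mul]
    have : ∑ j, pottsMeasure q n β (Function.update σ u j) ≠ 0 :=
      (Finset.sum_pos (fun j _ => mu_pos q n β _) ⟨0, Finset.mem_univ _⟩).ne'
    simp only [hg]
    field_simp
  calc muF q n β (Pop q n β f) = ∑ σ, ∑ u, (1 / n) * (pottsMeasure q n β σ *
      ∑ k, sm (fld β σ u) k * f (Function.update σ u k)) := by
        rw [muF_apply]
        apply Finset.sum_congr rfl
        intro σ _
        rw [Pop_apply, ← Finset.mul_sum, ← Finset.mul_sum]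
        ring
    _ = ∑ u : Fin n, (1 / n) * muF q n β f := by
        rw [Finset.sum_comm]
        apply Finset.sum_congr rfl
        intro u _
        rw [← Finset.mul_sum, key]
    _ = muF q n β f := by
        simp
        field_simp

lemma muF_stat_pow {q n : ℕ} [NeZero q] [NeZero n] (β : ℝ) (t : ℕ) (f) :
    muF q n β ((Pop q n β ^ t) f) = muF q n β f := by
  induction t generalizing f with
  | zero => simp
  | succ t ih => rw [pow_succ, Module.End.mul_apply, ih, muF_stat]

end EM

namespace EM

/-- full field at deviation vector `x` -/
noncomputable def ff {q : ℕ} (β : ℝ) (x : Fin q → ℝ) : Fin q → ℝ :=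
  fun j => 2 * β / q + 2 * β * x j

lemma X_sum {q n : ℕ} [NeZero q] [NeZero n] (σ : Fin n → Fin q) : ∑ k, X σ k = 0 := by
  unfold X
  have hn : (n : ℝ) ≠ 0 := by exact_mod_cast NeZero.ne n
  have hq : (q : ℝ) ≠ 0 := by exact_mod_cast NeZero.ne q
  rw [Finset.sum_sub_distrib, ← Finset.sum_div, cnt_sum]
  simp

lemma cnt_nonneg {q n : ℕ} (σ : Fin n → Fin q) (k) : 0 ≤ cnt σ k :=
  Finset.sum_nonneg fun v _ => by split_ifs <;> norm_num

lemma cnt_le {q n : ℕ} (σ : Fin n → Fin q) (k) : cnt σ k ≤ n := by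
  rw [← cnt_sum σ]
  exact Finset.single_le_sum (f := cnt σ) (fun i _ => cnt_nonneg σ i) (Finset.mem_univ k)

lemma X_abs_le {q n : ℕ} [NeZero q] [NeZero n] (σ : Fin n → Fin q) (k) : |X σ k| ≤ 1 := by
  unfold X
  have hn : (0 : ℝ) < n := by exact_mod_cast Nat.pos_of_ne_zero (NeZero.ne n)
  have hq : (1 : ℝ) ≤ q := by exact_mod_cast Nat.pos_of_ne_zero (NeZero.ne q)
  have h1 : 0 ≤ cnt σ k / n := div_nonneg (cnt_nonneg σ k) hn.le
  have h2 : cnt σ k / n ≤ 1 := by rw [div_le_one hn]; exact cnt_le σ k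
  have h3 : 1 / (q : ℝ) ≤ 1 := by rw [div_le_one (by linarith)]; exact hq
  have h4 : 0 ≤ 1 / (q : ℝ) := by positivity
  rw [abs_le]; constructor <;> linarith

lemma V_nonneg {q n : ℕ} (σ : Fin n → Fin q) : 0 ≤ V σ := Finset.sum_nonneg fun _ _ => sq_nonneg _

lemma X_sq_le {q n : ℕ} (σ : Fin n → Fin q) (k) : X σ k ^ 2 ≤ V σ :=
  Finset.single_le_sum (f := fun k => X σ k ^ 2) (fun i _ => sq_nonneg _) (Finset.mem_univ k)

lemma X_abs_le_sqrt {q n : ℕ} (σ : Fin n → Fin q) (k) : |X σ k| ≤ √(V σ) := by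
  rw [← Real.sqrt_sq_eq_abs]
  exact Real.sqrt_le_sqrt (X_sq_le σ k)

lemma V_le {q n : ℕ} [NeZero q] [NeZero n] (σ : Fin n → Fin q) : V σ ≤ q := by
  unfold V
  calc _ ≤ ∑ k : Fin q, (1 : ℝ) := by
        apply Finset.sum_le_sum
        intro k _
        have := X_abs_le σ k
        rw [← sq_abs]
        nlinarith [abs_nonneg (X σ k)]
    _ = q := by simp

lemma X_update {q n : ℕ} (σ : Fin n → Fin q) (u : Fin n) (j k : Fin q) :
    X (Function.update σ u j) k =
      X σ k + (1 / n) * ((if j = k then 1 else 0) - (if σ u = k then 1 else 0)) := by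
  unfold X
  rw [cnt_update]
  ring

lemma fld_eq {q n : ℕ} [NeZero q] (β : ℝ) (σ : Fin n → Fin q) (u : Fin n) :
    fld β σ u = fun j => ff β (X σ) j + (-(2 * β / n) * if σ u = j then 1 else 0) := by
  ext j
  unfold fld ff X
  ring

lemma sm_fld_near {q n : ℕ} [NeZero q] (β : ℝ) (hβ : 0 ≤ β) (σ : Fin n → Fin q) (u : Fin n) (k) :
    |sm (fld β σ u) k - sm (ff β (X σ)) k| ≤ 4 * β / n := by
  rw [fld_eq]
  have := sm_lip (ff β (X σ)) (fun j => -(2 * β / n) * if σ u = j then 1 else 0) (2 * β / n)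
    (fun j => by
      have : 0 ≤ 2 * β / n := by positivity
      split_ifs
      · rw [mul_one, abs_neg, abs_of_nonneg this]
      · simpa using this) k
  calc _ ≤ _ := this
    _ = _ := by ring

/-- average update probabilities -/
noncomputable def pbar {q n : ℕ} (β : ℝ) (σ : Fin n → Fin q) (k : Fin q) : ℝ :=
  (1 / n) * ∑ u, sm (fld β σ u) k

lemma pbar_near {q n : ℕ} [NeZero q] [NeZero n] (β : ℝ) (hβ : 0 ≤ β) (σ : Fin n → Fin q) (k) :
    |pbar β σ k - sm (ff β (X σ)) k| ≤ 4 * β / n := by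
  have hn : (0 : ℝ) < n := by exact_mod_cast Nat.pos_of_ne_zero (NeZero.ne n)
  have : pbar β σ k - sm (ff β (X σ)) k =
      (1 / n) * ∑ u : Fin n, (sm (fld β σ u) k - sm (ff β (X σ)) k) := by
    unfold pbar
    rw [Finset.sum_sub_distrib]
    simp
    field_simp
  rw [this, abs_mul, abs_of_pos (by positivity)]
  calc _ ≤ (1 / (n : ℝ)) * ∑ u : Fin n, 4 * β / n := by
        apply mul_le_mul_of_nonneg_left _ (by positivity)
        refine (Finset.abs_sum_le_sum_abs _ _).trans ?_
        exact Finset.sum_le_sum fun u _ => sm_fld_near β hβ σ u k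
    _ = _ := by
        simp
        field_simp

lemma avg_ite {q n : ℕ} [NeZero q] [NeZero n] (σ : Fin n → Fin q) (k : Fin q) :
    (1 / (n : ℝ)) * ∑ u, (if σ u = k then (1 : ℝ) else 0) = X σ k + 1 / q := by
  unfold X cnt
  ring

lemma Pop_X {q n : ℕ} [NeZero q] [NeZero n] (β : ℝ) (σ : Fin n → Fin q) (k : Fin q) :
    Pop q n β (fun σ => X σ k) σ = X σ k + (1 / n) * (pbar β σ k - 1 / q - X σ k) := by
  have hn : (n : ℝ) ≠ 0 := by exact_mod_cast NeZero.ne n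
  have h : ∀ u, ∑ j, sm (fld β σ u) j * X (Function.update σ u j) k =
      X σ k + (1 / n) * (sm (fld β σ u) k - if σ u = k then 1 else 0) := by
    intro u
    simp_rw [X_update]
    have : ∀ j, sm (fld β σ u) j * (X σ k + (1 / n) * ((if j = k then 1 else 0) -
        (if σ u = k then 1 else 0))) = sm (fld β σ u) j * (X σ k - (1 / n) *
        (if σ u = k then 1 else 0)) + (if j = k then (1 / n) * sm (fld β σ u) j else 0) := by
      intro j; split_ifs <;> ring
    simp_rw [this]
    rw [Finset.sum_add_distrib, ← Finset.sum_mul, sm_sum]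
    simp
    split_ifs <;> ring
  rw [Pop_apply]
  simp_rw [h]
  rw [Finset.sum_add_distrib, ← Finset.mul_sum, Finset.sum_sub_distrib, mul_add]
  have h3 := avg_ite σ k
  have h4 : (1 / (n : ℝ)) * ∑ u, sm (fld β σ u) k = pbar β σ k := rfl
  have h5 : (1 / (n : ℝ)) * ∑ u : Fin n, X σ k = X σ k := by simp; field_simp
  rw [h5, mul_sub, h4, h3]
  ring

lemma ff_sum {q n : ℕ} [NeZero q] [NeZero n] (β : ℝ) (σ : Fin n → Fin q) :
    ∑ k, 2 * β * X σ k = 0 := by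
  rw [← Finset.mul_sum, X_sum, mul_zero]

lemma mean_step {q n : ℕ} [NeZero q] [NeZero n] (β : ℝ) (hβ : 0 ≤ β) (σ : Fin n → Fin q)
    (k : Fin q) :
    |Pop q n β (fun σ => X σ k) σ - (1 - (1 - 2 * β / q) / n) * X σ k| ≤
      (((2 + 2 * q) * (4 * β ^ 2) + 4 * β) / n) * (V σ + 1 / n) := by
  have hn : (0 : ℝ) < n := by exact_mod_cast Nat.pos_of_ne_zero (NeZero.ne n)
  have h1 := pbar_near β hβ σ k
  have h2 := sm_taylor (fun j => 2 * β * X σ j) (2 * β / q) (2 * β * √(V σ)) (ff_sum β σ)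
    (fun j => by
      rw [abs_mul, abs_of_nonneg (by positivity)]
      exact mul_le_mul_of_nonneg_left (X_abs_le_sqrt σ j) (by positivity)) k
  rw [mul_pow, Real.sq_sqrt (V_nonneg σ)] at h2
  have e : (fun j => 2 * β / q + 2 * β * X σ j) = ff β (X σ) := rfl
  rw [e] at h2
  rw [Pop_X]
  have : X σ k + (1 / n) * (pbar β σ k - 1 / q - X σ k) - (1 - (1 - 2 * β / q) / n) * X σ k =
      (1 / n) * ((pbar β σ k - sm (ff β (X σ)) k) +
        (sm (ff β (X σ)) k - 1 / q - 2 * β * X σ k / q)) := by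
    field_simp
    ring
  rw [this, abs_mul, abs_of_pos (by positivity)]
  have h3 : |(pbar β σ k - sm (ff β (X σ)) k) +
        (sm (ff β (X σ)) k - 1 / q - 2 * β * X σ k / q)| ≤
       ((2 + 2 * q) * (4 * β ^ 2) + 4 * β) * (V σ + 1 / n) := by
    refine (abs_add_le _ _).trans ?_
    have hV := V_nonneg σ
    have a1 : 0 ≤ (2 + 2 * (q : ℝ)) * (4 * β ^ 2) * (1 / n) := by positivity
    have a2 : 0 ≤ 4 * β * V σ := by positivity
    have a3 : 4 * β / n = 4 * β * (1 / n) := by ring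
    have a4 : (2 * β) ^ 2 = 4 * β ^ 2 := by ring
    rw [a4] at h2
    rw [a3] at h1
    nlinarith
  calc _ ≤ (1 / (n : ℝ)) * (((2 + 2 * q) * (4 * β ^ 2) + 4 * β) * (V σ + 1 / n)) :=
        mul_le_mul_of_nonneg_left h3 (by positivity)
    _ = _ := by ring

/-- squared distance to `y` -/
noncomputable def fy {q n : ℕ} (y : Fin q → ℝ) (σ : Fin n → Fin q) : ℝ :=
  ∑ k, (X σ k - y k) ^ 2

lemma fy_update {q n : ℕ} [NeZero n] (y : Fin q → ℝ) (σ : Fin n → Fin q) (u : Fin n) (j : Fin q) :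
    fy y (Function.update σ u j) ≤
      fy y σ + (2 / n) * ((X σ j - y j) - (X σ (σ u) - y (σ u))) + 2 / n ^ 2 := by
  have hn : (0 : ℝ) < n := by exact_mod_cast Nat.pos_of_ne_zero (NeZero.ne n)
  unfold fy
  have : ∀ k, (X (Function.update σ u j) k - y k) ^ 2 ≤ (X σ k - y k) ^ 2 +
      ((if j = k then (2 / n) * (X σ k - y k) else 0) -
       (if σ u = k then (2 / n) * (X σ k - y k) else 0)) +
      ((if j = k then 1 / (n : ℝ) ^ 2 else 0) + (if σ u = k then 1 / (n : ℝ) ^ 2 else 0)) := by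
    intro k
    rw [X_update]
    have : 0 < 1 / (n : ℝ) ^ 2 := by positivity
    have h2 : (1 / (n : ℝ)) ^ 2 = 1 / n ^ 2 := by ring
    split_ifs
    · nlinarith
    · rw [← h2]; apply le_of_eq; ring
    · rw [← h2]; apply le_of_eq; ring
    · apply le_of_eq; ring
  refine (Finset.sum_le_sum fun k _ => this k).trans (le_of_eq ?_)
  rw [Finset.sum_add_distrib, Finset.sum_add_distrib, Finset.sum_sub_distrib,
    Finset.sum_add_distrib]
  simp
  ring

lemma avg_comp {q n : ℕ} [NeZero q] [NeZero n] (σ : Fin n → Fin q) (g : Fin q → ℝ) :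
    (1 / (n : ℝ)) * ∑ u, g (σ u) = ∑ k, (X σ k + 1 / q) * g k := by
  simp_rw [← avg_ite σ, mul_assoc, ← Finset.mul_sum, Finset.sum_mul]
  rw [Finset.sum_comm]
  simp

lemma fy_step0 {q n : ℕ} [NeZero q] [NeZero n] (β : ℝ) (y : Fin q → ℝ)
    (σ : Fin n → Fin q) :
    Pop q n β (fy y) σ ≤ fy y σ +
      (2 / n) * ∑ k, (X σ k - y k) * (pbar β σ k - 1 / q - X σ k) + 2 / n ^ 2 := by
  have hn : (0 : ℝ) < n := by exact_mod_cast Nat.pos_of_ne_zero (NeZero.ne n)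
  rw [Pop_apply]
  have h1 : ∀ u, ∑ j, sm (fld β σ u) j * fy y (Function.update σ u j) ≤
      (fy y σ + 2 / n ^ 2) + (2 / n) * (∑ j, sm (fld β σ u) j * (X σ j - y j) -
        (X σ (σ u) - y (σ u))) := by
    intro u
    calc _ ≤ ∑ j, sm (fld β σ u) j * (fy y σ + (2 / n) * ((X σ j - y j) -
          (X σ (σ u) - y (σ u))) + 2 / n ^ 2) :=
          Finset.sum_le_sum fun j _ => mul_le_mul_of_nonneg_left (fy_update y σ u j) (sm_pos _ _).le
      _ = ∑ j, (sm (fld β σ u) j * (fy y σ - (2 / n) * (X σ (σ u) - y (σ u)) + 2 / n ^ 2) +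
            (2 / n) * (sm (fld β σ u) j * (X σ j - y j))) :=
          Finset.sum_congr rfl fun j _ => by ring
      _ = _ := by
          rw [Finset.sum_add_distrib, ← Finset.sum_mul, sm_sum, ← Finset.mul_sum]
          ring
  calc _ ≤ (1 / (n : ℝ)) * ∑ u, ((fy y σ + 2 / n ^ 2) + (2 / n) *
        (∑ j, sm (fld β σ u) j * (X σ j - y j) - (X σ (σ u) - y (σ u)))) := by
        apply mul_le_mul_of_nonneg_left (Finset.sum_le_sum fun u _ => h1 u) (by positivity)
    _ = (fy y σ + 2 / n ^ 2) + (2 / n) * ((1 / n) * ∑ u, ∑ j, sm (fld β σ u) j * (X σ j - y j)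
          - (1 / n) * ∑ u, (X σ (σ u) - y (σ u))) := by
        rw [Finset.sum_add_distrib, ← Finset.mul_sum, Finset.sum_sub_distrib]
        simp
        field_simp
    _ = _ := by
        rw [avg_comp σ (fun k => X σ k - y k), Finset.sum_comm, Finset.mul_sum,
          ← Finset.sum_sub_distrib]
        simp_rw [← Finset.sum_mul]
        have : ∀ i, (1 / (n : ℝ)) * ((∑ u, sm (fld β σ u) i) * (X σ i - y i)) -
            (X σ i + 1 / q) * (X σ i - y i) = (X σ i - y i) * (pbar β σ i - 1 / q - X σ i) := by
          intro i; unfold pbar; ring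
        simp_rw [this]
        ring

/-- indicator of the bad set -/
noncomputable def bad {q n : ℕ} (δ : ℝ) (σ : Fin n → Fin q) : ℝ := if V σ ≤ δ ^ 2 then 0 else 1

lemma ff_near {q : ℕ} [NeZero q] (β δ : ℝ) (hβ : 0 ≤ β) (x : Fin q → ℝ) (h : ∀ k, |x k| ≤ δ) (k) :
    |ff β x k - 2 * β / q| ≤ 2 * β * δ := by
  unfold ff
  rw [add_sub_cancel_left, abs_mul, abs_of_nonneg (by positivity)]
  exact mul_le_mul_of_nonneg_left (h k) (by positivity)

lemma ff_onesided {q : ℕ} [NeZero q] (β δ : ℝ) (hβ : 0 ≤ β) (x y : Fin q → ℝ)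
    (hx : ∀ k, |x k| ≤ δ) (hy : ∀ k, |y k| ≤ δ) :
    ∑ k, (x k - y k) * (sm (ff β x) k - sm (ff β y) k) ≤
      (2 * β / q + 8 * β ^ 2 * δ) * ∑ k, (x k - y k) ^ 2 := by
  rcases hβ.eq_or_lt with h0 | h0
  · subst h0
    have : ff 0 x = ff 0 y := by ext; simp [ff]
    rw [this]; simp
  have e : (fun j => ff β y j + 2 * β * (x j - y j)) = ff β x := by
    ext j; unfold ff; ring
  have := sm_onesided (ff β y) (fun j => 2 * β * (x j - y j)) (2 * β / q) (2 * β * δ)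
    (ff_near β δ hβ y hy) (fun j => by
      have := ff_near β δ hβ x hx j
      rw [← e] at this; exact this)
  rw [e, ← Finset.sum_sub_distrib] at this
  have e2 : ∑ k, (2 * β * (x k - y k) * sm (ff β x) k - 2 * β * (x k - y k) * sm (ff β y) k) =
      2 * β * ∑ k, (x k - y k) * (sm (ff β x) k - sm (ff β y) k) := by
    rw [Finset.mul_sum]; exact Finset.sum_congr rfl fun i _ => by ring
  have e3 : ∑ k, (2 * β * (x k - y k)) ^ 2 = (2 * β) ^ 2 * ∑ k, (x k - y k) ^ 2 := by
    rw [Finset.mul_sum]; exact Finset.sum_congr rfl fun i _ => by ring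
  rw [e2, e3] at this
  have h2 : 0 < 2 * β := by linarith
  apply le_of_mul_le_mul_left _ h2
  calc _ ≤ _ := this
    _ = _ := by ring

lemma fy_step {q n : ℕ} [NeZero q] [NeZero n] (β : ℝ) (hβ : 0 ≤ β) (δ : ℝ) (hδ : 0 < δ)
    (hδ2 : δ ≤ 1 / 2) (hρ : 0 ≤ 1 - 2 * β / q) (hδ3 : 16 * β ^ 2 * δ ≤ (1 - 2 * β / q) / 4)
    (y : Fin q → ℝ) (hy : ∀ k, |y k| ≤ 2 * δ) (σ : Fin n → Fin q) :
    Pop q n β (fy y) σ ≤ (1 - (3 / 2) * (1 - 2 * β / q) / n) * fy y σ +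
      (2 / n) * ∑ k, (X σ k - y k) * (sm (ff β y) k - 1 / q - y k) +
      (2 + 16 * q * β + 18 * q) / n ^ 2 + (2 + 16 * q * β + 18 * q) / n * bad δ σ := by
  have hn : (0 : ℝ) < n := by exact_mod_cast Nat.pos_of_ne_zero (NeZero.ne n)
  have hq0 : (0 : ℝ) < q := by exact_mod_cast Nat.pos_of_ne_zero (NeZero.ne q)
  set ρ := 1 - 2 * β / q with hρd
  have hρ1 : ρ ≤ 1 := by
    have : 0 ≤ 2 * β / q := by positivity
    linarith
  have hdiff : ∀ k, |X σ k - y k| ≤ 2 := fun k =>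
    (abs_sub _ _).trans (by linarith [X_abs_le σ k, hy k])
  have hbd : ∀ (a : ℝ) (z : Fin q → ℝ), (∀ k, |z k| ≤ a) →
      ∑ k, (X σ k - y k) * z k ≤ q * (2 * a) := by
    intro a z hz
    calc _ ≤ ∑ k : Fin q, (2 * a) := by
          apply Finset.sum_le_sum
          intro k _
          calc _ ≤ |(X σ k - y k) * z k| := le_abs_self _
            _ = |X σ k - y k| * |z k| := abs_mul _ _
            _ ≤ 2 * a := mul_le_mul (hdiff k) (hz k) (abs_nonneg _) (by norm_num)
      _ = _ := by simp
  have s0 := fy_step0 β y σ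
  have s1 : ∑ k, (X σ k - y k) * (pbar β σ k - 1 / q - X σ k) =
      ∑ k, (X σ k - y k) * (pbar β σ k - sm (ff β (X σ)) k) +
      ∑ k, (X σ k - y k) * (sm (ff β (X σ)) k - sm (ff β y) k) - fy y σ +
      ∑ k, (X σ k - y k) * (sm (ff β y) k - 1 / q - y k) := by
    unfold fy
    rw [← Finset.sum_add_distrib, ← Finset.sum_sub_distrib, ← Finset.sum_add_distrib]
    exact Finset.sum_congr rfl fun k _ => by ring
  have s2 := hbd (4 * β / n) (fun k => pbar β σ k - sm (ff β (X σ)) k) (pbar_near β hβ σ)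
  have s3 : ∑ k, (X σ k - y k) * (sm (ff β (X σ)) k - sm (ff β y) k) - fy y σ ≤
      - (3 / 4 * ρ) * fy y σ + 9 * q * bad δ σ := by
    have hf0 : 0 ≤ fy y σ := Finset.sum_nonneg fun _ _ => sq_nonneg _
    unfold bad
    split_ifs with hg
    · have hx : ∀ k, |X σ k| ≤ 2 * δ := fun k => by
        have h1 : √(V σ) ≤ δ := by
          rw [show δ = √(δ ^ 2) from (Real.sqrt_sq hδ.le).symm]
          exact Real.sqrt_le_sqrt hg
        linarith [X_abs_le_sqrt σ k]
      have := ff_onesided β (2 * δ) hβ (X σ) y hx hy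
      change _ ≤ _ * fy y σ at this
      have e1 : 2 * β / q = 1 - ρ := by rw [hρd]; ring
      rw [e1] at this
      nlinarith
    · have h2 := hbd 1 (fun k => sm (ff β (X σ)) k - sm (ff β y) k) (fun k => by
        have a1 := sm_pos (ff β (X σ)) k
        have a2 := sm_pos (ff β y) k
        have a3 := sm_le_one (ff β (X σ)) k
        have a4 := sm_le_one (ff β y) k
        rw [abs_le]; constructor <;> linarith)
      nlinarith
  have s4 : (2 / n) * ∑ k, (X σ k - y k) * (pbar β σ k - 1 / q - X σ k) ≤
      (2 / n) * (q * (2 * (4 * β / n)) + (- (3 / 4 * ρ) * fy y σ + 9 * q * bad δ σ) +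
        ∑ k, (X σ k - y k) * (sm (ff β y) k - 1 / q - y k)) := by
    apply mul_le_mul_of_nonneg_left _ (by positivity)
    rw [s1]; linarith
  have hb0 : 0 ≤ bad δ σ := by unfold bad; split_ifs <;> norm_num
  have s5 : 0 ≤ (18 * (q : ℝ)) / n ^ 2 := by positivity
  have s6 : 0 ≤ (2 + 16 * (q : ℝ) * β) / n * bad δ σ := by positivity
  calc _ ≤ _ := s0
    _ ≤ fy y σ + (2 / n) * (q * (2 * (4 * β / n)) + (- (3 / 4 * ρ) * fy y σ + 9 * q * bad δ σ) +
        ∑ k, (X σ k - y k) * (sm (ff β y) k - 1 / q - y k)) + 2 / n ^ 2 := by linarith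
    _ = (1 - (3 / 2) * ρ / n) * fy y σ +
      (2 / n) * ∑ k, (X σ k - y k) * (sm (ff β y) k - 1 / q - y k) +
      (2 + 16 * q * β) / n ^ 2 + (18 * q) / n * bad δ σ := by field_simp; ring
    _ ≤ _ := by
      have e1 : (2 + 16 * (q : ℝ) * β + 18 * q) / n ^ 2 = (2 + 16 * q * β) / n ^ 2 +
          (18 * (q : ℝ)) / n ^ 2 := by ring
      have e2 : (2 + 16 * (q : ℝ) * β + 18 * q) / n * bad δ σ = (2 + 16 * q * β) / n * bad δ σ +
          (18 * (q : ℝ)) / n * bad δ σ := by ring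
      rw [e1, e2]; linarith

lemma bad_nonneg {q n : ℕ} (δ : ℝ) (σ : Fin n → Fin q) : 0 ≤ bad δ σ := by
  unfold bad; split_ifs <;> norm_num

lemma bad_le_one {q n : ℕ} (δ : ℝ) (σ : Fin n → Fin q) : bad δ σ ≤ 1 := by
  unfold bad; split_ifs <;> norm_num

lemma V_step {q n : ℕ} [NeZero q] [NeZero n] (β : ℝ) (hβ : 0 ≤ β) (δ : ℝ) (hδ : 0 < δ)
    (hδ2 : δ ≤ 1 / 2) (hρ : 0 ≤ 1 - 2 * β / q) (hδ3 : 16 * β ^ 2 * δ ≤ (1 - 2 * β / q) / 4)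
    (σ : Fin n → Fin q) :
    Pop q n β V σ ≤ (1 - (3 / 2) * (1 - 2 * β / q) / n) * V σ +
      (2 + 16 * q * β + 18 * q) / n ^ 2 + (2 + 16 * q * β + 18 * q) / n * bad δ σ := by
  have := fy_step β hβ δ hδ hδ2 hρ hδ3 (fun _ => 0) (fun k => by simpa using hδ.le) σ
  have e : (fy (fun _ => 0) : (Fin n → Fin q) → ℝ) = V := by ext; simp [fy, V]
  have e2 : ∀ k, sm (ff β (fun _ : Fin q => 0)) k = 1 / q := by
    intro k
    have : ff β (fun _ : Fin q => 0) = fun _ => 2 * β / q := by ext; simp [ff]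
    rw [this, sm_const]
  rw [e] at this
  simpa [e2] using this

end EM

namespace EM

lemma rec_le (y b : ℕ → ℝ) (r A B : ℝ) (T : ℕ) (hr : 0 < r) (hr1 : r ≤ 1) (hA : 0 ≤ A) (hB : 0 ≤ B)
    (hb : ∀ t, 0 ≤ b t) (h : ∀ t < T, y (t + 1) ≤ (1 - r) * y t + A + B * b t) :
    ∀ t ≤ T, y t ≤ (1 - r) ^ t * y 0 + A / r + B * ∑ s ∈ range t, b s := by
  intro t
  induction t with
  | zero => intro _; simp; positivity
  | succ t ih =>
    intro ht
    have h1 := ih (by omega)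
    have h2 := h t (by omega)
    rw [Finset.sum_range_succ, pow_succ]
    have h3 := mul_le_mul_of_nonneg_left h1 (by linarith : 0 ≤ 1 - r)
    have h4 : A / r * r = A := by field_simp
    have h5 : 0 ≤ B * ∑ s ∈ range t, b s := mul_nonneg hB (Finset.sum_nonneg fun s _ => hb s)
    nlinarith

/-- contraction rate -/
noncomputable def rho (q : ℕ) (β : ℝ) : ℝ := 1 - 2 * β / q

/-- main constant -/
noncomputable def KK (q : ℕ) (β : ℝ) : ℝ :=
  (2 + 2 * q) * (4 * β ^ 2) + 4 * β + (2 + 16 * q * β + 18 * q)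

/-- standing assumptions on parameters -/
structure Par (q : ℕ) (β δ : ℝ) : Prop where
  hβ : 0 ≤ β
  hδ : 0 < δ
  hδ2 : δ ≤ 1 / 2
  hρ : 0 < rho q β
  hδ4 : 32 * β ^ 2 * δ ≤ rho q β / 4

lemma Par.hδ3 {q : ℕ} {β δ : ℝ} (h : Par q β δ) : 16 * β ^ 2 * δ ≤ rho q β / 4 := by
  have := h.hδ
  have : 0 ≤ β ^ 2 * δ := by positivity
  linarith [h.hδ4]

lemma Par.rho_le {q : ℕ} {β δ : ℝ} (h : Par q β δ) : rho q β ≤ 1 := by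
  unfold rho
  have := h.hβ
  have : 0 ≤ 2 * β / q := by positivity
  linarith

lemma Par.K1 {q : ℕ} {β δ : ℝ} (h : Par q β δ) : (2 + 2 * q) * (4 * β ^ 2) + 4 * β ≤ KK q β := by
  unfold KK; have := h.hβ
  have : (0:ℝ) ≤ (2 + 16 * q * β + 18 * q) := by positivity
  linarith

lemma Par.K2 {q : ℕ} {β δ : ℝ} (h : Par q β δ) : 2 + 16 * q * β + 18 * q ≤ KK q β := by
  unfold KK; have := h.hβ
  have : (0:ℝ) ≤ (2 + 2 * q) * (4 * β ^ 2) + 4 * β := by positivity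
  linarith

lemma Par.Kpos {q : ℕ} {β δ : ℝ} (h : Par q β δ) : 0 < KK q β := by
  have := h.K2; have := h.hβ
  have : (0:ℝ) < (2 + 16 * q * β + 18 * q) := by positivity
  linarith

lemma ncast_pos (n : ℕ) [NeZero n] : (0 : ℝ) < n := by
  exact_mod_cast Nat.pos_of_ne_zero (NeZero.ne n)

lemma ncast_one_le (n : ℕ) [NeZero n] : (1 : ℝ) ≤ n := by
  exact_mod_cast Nat.pos_of_ne_zero (NeZero.ne n)

lemma mean_step' {q n : ℕ} [NeZero q] [NeZero n] {β δ : ℝ} (h : Par q β δ) (σ : Fin n → Fin q)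
    (k : Fin q) :
    |Pop q n β (fun σ => X σ k) σ - (1 - rho q β / n) * X σ k| ≤ KK q β / n * (V σ + 1 / n) := by
  have hn := ncast_pos n
  refine (mean_step β h.hβ σ k).trans ?_
  have : 0 ≤ V σ + 1 / n := add_nonneg (V_nonneg σ) (by positivity)
  have := h.K1
  gcongr

lemma fy_step' {q n : ℕ} [NeZero q] [NeZero n] {β δ : ℝ} (h : Par q β δ)
    (y : Fin q → ℝ) (hy : ∀ k, |y k| ≤ 2 * δ) (σ : Fin n → Fin q) :
    Pop q n β (fy y) σ ≤ (1 - (3 / 2) * rho q β / n) * fy y σ +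
      (2 / n) * ∑ k, (X σ k - y k) * (sm (ff β y) k - 1 / q - y k) +
      KK q β / n ^ 2 + KK q β / n * bad δ σ := by
  have hn := ncast_pos n
  refine (fy_step β h.hβ δ h.hδ h.hδ2 h.hρ.le h.hδ3 y hy σ).trans ?_
  have := bad_nonneg δ σ
  have := h.K2
  unfold rho
  gcongr

lemma V_step' {q n : ℕ} [NeZero q] [NeZero n] {β δ : ℝ} (h : Par q β δ) (σ : Fin n → Fin q) :
    Pop q n β V σ ≤ (1 - (3 / 2) * rho q β / n) * V σ +
      KK q β / n ^ 2 + KK q β / n * bad δ σ := by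
  have hn := ncast_pos n
  refine (V_step β h.hβ δ h.hδ h.hδ2 h.hρ.le h.hδ3 σ).trans ?_
  have := bad_nonneg δ σ
  have := h.K2
  unfold rho
  gcongr

/-- expectation at time `t` started from the state `φ` -/
noncomputable def Et {q n : ℕ} (β : ℝ) (φ : ((Fin n → Fin q) → ℝ) →ₗ[ℝ] ℝ) (t : ℕ) :
    ((Fin n → Fin q) → ℝ) →ₗ[ℝ] ℝ := φ ∘ₗ (Pop q n β ^ t)

lemma Et_state {q n : ℕ} [NeZero q] [NeZero n] (β : ℝ) {φ : ((Fin n → Fin q) → ℝ) →ₗ[ℝ] ℝ}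
    (h : IsState φ) (t : ℕ) : IsState (Et β φ t) := h.comp ((Pop_markov β).pow t)

lemma Et_succ {q n : ℕ} (β : ℝ) (φ : ((Fin n → Fin q) → ℝ) →ₗ[ℝ] ℝ) (t : ℕ) (f) :
    Et β φ (t + 1) f = Et β φ t (Pop q n β f) := by
  unfold Et
  rw [pow_succ]; rfl

lemma Et_zero {q n : ℕ} (β : ℝ) (φ : ((Fin n → Fin q) → ℝ) →ₗ[ℝ] ℝ) (f) :
    Et β φ 0 f = φ f := by
  unfold Et
  rw [pow_zero]; rfl

lemma Et_bad_nonneg {q n : ℕ} [NeZero q] [NeZero n] (β δ : ℝ)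
    {φ : ((Fin n → Fin q) → ℝ) →ₗ[ℝ] ℝ} (h : IsState φ) (t : ℕ) : 0 ≤ Et β φ t (bad δ) :=
  (Et_state β h t).1 _ (bad_nonneg δ)

lemma state_const {α : Type*} {φ : (α → ℝ) →ₗ[ℝ] ℝ} (h : IsState φ) (c : ℝ) (f : α → ℝ) (a : ℝ) :
    φ (fun x => a * f x + c) = a * φ f + c := by
  have e : (fun x => a * f x + c) = a • f + fun _ => c := by ext; simp
  rw [e, map_add, map_smul, h.const]; simp

/-- Lyapunov weight for the mean -/
noncomputable def aa (q : ℕ) (β : ℝ) : ℝ := 2 * KK q β / rho q β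

lemma rho_div {q n : ℕ} [NeZero n] {β δ : ℝ} (h : Par q β δ) :
    0 < rho q β / n ∧ rho q β / n ≤ 1 := by
  have hn := ncast_pos n
  refine ⟨div_pos h.hρ hn, ?_⟩
  rw [div_le_one hn]
  exact h.rho_le.trans (ncast_one_le n)

/-- error constant for the mean -/
noncomputable def C1 (q : ℕ) (β : ℝ) : ℝ := KK q β * (1 + aa q β) / rho q β + aa q β * KK q β

lemma mean_lower {q n : ℕ} [NeZero q] [NeZero n] {β δ : ℝ} (h : Par q β δ)
    {φ : ((Fin n → Fin q) → ℝ) →ₗ[ℝ] ℝ} (hφ : IsState φ) (t : ℕ)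
    (hb : ∑ s ∈ range t, Et β φ s (bad δ) ≤ 1) (s : ℝ) (hs : |s| = 1) (k : Fin q) :
    (1 - rho q β / n) ^ t * (s * φ (fun σ => X σ k) - aa q β * φ V) - C1 q β / n ≤
      s * Et β φ t (fun σ => X σ k) := by
  have hn := ncast_pos n
  have hK := h.Kpos
  have hρ := h.hρ
  have ha : 0 < aa q β := by unfold aa; positivity
  obtain ⟨hr0, hr1⟩ := rho_div (n := n) h
  set ψ : (Fin n → Fin q) → ℝ := s • (fun σ => X σ k) - aa q β • V with hψ
  have step : ∀ σ, (1 - rho q β / n) * ψ σ - KK q β * (1 + aa q β) / n ^ 2 -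
      (aa q β * KK q β / n) * bad δ σ ≤ Pop q n β ψ σ := by
    intro σ
    have e : Pop q n β ψ σ = s * Pop q n β (fun σ => X σ k) σ - aa q β * Pop q n β V σ := by
      rw [hψ, map_sub, map_smul, map_smul]; rfl
    have e2 : ψ σ = s * X σ k - aa q β * V σ := rfl
    have h1 := mean_step' h σ k
    have h2 := V_step' h σ
    have h3 : s * ((1 - rho q β / n) * X σ k) - KK q β / n * (V σ + 1 / n) ≤
        s * Pop q n β (fun σ => X σ k) σ := by
      have : |s * (Pop q n β (fun σ => X σ k) σ - (1 - rho q β / n) * X σ k)| ≤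
          KK q β / n * (V σ + 1 / n) := by rw [abs_mul, hs, one_mul]; exact h1
      have := (abs_le.1 this).1
      linarith
    have h4 := mul_le_mul_of_nonneg_left h2 ha.le
    rw [e, e2]
    have h5 : aa q β * (rho q β / 2) = KK q β := by unfold aa; field_simp
    have h6 : KK q β / n * V σ = aa q β * ((1/2) * rho q β / n) * V σ := by
      rw [← h5]; ring
    have h7 : KK q β / n * (V σ + 1 / n) = aa q β * ((1/2) * rho q β / n) * V σ + KK q β / n ^ 2 := by
      rw [mul_add, h6]; ring
    rw [h7] at h3
    have h8 : KK q β * (1 + aa q β) / n ^ 2 = KK q β / n ^ 2 + aa q β * (KK q β / n ^ 2) := by ring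
    have h9 : aa q β * KK q β / n * bad δ σ = aa q β * (KK q β / n * bad δ σ) := by ring
    rw [h8, h9]
    have h10 : aa q β * ((1 - (3 / 2) * rho q β / n) * V σ +
      KK q β / n ^ 2 + KK q β / n * bad δ σ) = aa q β * V σ - aa q β * (rho q β / n) * V σ -
        aa q β * ((1/2) * rho q β / n) * V σ + aa q β * (KK q β / n ^ 2) +
         aa q β * (KK q β / n * bad δ σ) := by ring
    rw [h10] at h4
    linarith
  have hrec := rec_le (fun t => - Et β φ t ψ) (fun t => Et β φ t (bad δ)) (rho q β / n)
    (KK q β * (1 + aa q β) / n ^ 2) (aa q β * KK q β / n) t hr0 hr1 (by positivity) (by positivity)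
    (Et_bad_nonneg β δ hφ) (fun t _ => by
      have hE := Et_state β hφ t
      have := hE.mono step
      have e : (fun σ => (1 - rho q β / n) * ψ σ - KK q β * (1 + aa q β) / n ^ 2 -
        (aa q β * KK q β / n) * bad δ σ) = (1 - rho q β / n) • ψ - (fun _ => KK q β * (1 + aa q β) / n ^ 2)
        - (aa q β * KK q β / n) • bad δ := by ext; simp
      rw [e, map_sub, map_sub, hE.const, map_smul, map_smul, smul_eq_mul, smul_eq_mul] at this
      rw [Et_succ]
      linarith) t le_rfl
  have e0 : Et β φ 0 ψ = s * φ (fun σ => X σ k) - aa q β * φ V := by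
    rw [Et_zero, hψ, map_sub, map_smul, map_smul]; rfl
  have e1 : Et β φ t ψ = s * Et β φ t (fun σ => X σ k) - aa q β * Et β φ t V := by
    rw [hψ, map_sub, map_smul, map_smul]; rfl
  have hV : 0 ≤ aa q β * Et β φ t V := mul_nonneg ha.le ((Et_state β hφ t).1 _ V_nonneg)
  simp only [e0, e1] at hrec
  have h2 : (aa q β * KK q β / n) * ∑ s ∈ range t, Et β φ s (bad δ) ≤ aa q β * KK q β / n := by
    apply mul_le_of_le_one_right _ hb; positivity
  have h3 : C1 q β / n = KK q β * (1 + aa q β) / n ^ 2 / (rho q β / n) + aa q β * KK q β / n := by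
    unfold C1; field_simp
  rw [h3]
  linarith

lemma mean_abs {q n : ℕ} [NeZero q] [NeZero n] {β δ : ℝ} (h : Par q β δ)
    {φ : ((Fin n → Fin q) → ℝ) →ₗ[ℝ] ℝ} (hφ : IsState φ) (t : ℕ)
    (hb : ∑ s ∈ range t, Et β φ s (bad δ) ≤ 1) (k : Fin q) :
    |Et β φ t (fun σ => X σ k)| ≤ (1 - rho q β / n) ^ t * (1 + aa q β * q) + C1 q β / n := by
  have hK := h.Kpos
  have hρ := h.hρ
  have ha : 0 < aa q β := by unfold aa; positivity
  obtain ⟨hr0, hr1⟩ := rho_div (n := n) h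
  have hp : 0 ≤ (1 - rho q β / n) ^ t := pow_nonneg (by linarith) t
  have h1 := mean_lower h hφ t hb 1 (by norm_num) k
  have h2 := mean_lower h hφ t hb (-1) (by norm_num) k
  have hV : φ V ≤ q := by
    rw [← hφ.const (q : ℝ)]; exact hφ.mono V_le
  have hX1 : φ (fun σ => X σ k) ≤ 1 := by
    rw [← hφ.const (1 : ℝ)]; exact hφ.mono fun σ => (abs_le.1 (X_abs_le σ k)).2
  have hX2 : -1 ≤ φ (fun σ => X σ k) := by
    rw [← hφ.const (-1 : ℝ)]; exact hφ.mono fun σ => (abs_le.1 (X_abs_le σ k)).1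
  have h3 : -((1 - rho q β / n) ^ t * (1 + aa q β * q)) ≤
      (1 - rho q β / n) ^ t * (1 * φ (fun σ => X σ k) - aa q β * φ V) := by
    rw [← mul_neg]
    apply mul_le_mul_of_nonneg_left _ hp
    nlinarith
  have h4 : -((1 - rho q β / n) ^ t * (1 + aa q β * q)) ≤
      (1 - rho q β / n) ^ t * ((-1) * φ (fun σ => X σ k) - aa q β * φ V) := by
    rw [← mul_neg]
    apply mul_le_mul_of_nonneg_left _ hp
    nlinarith
  rw [abs_le]
  constructor <;> linarith

/-- variance constant -/
noncomputable def C2 (q : ℕ) (β : ℝ) : ℝ := KK q β / rho q β + KK q β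

lemma rho15_div {q n : ℕ} [NeZero n] {β δ : ℝ} (h : Par q β δ) (hn2 : 2 ≤ n) :
    0 < (3 / 2) * rho q β / n ∧ (3 / 2) * rho q β / n ≤ 1 := by
  have hn := ncast_pos n
  have := h.hρ
  refine ⟨by positivity, ?_⟩
  rw [div_le_one hn]
  have : (2 : ℝ) ≤ n := by exact_mod_cast hn2
  linarith [h.rho_le]

lemma fy_expand {q n : ℕ} {φ : ((Fin n → Fin q) → ℝ) →ₗ[ℝ] ℝ} (hφ : IsState φ) (y : Fin q → ℝ) :
    φ (fy y) = φ (fy (fun k => φ (fun σ => X σ k))) + ∑ k, (φ (fun σ => X σ k) - y k) ^ 2 := by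
  have e : ∀ z : Fin q → ℝ, φ (fy z) = ∑ k, (φ (fun σ => X σ k ^ 2) - 2 * z k * φ (fun σ => X σ k) +
      z k ^ 2) := by
    intro z
    have : (fy z : (Fin n → Fin q) → ℝ) = ∑ k, ((fun σ => X σ k ^ 2) - (2 * z k) • (fun σ => X σ k) +
        fun _ => z k ^ 2) := by
      ext σ
      simp only [fy, Finset.sum_apply, Pi.add_apply, Pi.sub_apply, Pi.smul_apply, smul_eq_mul]
      exact Finset.sum_congr rfl fun k _ => by ring
    rw [this, map_sum]
    refine Finset.sum_congr rfl fun k _ => ?_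
    rw [map_add, map_sub, map_smul, hφ.const, smul_eq_mul]
  rw [e, e, ← Finset.sum_add_distrib]
  exact Finset.sum_congr rfl fun k _ => by ring

lemma var_bound {q n : ℕ} [NeZero q] [NeZero n] {β δ : ℝ} (h : Par q β δ) (hn2 : 2 ≤ n)
    (σ₀ : Fin n → Fin q) (T : ℕ)
    (hb : ∑ s ∈ range T, Et β (ev σ₀) s (bad δ) ≤ δ) (t : ℕ) (ht : t ≤ T) :
    Et β (ev σ₀) t (fy (fun k => Et β (ev σ₀) t (fun σ => X σ k))) ≤ C2 q β / n := by
  have hn := ncast_pos n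
  have hK := h.Kpos
  have hρ := h.hρ
  have hev : IsState (ev σ₀) := ⟨fun f hf => hf σ₀, rfl⟩
  obtain ⟨hr0, hr1⟩ := rho15_div (n := n) h hn2
  have hbs : ∀ s < T, Et β (ev σ₀) s (bad δ) ≤ δ := fun s hs =>
    (Finset.single_le_sum (f := fun s => Et β (ev σ₀) s (bad δ))
      (fun i _ => Et_bad_nonneg β δ hev i) (Finset.mem_range.2 hs)).trans hb
  have hm : ∀ s < T, ∀ k, |Et β (ev σ₀) s (fun σ => X σ k)| ≤ 2 * δ := by
    intro s hs k
    have hE := Et_state β hev s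
    have hp : ∀ σ : Fin n → Fin q, |X σ k| ≤ 1 * bad δ σ + δ := by
      intro σ
      unfold bad
      split_ifs with hg
      · have h1 : √(V σ) ≤ δ := by
          rw [show δ = √(δ ^ 2) from (Real.sqrt_sq h.hδ.le).symm]
          exact Real.sqrt_le_sqrt hg
        linarith [X_abs_le_sqrt σ k]
      · linarith [X_abs_le σ k, h.hδ]
    have h1 := hE.mono (fun σ => (le_abs_self _).trans (hp σ))
    have h2 := hE.mono (fun σ => (neg_le_abs _).trans (hp σ))
    rw [state_const hE] at h1 h2
    have e : (fun σ : Fin n → Fin q => -X σ k) = -(fun σ => X σ k) := rfl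
    rw [e, map_neg] at h2
    have := hbs s hs
    rw [abs_le]; constructor <;> linarith
  have hrec := rec_le (fun t => Et β (ev σ₀) t (fy (fun k => Et β (ev σ₀) t (fun σ => X σ k))))
    (fun t => Et β (ev σ₀) t (bad δ)) ((3 / 2) * rho q β / n)
    (KK q β / n ^ 2) (KK q β / n) T hr0 hr1 (by positivity) (by positivity)
    (Et_bad_nonneg β δ hev) (fun t ht => by
      have hE := Et_state β hev t
      have hE1 := Et_state β hev (t + 1)
      set m := fun k => Et β (ev σ₀) t (fun σ => X σ k) with hmd
      have s1 := fy_expand hE1 m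
      have s2 : 0 ≤ ∑ k, (Et β (ev σ₀) (t + 1) (fun σ => X σ k) - m k) ^ 2 :=
        Finset.sum_nonneg fun _ _ => sq_nonneg _
      have s3 : Et β (ev σ₀) (t + 1) (fy m) ≤ (1 - (3 / 2) * rho q β / n) * Et β (ev σ₀) t (fy m) +
          KK q β / n ^ 2 + KK q β / n * Et β (ev σ₀) t (bad δ) := by
        rw [Et_succ]
        refine (hE.mono (fun σ => fy_step' h m (hm t ht) σ)).trans (le_of_eq ?_)
        have e : (fun σ => (1 - (3 / 2) * rho q β / n) * fy m σ +
            (2 / n) * ∑ k, (X σ k - m k) * (sm (ff β m) k - 1 / q - m k) +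
            KK q β / n ^ 2 + KK q β / n * bad δ σ) =
            (1 - (3 / 2) * rho q β / n) • (fy m) +
            (∑ k, ((2 / n : ℝ) * (sm (ff β m) k - 1 / q - m k)) • ((fun σ => X σ k) - fun _ => m k)) +
            (fun _ => KK q β / n ^ 2) + (KK q β / n) • (bad δ : (Fin n → Fin q) → ℝ) := by
          ext σ
          simp only [Finset.sum_apply, Pi.add_apply, Pi.sub_apply, Pi.smul_apply, smul_eq_mul]
          rw [Finset.mul_sum]
          congr 3
          exact Finset.sum_congr rfl fun k _ => by ring
        rw [e, map_add, map_add, map_add, map_smul, map_smul, hE.const, map_sum]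
        have e2 : ∀ k, Et β (ev σ₀) t (((2 / n : ℝ) * (sm (ff β m) k - 1 / q - m k)) •
            ((fun σ => X σ k) - fun _ => m k)) = 0 := by
          intro k
          rw [map_smul, map_sub, hE.const]
          simp [hmd]
        simp_rw [e2]
        simp
      linarith) t ht
  have h0 : Et β (ev σ₀) 0 (fy (fun k => Et β (ev σ₀) 0 (fun σ => X σ k))) = 0 := by
    simp only [Et_zero]
    show fy (fun k => X σ₀ k) σ₀ = 0
    simp [fy]
  simp only [h0, mul_zero, zero_add] at hrec
  have h2 : KK q β / n * ∑ s ∈ range t, Et β (ev σ₀) s (bad δ) ≤ KK q β / n := by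
    apply mul_le_of_le_one_right (by positivity)
    have : ∑ s ∈ range t, Et β (ev σ₀) s (bad δ) ≤ ∑ s ∈ range T, Et β (ev σ₀) s (bad δ) :=
      Finset.sum_le_sum_of_subset_of_nonneg (Finset.range_mono ht)
        (fun i _ _ => Et_bad_nonneg β δ hev i)
    linarith [h.hδ2]
  have h3 : KK q β / n ^ 2 / ((3 / 2) * rho q β / n) ≤ KK q β / rho q β / n := by
    have : KK q β / n ^ 2 / ((3 / 2) * rho q β / n) = (2 / 3) * (KK q β / rho q β / n) := by
      field_simp
    rw [this]
    have : 0 ≤ KK q β / rho q β / n := by positivity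
    linarith
  unfold C2
  rw [add_div]
  linarith

lemma EV_bound {q n : ℕ} [NeZero q] [NeZero n] {β δ : ℝ} (h : Par q β δ) (hn2 : 2 ≤ n)
    (σ₀ : Fin n → Fin q) (T : ℕ)
    (hb : ∑ s ∈ range T, Et β (ev σ₀) s (bad δ) ≤ δ) (t : ℕ) (ht : t ≤ T) :
    Et β (ev σ₀) t V ≤ C2 q β / n +
      q * ((1 - rho q β / n) ^ t * (1 + aa q β * q) + C1 q β / n) ^ 2 := by
  have hev : IsState (ev σ₀) := ⟨fun f hf => hf σ₀, rfl⟩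
  have hE := Et_state β hev t
  have h1 := fy_expand hE (fun _ => 0)
  have e : (fy (fun _ => 0) : (Fin n → Fin q) → ℝ) = V := by ext; simp [fy, V]
  rw [e] at h1
  have h2 := var_bound h hn2 σ₀ T hb t ht
  have h3 : ∑ k, (Et β (ev σ₀) t (fun σ => X σ k) - 0) ^ 2 ≤
      ∑ k : Fin q, ((1 - rho q β / n) ^ t * (1 + aa q β * q) + C1 q β / n) ^ 2 := by
    apply Finset.sum_le_sum
    intro k _
    rw [sub_zero, ← sq_abs]
    refine pow_le_pow_left₀ (abs_nonneg _) (mean_abs h hev t ?_ k) 2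
    have : ∑ s ∈ range t, Et β (ev σ₀) s (bad δ) ≤ ∑ s ∈ range T, Et β (ev σ₀) s (bad δ) :=
      Finset.sum_le_sum_of_subset_of_nonneg (Finset.range_mono ht)
        (fun i _ _ => Et_bad_nonneg β δ hev i)
    linarith [h.hδ2]
  rw [h1]
  simp only [Finset.sum_const, Finset.card_univ, Fintype.card_fin, nsmul_eq_mul] at h3
  linarith

lemma Epi {q n : ℕ} [NeZero q] [NeZero n] (β : ℝ) (t f) : Et β (muF q n β) t f = muF q n β f :=
  muF_stat_pow β t f

lemma piV_bound {q n : ℕ} [NeZero q] [NeZero n] {β δ : ℝ} (h : Par q β δ) :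
    muF q n β V ≤ KK q β / rho q β * (1 / n + muF q n β (bad δ)) := by
  have hn := ncast_pos n
  have hK := h.Kpos
  have hρ := h.hρ
  have hπ := muF_state q n β
  have h1 := hπ.mono (fun σ => V_step' h σ)
  change muF q n β (Pop q n β V) ≤ _ at h1
  rw [muF_stat] at h1
  have e : (fun σ => (1 - (3 / 2) * rho q β / n) * V σ + KK q β / n ^ 2 + KK q β / n * bad δ σ) =
    (1 - (3 / 2) * rho q β / n) • (V : (Fin n → Fin q) → ℝ) + (fun _ => KK q β / n ^ 2) +
     (KK q β / n) • (bad δ : (Fin n → Fin q) → ℝ) := by ext; simp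
  rw [e, map_add, map_add, map_smul, map_smul, hπ.const, smul_eq_mul, smul_eq_mul] at h1
  have hV : 0 ≤ muF q n β V := hπ.1 _ V_nonneg
  have hb : 0 ≤ muF q n β (bad δ) := hπ.1 _ (bad_nonneg δ)
  have h2 : (3 / 2) * rho q β / n * muF q n β V ≤ KK q β / n ^ 2 + KK q β / n * muF q n β (bad δ) := by
    linarith
  have h3 : rho q β * muF q n β V ≤ KK q β * (1 / n + muF q n β (bad δ)) := by
    have h4 := mul_le_mul_of_nonneg_left h2 hn.le
    have e1 : n * ((3 / 2) * rho q β / n * muF q n β V) = (3/2) * (rho q β * muF q n β V) := by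
      field_simp
    have e2 : n * (KK q β / n ^ 2 + KK q β / n * muF q n β (bad δ)) =
        KK q β * (1 / n + muF q n β (bad δ)) := by field_simp
    rw [e1, e2] at h4
    have : 0 ≤ rho q β * muF q n β V := by positivity
    linarith
  rw [div_mul_eq_mul_div, le_div_iff₀ hρ]
  linarith

end EM

namespace EM

/-- positive part distance -/
noncomputable def ptv {q : ℕ} (p r : Fin q → ℝ) : ℝ := ∑ k, max (p k - r k) 0

/-- maximal coupling of two probability vectors -/
noncomputable def cpl {q : ℕ} (p r : Fin q → ℝ) (k l : Fin q) : ℝ :=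
  (if k = l then min (p k) (r k) else 0) + max (p k - r k) 0 * max (r l - p l) 0 / ptv p r

lemma ptv_nonneg {q : ℕ} (p r : Fin q → ℝ) : 0 ≤ ptv p r :=
  Finset.sum_nonneg fun _ _ => le_max_right _ _

lemma ptv_comm {q : ℕ} (p r : Fin q → ℝ) (h : ∑ k, p k = ∑ k, r k) : ptv p r = ptv r p := by
  unfold ptv
  have : ∀ k, max (p k - r k) 0 = max (r k - p k) 0 + (p k - r k) := by
    intro k
    rcases le_total (p k) (r k) with h1 | h1
    · rw [max_eq_right (by linarith), max_eq_left (by linarith)]; ring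
    · rw [max_eq_left (by linarith), max_eq_right (by linarith)]; ring
  simp_rw [this]
  rw [Finset.sum_add_distrib, Finset.sum_sub_distrib, h]; ring

lemma ptv_abs {q : ℕ} (p r : Fin q → ℝ) (h : ∑ k, p k = ∑ k, r k) :
    ptv p r = (1 / 2) * ∑ k, |r k - p k| := by
  have h1 := ptv_comm p r h
  have : ∀ k, |r k - p k| = max (p k - r k) 0 + max (r k - p k) 0 := by
    intro k
    rcases le_total (p k) (r k) with h1 | h1
    · rw [max_eq_right (by linarith), max_eq_left (by linarith), abs_of_nonneg (by linarith)]; ring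
    · rw [max_eq_left (by linarith), max_eq_right (by linarith), abs_of_nonpos (by linarith)]; ring
  simp_rw [this]
  rw [Finset.sum_add_distrib]
  change _ = (1 / 2) * (ptv p r + ptv r p)
  rw [← h1]; ring

lemma ptv_zero {q : ℕ} (p r : Fin q → ℝ) (h : ptv p r = 0) (k) : max (p k - r k) 0 = 0 :=
  (Finset.sum_eq_zero_iff_of_nonneg (fun _ _ => le_max_right _ _)).1 h k (Finset.mem_univ k)

lemma cpl_nonneg {q : ℕ} (p r : Fin q → ℝ) (hp : ∀ k, 0 ≤ p k) (hr : ∀ k, 0 ≤ r k) (k l) :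
    0 ≤ cpl p r k l := by
  unfold cpl
  have h1 : 0 ≤ max (p k - r k) 0 := le_max_right _ _
  have h2 : 0 ≤ max (r l - p l) 0 := le_max_right _ _
  have h3 := ptv_nonneg p r
  have h4 : 0 ≤ min (p k) (r k) := le_min (hp k) (hr k)
  split_ifs <;> positivity

lemma cpl_fst {q : ℕ} (p r : Fin q → ℝ) (h : ∑ k, p k = ∑ k, r k) (k) :
    ∑ l, cpl p r k l = p k := by
  unfold cpl
  rw [Finset.sum_add_distrib, ← Finset.sum_div, ← Finset.mul_sum]
  change _ + _ * ptv r p / _ = _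
  rw [← ptv_comm p r h]
  have e : max (p k - r k) 0 * ptv p r / ptv p r = max (p k - r k) 0 := by
    by_cases h0 : ptv p r = 0
    · rw [ptv_zero p r h0 k]; simp
    · field_simp
  rw [e]
  simp
  rcases le_total (p k) (r k) with h1 | h1
  · rw [max_eq_right (by linarith), min_eq_left h1]; ring
  · rw [max_eq_left (by linarith), min_eq_right h1]; ring

lemma cpl_snd {q : ℕ} (p r : Fin q → ℝ) (h : ∑ k, p k = ∑ k, r k) (l) :
    ∑ k, cpl p r k l = r l := by
  unfold cpl
  rw [Finset.sum_add_distrib, ← Finset.sum_div, ← Finset.sum_mul]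
  change _ + ptv p r * _ / _ = _
  have e : ptv p r * max (r l - p l) 0 / ptv p r = max (r l - p l) 0 := by
    by_cases h0 : ptv p r = 0
    · rw [ptv_comm p r h] at h0
      rw [ptv_zero r p h0 l]; simp
    · field_simp
  rw [e]
  simp
  rcases le_total (p l) (r l) with h1 | h1
  · rw [max_eq_left (by linarith), min_eq_left h1]; ring
  · rw [max_eq_right (by linarith), min_eq_right h1]; ring

lemma cpl_diag {q : ℕ} (p r : Fin q → ℝ) (k) : cpl p r k k = min (p k) (r k) := by
  unfold cpl
  rcases le_total (p k) (r k) with h1 | h1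
  · simp [max_eq_right (by linarith : p k - r k ≤ 0)]
  · simp [max_eq_right (by linarith : r k - p k ≤ 0)]

lemma cpl_ne {q : ℕ} (p r : Fin q → ℝ) (h : ∑ k, p k = ∑ k, r k) :
    ∑ k, ∑ l, cpl p r k l * (if k = l then 0 else 1) = ptv p r := by
  unfold ptv
  refine Finset.sum_congr rfl fun k _ => ?_
  have : ∀ l, cpl p r k l * (if k = l then 0 else 1) = cpl p r k l - if k = l then cpl p r k l else 0 := by
    intro l; split_ifs <;> simp
  simp_rw [this]
  rw [Finset.sum_sub_distrib, cpl_fst p r h]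
  simp
  rw [cpl_diag]
  rcases le_total (p k) (r k) with h1 | h1
  · rw [max_eq_right (by linarith), min_eq_left h1]; ring
  · rw [max_eq_left (by linarith), min_eq_right h1]

/-- the coupled dynamics as an operator on functions of pairs -/
noncomputable def Kop (q n : ℕ) (β : ℝ) :
    (((Fin n → Fin q) × (Fin n → Fin q)) → ℝ) →ₗ[ℝ] (((Fin n → Fin q) × (Fin n → Fin q)) → ℝ) where
  toFun h x := (1 / n) * ∑ u, ∑ k, ∑ l, cpl (sm (fld β x.1 u)) (sm (fld β x.2 u)) k l *
    h (Function.update x.1 u k, Function.update x.2 u l)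
  map_add' f g := by
    ext σ
    simp only [Pi.add_apply, mul_add, Finset.sum_add_distrib]
  map_smul' c f := by
    ext σ
    simp only [Pi.smul_apply, smul_eq_mul, RingHom.id_apply]
    rw [← mul_assoc, mul_comm c, mul_assoc]
    congr 1
    rw [Finset.mul_sum]
    apply Finset.sum_congr rfl; intro u _
    rw [Finset.mul_sum]
    apply Finset.sum_congr rfl; intro k _
    rw [Finset.mul_sum]
    apply Finset.sum_congr rfl; intro l _
    ring

lemma Kop_apply {q n : ℕ} (β : ℝ) (h : ((Fin n → Fin q) × (Fin n → Fin q)) → ℝ) (x) :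
    Kop q n β h x = (1 / n) * ∑ u, ∑ k, ∑ l, cpl (sm (fld β x.1 u)) (sm (fld β x.2 u)) k l *
    h (Function.update x.1 u k, Function.update x.2 u l) := rfl

lemma sm_sum_eq {q : ℕ} [NeZero q] (a b : Fin q → ℝ) : ∑ k, sm a k = ∑ k, sm b k := by
  rw [sm_sum, sm_sum]

lemma Kop_fst {q n : ℕ} [NeZero q] (β : ℝ) (f : (Fin n → Fin q) → ℝ) :
    Kop q n β (fun x => f x.1) = fun x => Pop q n β f x.1 := by
  ext x
  rw [Kop_apply, Pop_apply]
  congr 1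
  refine Finset.sum_congr rfl fun u _ => Finset.sum_congr rfl fun k _ => ?_
  dsimp only
  rw [← Finset.sum_mul, cpl_fst _ _ (sm_sum_eq _ _)]

lemma Kop_snd {q n : ℕ} [NeZero q] (β : ℝ) (f : (Fin n → Fin q) → ℝ) :
    Kop q n β (fun x => f x.2) = fun x => Pop q n β f x.2 := by
  ext x
  rw [Kop_apply, Pop_apply]
  congr 1
  refine Finset.sum_congr rfl fun u _ => ?_
  rw [Finset.sum_comm]
  refine Finset.sum_congr rfl fun k _ => ?_
  dsimp only
  rw [← Finset.sum_mul, cpl_snd _ _ (sm_sum_eq _ _)]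

lemma cpl_nn {q : ℕ} [NeZero q] (a b : Fin q → ℝ) (k l) : 0 ≤ cpl (sm a) (sm b) k l :=
  cpl_nonneg _ _ (fun k => (sm_pos a k).le) (fun k => (sm_pos b k).le) k l

lemma Kop_markov {q n : ℕ} [NeZero q] [NeZero n] (β : ℝ) : IsMarkov (Kop q n β) := by
  constructor
  · intro f hf x
    rw [Kop_apply]
    refine mul_nonneg (by positivity) ?_
    exact Finset.sum_nonneg fun u _ => Finset.sum_nonneg fun k _ => Finset.sum_nonneg fun l _ =>
      mul_nonneg (cpl_nn _ _ _ _) (hf _)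
  · have := Kop_fst (q := q) (n := n) β (fun _ => 1)
    rw [this, (Pop_markov β).2]

/-- Hamming distance -/
noncomputable def dd {q n : ℕ} (x : (Fin n → Fin q) × (Fin n → Fin q)) : ℝ :=
  ∑ v, if x.1 v = x.2 v then 0 else 1

lemma dd_nonneg {q n : ℕ} (x : (Fin n → Fin q) × (Fin n → Fin q)) : 0 ≤ dd x :=
  Finset.sum_nonneg fun _ _ => by split_ifs <;> norm_num

lemma dd_le {q n : ℕ} (x : (Fin n → Fin q) × (Fin n → Fin q)) : dd x ≤ n := by
  unfold dd
  calc _ ≤ ∑ v : Fin n, (1 : ℝ) := Finset.sum_le_sum fun _ _ => by split_ifs <;> norm_num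
    _ = n := by simp

lemma dd_update {q n : ℕ} (x : (Fin n → Fin q) × (Fin n → Fin q)) (u : Fin n) (k l : Fin q) :
    dd (Function.update x.1 u k, Function.update x.2 u l) =
      dd x + ((if k = l then 0 else 1) - (if x.1 u = x.2 u then 0 else 1)) := by
  unfold dd
  rw [← Finset.add_sum_erase _ _ (Finset.mem_univ u)]
  rw [← Finset.add_sum_erase (a := u) _ (fun v => if x.1 v = x.2 v then (0:ℝ) else 1) (Finset.mem_univ u)]
  have : ∑ v ∈ Finset.univ.erase u, (if Function.update x.1 u k v = Function.update x.2 u l v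
      then (0:ℝ) else 1) = ∑ v ∈ Finset.univ.erase u, (if x.1 v = x.2 v then (0:ℝ) else 1) := by
    refine Finset.sum_congr rfl fun v hv => ?_
    rw [Function.update_of_ne (Finset.ne_of_mem_erase hv), Function.update_of_ne (Finset.ne_of_mem_erase hv)]
  simp only [this, Function.update_self]
  ring

lemma fld_diff_sum {q n : ℕ} [NeZero q] (β : ℝ) (σ τ : Fin n → Fin q) (u : Fin n) :
    ∑ j, (fld β τ u j - fld β σ u j) = 0 := by
  unfold fld
  rw [Finset.sum_sub_distrib, ← Finset.mul_sum, ← Finset.mul_sum, Finset.sum_sub_distrib,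
    Finset.sum_sub_distrib, cnt_sum, cnt_sum]
  simp

lemma fld_diff_l1 {q n : ℕ} [NeZero q] [NeZero n] (β : ℝ) (hβ : 0 ≤ β) (σ τ : Fin n → Fin q) (u : Fin n) :
    ∑ j, |fld β τ u j - fld β σ u j| ≤ 4 * β / n * dd (σ, τ) := by
  have hn := ncast_pos n
  have e : ∀ j, fld β τ u j - fld β σ u j = 2 * β / n * ∑ v ∈ Finset.univ.erase u,
      ((if τ v = j then (1:ℝ) else 0) - (if σ v = j then 1 else 0)) := by
    intro j
    unfold fld cnt
    rw [← Finset.add_sum_erase _ (fun v => if τ v = j then (1:ℝ) else 0) (Finset.mem_univ u)]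
    rw [← Finset.add_sum_erase _ (fun v => if σ v = j then (1:ℝ) else 0) (Finset.mem_univ u)]
    rw [Finset.sum_sub_distrib]
    ring
  simp_rw [e, abs_mul, abs_of_nonneg (by positivity : 0 ≤ 2 * β / n)]
  rw [← Finset.mul_sum]
  have h1 : ∑ j, |∑ v ∈ Finset.univ.erase u,
      ((if τ v = j then (1:ℝ) else 0) - (if σ v = j then 1 else 0))| ≤ 2 * dd (σ, τ) := by
    calc _ ≤ ∑ j, ∑ v : Fin n, |(if τ v = j then (1:ℝ) else 0) - (if σ v = j then 1 else 0)| := by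
          refine Finset.sum_le_sum fun j _ => (Finset.abs_sum_le_sum_abs _ _).trans ?_
          exact Finset.sum_le_sum_of_subset_of_nonneg (Finset.subset_univ _) fun _ _ _ => abs_nonneg _
      _ = ∑ v : Fin n, ∑ j, |(if τ v = j then (1:ℝ) else 0) - (if σ v = j then 1 else 0)| :=
          Finset.sum_comm
      _ ≤ ∑ v : Fin n, 2 * (if σ v = τ v then (0:ℝ) else 1) := by
          refine Finset.sum_le_sum fun v _ => ?_
          split_ifs with hv
          · rw [hv]; simp
          · calc _ ≤ ∑ j, ((if τ v = j then (1:ℝ) else 0) + (if σ v = j then 1 else 0)) := by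
                  refine Finset.sum_le_sum fun j _ => ?_
                  split_ifs <;> norm_num
              _ ≤ _ := by rw [Finset.sum_add_distrib]; simp; norm_num
      _ = _ := by rw [← Finset.mul_sum]; rfl
  calc _ ≤ 2 * β / n * (2 * dd (σ, τ)) := mul_le_mul_of_nonneg_left h1 (by positivity)
    _ = _ := by ring

lemma fld_near {q n : ℕ} [NeZero q] [NeZero n] (β : ℝ) (hβ : 0 ≤ β) (σ : Fin n → Fin q) (u) (η : ℝ)
    (hη : √(V σ) ≤ η) (j) : |fld β σ u j - 2 * β / q| ≤ 2 * β * (η + 1 / n) := by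
  have hn := ncast_pos n
  rw [fld_eq]
  have e : ff β (X σ) j + (-(2 * β / n) * if σ u = j then 1 else 0) - 2 * β / q =
      2 * β * (X σ j - (1 / n) * if σ u = j then 1 else 0) := by unfold ff; ring
  simp only [e]
  rw [abs_mul, abs_of_nonneg (by positivity : 0 ≤ 2 * β)]
  apply mul_le_mul_of_nonneg_left _ (by positivity)
  refine (abs_sub _ _).trans ?_
  have := X_abs_le_sqrt σ j
  have : |(1 / (n:ℝ)) * if σ u = j then 1 else 0| ≤ 1 / n := by
    have h0 : 0 ≤ 1 / (n : ℝ) := by positivity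
    split_ifs
    · rw [mul_one, abs_of_nonneg h0]
    · simp
  linarith

lemma ptv_fld {q n : ℕ} [NeZero q] [NeZero n] (β : ℝ) (hβ : 0 ≤ β) (σ τ : Fin n → Fin q) (u) (η : ℝ)
    (hη : √(V σ) ≤ η) (hη' : √(V τ) ≤ η) :
    ptv (sm (fld β σ u)) (sm (fld β τ u)) ≤
      (1 / q + 8 * β * (η + 1 / n)) * (2 * β / n * dd (σ, τ)) := by
  rw [ptv_abs _ _ (sm_sum_eq _ _)]
  have e : (fun j => fld β σ u j + (fld β τ u j - fld β σ u j)) = fld β τ u := by ext; ring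
  have h1 := sm_l1 (fld β σ u) (fun j => fld β τ u j - fld β σ u j) (2 * β / q)
    (2 * β * (η + 1 / n)) (fld_diff_sum β σ τ u) (fld_near β hβ σ u η hη)
    (fun j => by
      have := fld_near β hβ τ u η hη' j
      simpa using this)
  rw [e] at h1
  have h2 := fld_diff_l1 β hβ σ τ u
  have hn := ncast_pos n
  have hη0 : 0 ≤ η := (Real.sqrt_nonneg _).trans hη
  have h3 := mul_le_mul_of_nonneg_left h2
    (by positivity : 0 ≤ 1 / (q:ℝ) + 4 * (2 * β * (η + 1 / n)))
  calc _ ≤ (1 / 2) * ((1 / (q:ℝ) + 4 * (2 * β * (η + 1 / n))) * (4 * β / n * dd (σ, τ))) := by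
        apply mul_le_mul_of_nonneg_left (h1.trans h3) (by norm_num)
    _ = _ := by ring

lemma avg_neq {q n : ℕ} (x : (Fin n → Fin q) × (Fin n → Fin q)) :
   ∑ u, (if x.1 u = x.2 u then (0:ℝ) else 1) = dd x := rfl

lemma cpl_sum {q : ℕ} [NeZero q] (a b : Fin q → ℝ) : ∑ k, ∑ l, cpl (sm a) (sm b) k l = 1 := by
  simp_rw [cpl_fst _ _ (sm_sum_eq a b)]
  exact sm_sum a

lemma Kop_dd {q n : ℕ} [NeZero q] [NeZero n] (β : ℝ) (x : (Fin n → Fin q) × (Fin n → Fin q)) :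
    Kop q n β dd x = dd x - (1 / n) * dd x +
      (1 / n) * ∑ u, ptv (sm (fld β x.1 u)) (sm (fld β x.2 u)) := by
  have hn := ncast_pos n
  rw [Kop_apply]
  simp_rw [dd_update]
  have : ∀ u, ∑ k, ∑ l, cpl (sm (fld β x.1 u)) (sm (fld β x.2 u)) k l *
      (dd x + ((if k = l then 0 else 1) - (if x.1 u = x.2 u then 0 else 1))) =
      dd x - (if x.1 u = x.2 u then 0 else 1) + ptv (sm (fld β x.1 u)) (sm (fld β x.2 u)) := by
    intro u
    rw [← cpl_ne _ _ (sm_sum_eq _ _)]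
    have h := cpl_sum (fld β x.1 u) (fld β x.2 u)
    calc _ = ∑ k, ∑ l, (cpl (sm (fld β x.1 u)) (sm (fld β x.2 u)) k l *
          (dd x - (if x.1 u = x.2 u then 0 else 1)) +
          cpl (sm (fld β x.1 u)) (sm (fld β x.2 u)) k l * (if k = l then 0 else 1)) :=
          Finset.sum_congr rfl fun k _ => Finset.sum_congr rfl fun l _ => by ring
      _ = _ := by
          simp_rw [Finset.sum_add_distrib, ← Finset.sum_mul]
          rw [h, one_mul]
  simp_rw [this]
  rw [Finset.sum_add_distrib, Finset.sum_sub_distrib, avg_neq]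
  simp
  field_simp

lemma Kop_dd_le {q n : ℕ} [NeZero q] [NeZero n] (β : ℝ) (hβ : 0 ≤ β)
    (x : (Fin n → Fin q) × (Fin n → Fin q)) (η : ℝ)
    (hη : √(V x.1) ≤ η) (hη' : √(V x.2) ≤ η) :
    Kop q n β dd x ≤ (1 - rho q β / n) * dd x + 16 * β ^ 2 / n * (η + 1 / n) * dd x := by
  have hn := ncast_pos n
  rw [Kop_dd]
  have h1 : ∑ u, ptv (sm (fld β x.1 u)) (sm (fld β x.2 u)) ≤ ∑ u : Fin n,
    (1 / q + 8 * β * (η + 1 / n)) * (2 * β / n * dd x) :=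
    Finset.sum_le_sum fun u _ => ptv_fld β hβ x.1 x.2 u η hη hη'
  simp only [Finset.sum_const, Finset.card_univ, Fintype.card_fin, nsmul_eq_mul] at h1
  have h2 := mul_le_mul_of_nonneg_left h1 (by positivity : 0 ≤ 1 / (n : ℝ))
  have e : 1 / (n : ℝ) * (n * ((1 / q + 8 * β * (η + 1 / n)) * (2 * β / n * dd x))) =
    (2 * β / q) / n * dd x + 16 * β ^ 2 / n * (η + 1 / n) * dd x := by
    have : 1 / (n : ℝ) * n = 1 := by field_simp
    rw [← mul_assoc, this]; ring
  rw [e] at h2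
  have e2 : (1 - rho q β / n) * dd x = dd x - (1 / n) * dd x + (2 * β / q) / n * dd x := by
    unfold rho; ring
  rw [e2]; linarith

lemma Kop_sq_le {q n : ℕ} [NeZero q] [NeZero n] (β : ℝ) (x : (Fin n → Fin q) × (Fin n → Fin q)) :
    Kop q n β (fun x => dd x ^ 2) x ≤ dd x ^ 2 + 2 * dd x * (Kop q n β dd x - dd x) + 1 := by
  have hn := ncast_pos n
  have hM : IsState (ev x ∘ₗ Kop q n β) := (Kop_markov β).ev x
  have key : ∀ u k l, (dd (Function.update x.1 u k, Function.update x.2 u l)) ^ 2 ≤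
      (2 * dd x) * dd (Function.update x.1 u k, Function.update x.2 u l) + (1 - dd x ^ 2) := by
    intro u k l
    rw [dd_update]
    have : ((if k = l then (0:ℝ) else 1) - (if x.1 u = x.2 u then 0 else 1)) ^ 2 ≤ 1 := by
      split_ifs <;> norm_num
    nlinarith
  have h1 : Kop q n β (fun x => dd x ^ 2) x ≤ Kop q n β (fun y => (2 * dd x) * dd y + (1 - dd x ^ 2)) x := by
    rw [Kop_apply, Kop_apply]
    apply mul_le_mul_of_nonneg_left _ (by positivity)
    exact Finset.sum_le_sum fun u _ => Finset.sum_le_sum fun k _ => Finset.sum_le_sum fun l _ =>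
      mul_le_mul_of_nonneg_left (key u k l) (cpl_nn _ _ _ _)
  have h2 := state_const hM (1 - dd x ^ 2) dd (2 * dd x)
  change Kop q n β (fun y => (2 * dd x) * dd y + (1 - dd x ^ 2)) x =
    2 * dd x * Kop q n β dd x + (1 - dd x ^ 2) at h2
  rw [h2] at h1
  linarith

/-- second order part of the Lyapunov function -/
noncomputable def WW {q n : ℕ} (x : (Fin n → Fin q) × (Fin n → Fin q)) : ℝ :=
  n * V x.1 + n * V x.2 + dd x ^ 2 / n

lemma Kop_dd_W {q n : ℕ} [NeZero q] [NeZero n] (β : ℝ) (hβ : 0 ≤ β)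
    (x : (Fin n → Fin q) × (Fin n → Fin q)) :
    Kop q n β dd x ≤ (1 - rho q β / n) * dd x + 16 * β ^ 2 / n * (WW x + 1) := by
  have hn := ncast_pos n
  have h := Kop_dd_le β hβ x (√(V x.1) + √(V x.2)) (by linarith [Real.sqrt_nonneg (V x.2)])
    (by linarith [Real.sqrt_nonneg (V x.1)])
  have h1 : (√(V x.1) + √(V x.2) + 1 / n) * dd x ≤ WW x + 1 := by
    have a1 := Real.sq_sqrt (V_nonneg x.1)
    have a2 := Real.sq_sqrt (V_nonneg x.2)
    have a3 : 1 / n * dd x ≤ 1 := by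
      rw [one_div, inv_mul_le_iff₀ hn]; linarith [dd_le x]
    have a4 : √(V x.1) * dd x ≤ n * V x.1 + (1/2) * (dd x ^ 2 / n) := by
      have e : n * V x.1 + (1/2) * (dd x ^ 2 / n) - √(V x.1) * dd x =
        (1 / 2) * (n * V x.1) + (1 / 2) * n * (√(V x.1) - dd x / n) ^ 2 := by
        rw [sub_sq, a1]; field_simp; ring
      have : 0 ≤ (1 / 2) * (n * V x.1) := by have := V_nonneg x.1; positivity
      have : 0 ≤ (1 / 2) * n * (√(V x.1) - dd x / n) ^ 2 := by positivity
      linarith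
    have a5 : √(V x.2) * dd x ≤ n * V x.2 + (1/2) * (dd x ^ 2 / n) := by
      have e : n * V x.2 + (1/2) * (dd x ^ 2 / n) - √(V x.2) * dd x =
        (1 / 2) * (n * V x.2) + (1 / 2) * n * (√(V x.2) - dd x / n) ^ 2 := by
        rw [sub_sq, a2]; field_simp; ring
      have : 0 ≤ (1 / 2) * (n * V x.2) := by have := V_nonneg x.2; positivity
      have : 0 ≤ (1 / 2) * n * (√(V x.2) - dd x / n) ^ 2 := by positivity
      linarith
    unfold WW
    linarith
  have h2 := mul_le_mul_of_nonneg_left h1 (by positivity : 0 ≤ 16 * β ^ 2 / n)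
  calc _ ≤ _ := h
    _ ≤ _ := by rw [mul_assoc (16 * β ^ 2 / (n:ℝ))]; linarith

lemma Kop_sq_W {q n : ℕ} [NeZero q] [NeZero n] {β δ : ℝ} (h : Par q β δ)
    (x : (Fin n → Fin q) × (Fin n → Fin q)) :
    Kop q n β (fun x => dd x ^ 2) x ≤ (1 - (3 / 2) * rho q β / n) * dd x ^ 2 + (1 + 32 * β ^ 2) +
      5 * n * (bad δ x.1 + bad δ x.2) := by
  have hn := ncast_pos n
  have hn1 := ncast_one_le n
  have h0 := Kop_sq_le β x
  have hd := dd_nonneg x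
  have hdn := dd_le x
  by_cases hg : V x.1 ≤ δ ^ 2 ∧ V x.2 ≤ δ ^ 2
  · have hs : ∀ y, y ≤ δ ^ 2 → √y ≤ δ := fun y hy => by
      rw [show δ = √(δ ^ 2) from (Real.sqrt_sq h.hδ.le).symm]
      exact Real.sqrt_le_sqrt hy
    have h1 := Kop_dd_le β h.hβ x δ (hs _ hg.1) (hs _ hg.2)
    have h2 : 16 * β ^ 2 / n * (δ + 1 / n) * dd x ≤ (1/4) * rho q β / n * dd x + 16 * β ^ 2 / n ^ 2 * dd x := by
      have e : 16 * β ^ 2 / n * (δ + 1 / n) * dd x = 16 * β ^ 2 * δ / n * dd x + 16 * β ^ 2 / n ^ 2 * dd x := by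
        ring
      rw [e]
      have : 16 * β ^ 2 * δ ≤ (1/4) * rho q β := by linarith [h.hδ3]
      gcongr
    have h3 : Kop q n β dd x - dd x ≤ - ((3/4) * rho q β / n) * dd x + 16 * β ^ 2 / n ^ 2 * dd x := by
      have e : (1 - rho q β / n) * dd x = dd x - rho q β / n * dd x := by ring
      have e2 : (1/4) * rho q β / n * dd x = (1/4) * (rho q β / n * dd x) := by ring
      have e3 : - ((3/4) * rho q β / n) * dd x = - (3/4) * (rho q β / n * dd x) := by ring
      rw [e] at h1; rw [e2] at h2; rw [e3]; linarith
    have h4 := mul_le_mul_of_nonneg_left h3 (by positivity : 0 ≤ 2 * dd x)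
    have h5 : 2 * dd x * (16 * β ^ 2 / n ^ 2 * dd x) ≤ 32 * β ^ 2 := by
      have e : 2 * dd x * (16 * β ^ 2 / n ^ 2 * dd x) = 32 * β ^ 2 * (dd x / n) ^ 2 := by field_simp; ring
      rw [e]
      have : dd x / n ≤ 1 := by rw [div_le_one hn]; exact hdn
      have : (dd x / n) ^ 2 ≤ 1 := pow_le_one₀ (by positivity) this
      nlinarith [sq_nonneg β]
    have hb := bad_nonneg δ x.1
    have hb2 := bad_nonneg δ x.2
    have : 0 ≤ 5 * n * (bad δ x.1 + bad δ x.2) := by positivity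
    have e : 2 * dd x * (- ((3/4) * rho q β / n) * dd x + 16 * β ^ 2 / n ^ 2 * dd x) =
      - ((3/2) * rho q β / n * dd x ^ 2) + 2 * dd x * (16 * β ^ 2 / n ^ 2 * dd x) := by ring
    rw [e] at h4
    linarith
  · have hb : 1 ≤ bad δ x.1 + bad δ x.2 := by
      unfold bad
      by_cases h1 : V x.1 ≤ δ ^ 2
      · have h2 : ¬ V x.2 ≤ δ ^ 2 := fun h2 => hg ⟨h1, h2⟩
        simp [h1, h2]
      · simp only [h1, if_false]
        split_ifs <;> norm_num
    have h1 : Kop q n β dd x ≤ dd x + 1 := by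
      rw [Kop_dd]
      have : ∑ u, ptv (sm (fld β x.1 u)) (sm (fld β x.2 u)) ≤ ∑ u : Fin n, (1:ℝ) := by
        refine Finset.sum_le_sum fun u _ => ?_
        rw [← sm_sum (fld β x.1 u)]
        refine Finset.sum_le_sum fun k _ => ?_
        have := sm_pos (fld β x.1 u) k
        have := sm_pos (fld β x.2 u) k
        exact max_le (by linarith) (by linarith)
      simp only [Finset.sum_const, Finset.card_univ, Fintype.card_fin, nsmul_eq_mul, mul_one] at this
      have h2 := mul_le_mul_of_nonneg_left this (by positivity : 0 ≤ 1 / (n : ℝ))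
      have e : 1 / (n : ℝ) * n = 1 := by field_simp
      rw [e] at h2
      have : 0 ≤ 1 / n * dd x := by positivity
      linarith
    have h2 : (3 / 2) * rho q β / n * dd x ^ 2 ≤ (3/2) * n := by
      have e : (3 / 2) * rho q β / n * dd x ^ 2 = (3 / 2) * n * (rho q β * (dd x / n) ^ 2) := by
        field_simp
      rw [e]
      have : dd x / n ≤ 1 := by rw [div_le_one hn]; exact hdn
      have : (dd x / n) ^ 2 ≤ 1 := pow_le_one₀ (by positivity) this
      have h3 : rho q β * (dd x / n) ^ 2 ≤ 1 := by
        have := h.hρ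
        have := h.rho_le
        nlinarith [sq_nonneg (dd x / n)]
      have : 0 ≤ (3/2) * (n:ℝ) := by positivity
      nlinarith
    have h3 : 5 * (n:ℝ) ≤ 5 * n * (bad δ x.1 + bad δ x.2) := by nlinarith
    have h4 : 2 * dd x * (Kop q n β dd x - dd x) ≤ 2 * dd x := by nlinarith
    have e : (1 - (3 / 2) * rho q β / n) * dd x ^ 2 = dd x ^ 2 - (3 / 2) * rho q β / n * dd x ^ 2 := by ring
    rw [e]
    nlinarith [sq_nonneg β]

/-- constants for the coupling -/
noncomputable def KC (q : ℕ) (β : ℝ) : ℝ := 2 * KK q β + 32 * β ^ 2 + 6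

/-- weight for the coupling -/
noncomputable def ac (q : ℕ) (β : ℝ) : ℝ := 2 * (16 * β ^ 2) / rho q β

lemma Kop_WW {q n : ℕ} [NeZero q] [NeZero n] {β δ : ℝ} (h : Par q β δ)
    (x : (Fin n → Fin q) × (Fin n → Fin q)) :
    Kop q n β WW x ≤ (1 - (3 / 2) * rho q β / n) * WW x + KC q β / n +
      KC q β * (bad δ x.1 + bad δ x.2) := by
  have hn := ncast_pos n
  have e : (WW : ((Fin n → Fin q) × (Fin n → Fin q)) → ℝ) = (n : ℝ) • (fun x => V x.1) +
    (n : ℝ) • (fun x => V x.2) + (1 / n : ℝ) • (fun x => dd x ^ 2) := by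
    ext x; simp [WW]; ring
  have e2 : Kop q n β WW x = n * Pop q n β V x.1 + n * Pop q n β V x.2 +
      (1 / n) * Kop q n β (fun x => dd x ^ 2) x := by
    rw [e, map_add, map_add, map_smul, map_smul, map_smul, Kop_fst, Kop_snd]; rfl
  rw [e2]
  have h1 := mul_le_mul_of_nonneg_left (V_step' h x.1) hn.le
  have h2 := mul_le_mul_of_nonneg_left (V_step' h x.2) hn.le
  have h3 := mul_le_mul_of_nonneg_left (Kop_sq_W h x) (by positivity : 0 ≤ 1 / (n:ℝ))
  have hb1 := bad_nonneg δ x.1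
  have hb2 := bad_nonneg δ x.2
  have hK := h.Kpos
  calc _ ≤ n * ((1 - (3 / 2) * rho q β / n) * V x.1 + KK q β / n ^ 2 + KK q β / n * bad δ x.1) +
        n * ((1 - (3 / 2) * rho q β / n) * V x.2 + KK q β / n ^ 2 + KK q β / n * bad δ x.2) +
        1 / n * ((1 - (3 / 2) * rho q β / n) * dd x ^ 2 + (1 + 32 * β ^ 2) +
      5 * n * (bad δ x.1 + bad δ x.2)) := by linarith
    _ = (1 - (3 / 2) * rho q β / n) * WW x + (2 * KK q β + 32 * β ^ 2 + 1) / n +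
        (KK q β + 5) * (bad δ x.1 + bad δ x.2) := by
      unfold WW
      field_simp
      ring
    _ ≤ _ := by
      have a1 : (2 * KK q β + 32 * β ^ 2 + 1) / n ≤ KC q β / n := by
        unfold KC; gcongr; norm_num
      have a2 : KK q β + 5 ≤ KC q β := by unfold KC; nlinarith [sq_nonneg β]
      have := mul_le_mul_of_nonneg_right a2 (by linarith : 0 ≤ bad δ x.1 + bad δ x.2)
      linarith

lemma Kop_Phi {q n : ℕ} [NeZero q] [NeZero n] {β δ : ℝ} (h : Par q β δ)
    (x : (Fin n → Fin q) × (Fin n → Fin q)) :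
    Kop q n β (dd + ac q β • WW) x ≤ (1 - rho q β / n) * (dd x + ac q β * WW x) +
      (16 * β ^ 2 + ac q β * KC q β) / n + ac q β * KC q β * (bad δ x.1 + bad δ x.2) := by
  have hn := ncast_pos n
  have hρ := h.hρ
  have ha : 0 ≤ ac q β := by unfold ac; positivity
  have h1 := Kop_dd_W β h.hβ x
  have h2 := mul_le_mul_of_nonneg_left (Kop_WW h x) ha
  have e : Kop q n β (dd + ac q β • WW) x = Kop q n β dd x + ac q β * Kop q n β WW x := by
    rw [map_add, map_smul]; rfl
  rw [e]
  have e1 : 16 * β ^ 2 / n * (WW x + 1) = ac q β * ((1/2) * rho q β / n) * WW x + 16 * β ^ 2 / n := by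
    unfold ac; field_simp
  rw [e1] at h1
  calc _ ≤ _ := add_le_add h1 h2
    _ = _ := by ring

/-- initial coupled state: point mass times stationary -/
noncomputable def Psi {q n : ℕ} (β : ℝ) (σ₀ : Fin n → Fin q) :
    (((Fin n → Fin q) × (Fin n → Fin q)) → ℝ) →ₗ[ℝ] ℝ where
  toFun h := muF q n β (fun τ => h (σ₀, τ))
  map_add' _ _ := (muF q n β).map_add _ _
  map_smul' c _ := (muF q n β).map_smul c _

lemma Psi_state {q n : ℕ} [NeZero q] (β : ℝ) (σ₀ : Fin n → Fin q) : IsState (Psi β σ₀) :=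
  ⟨fun _ hf => (muF_state q n β).1 _ fun _ => hf _, (muF_state q n β).2⟩

/-- coupled expectation -/
noncomputable def Ct {q n : ℕ} (β : ℝ) (σ₀ : Fin n → Fin q) (t : ℕ) :
    (((Fin n → Fin q) × (Fin n → Fin q)) → ℝ) →ₗ[ℝ] ℝ := Psi β σ₀ ∘ₗ (Kop q n β ^ t)

lemma Ct_state {q n : ℕ} [NeZero q] [NeZero n] (β : ℝ) (σ₀ : Fin n → Fin q) (t : ℕ) :
    IsState (Ct β σ₀ t) := (Psi_state β σ₀).comp ((Kop_markov β).pow t)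

lemma Ct_succ {q n : ℕ} (β : ℝ) (σ₀ : Fin n → Fin q) (t : ℕ) (f) :
    Ct β σ₀ (t + 1) f = Ct β σ₀ t (Kop q n β f) := by
  unfold Ct
  rw [pow_succ]; rfl

lemma Ct_fst {q n : ℕ} [NeZero q] [NeZero n] (β : ℝ) (σ₀ : Fin n → Fin q) (t : ℕ) (f) :
    Ct β σ₀ t (fun x => f x.1) = Et β (ev σ₀) t f := by
  induction t generalizing f with
  | zero =>
    rw [Et_zero]
    show muF q n β (fun _ => f σ₀) = f σ₀
    exact (muF_state q n β).const _
  | succ t ih => rw [Ct_succ, Kop_fst, ih, Et_succ]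

lemma Ct_snd {q n : ℕ} [NeZero q] [NeZero n] (β : ℝ) (σ₀ : Fin n → Fin q) (t : ℕ) (f) :
    Ct β σ₀ t (fun x => f x.2) = muF q n β f := by
  induction t generalizing f with
  | zero => rfl
  | succ t ih => rw [Ct_succ, Kop_snd, ih, muF_stat]

/-- coupling constant -/
noncomputable def CC (q : ℕ) (β : ℝ) : ℝ :=
  1 + ac q β * (2 * q + 1) + (16 * β ^ 2 + ac q β * KC q β) / rho q β + 2 * (ac q β * KC q β)

lemma Ct_dd {q n : ℕ} [NeZero q] [NeZero n] {β δ : ℝ} (h : Par q β δ) (σ₀ : Fin n → Fin q) (T : ℕ)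
    (hb : ∑ s ∈ range T, Et β (ev σ₀) s (bad δ) ≤ 1) (hπ : T * muF q n β (bad δ) ≤ 1) :
    Ct β σ₀ T dd ≤ CC q β * (n * (1 - rho q β / n) ^ T + 1) := by
  have hn := ncast_pos n
  have hn1 := ncast_one_le n
  have hρ := h.hρ
  have hK := h.Kpos
  have hKC : 0 ≤ KC q β := by unfold KC; positivity
  have ha : 0 ≤ ac q β := by unfold ac; positivity
  obtain ⟨hr0, hr1⟩ := rho_div (n := n) h
  have hbn : ∀ t, 0 ≤ Et β (ev σ₀) t (bad δ) + muF q n β (bad δ) := fun t =>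
    add_nonneg (Et_bad_nonneg β δ ⟨fun f hf => hf σ₀, rfl⟩ t) ((muF_state q n β).1 _ (bad_nonneg δ))
  have hrec := rec_le (fun t => Ct β σ₀ t (dd + ac q β • WW))
    (fun t => Et β (ev σ₀) t (bad δ) + muF q n β (bad δ)) (rho q β / n)
    ((16 * β ^ 2 + ac q β * KC q β) / n) (ac q β * KC q β) T hr0 hr1 (by positivity) (by positivity)
    hbn (fun t _ => by
      have hE := Ct_state β σ₀ t
      have h1 := hE.mono (fun x => Kop_Phi h x)
      have e : (fun x : (Fin n → Fin q) × (Fin n → Fin q) => (1 - rho q β / n) * (dd x + ac q β * WW x) +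
        (16 * β ^ 2 + ac q β * KC q β) / n + ac q β * KC q β * (bad δ x.1 + bad δ x.2)) =
        (1 - rho q β / n) • (dd + ac q β • WW) + (fun _ => (16 * β ^ 2 + ac q β * KC q β) / n) +
        (ac q β * KC q β) • ((fun x => bad δ x.1) + (fun x => bad δ x.2)) := by ext; simp; ring
      have e3 : Ct β σ₀ t ((1 - rho q β / n) • (dd + ac q β • WW) +
          (fun _ => (16 * β ^ 2 + ac q β * KC q β) / n) +
          (ac q β * KC q β) • ((fun x => bad δ x.1) + (fun x => bad δ x.2))) =
          (1 - rho q β / n) * Ct β σ₀ t (dd + ac q β • WW) + (16 * β ^ 2 + ac q β * KC q β) / n +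
          ac q β * KC q β * (Et β (ev σ₀) t (bad δ) + muF q n β (bad δ)) := by
        have i1 := (Ct β σ₀ t).map_add (fun x => bad δ x.1) (fun x => bad δ x.2)
        rw [Ct_fst, Ct_snd] at i1
        rw [(Ct β σ₀ t).map_add, (Ct β σ₀ t).map_add, (Ct β σ₀ t).map_smul, (Ct β σ₀ t).map_smul, i1,
          hE.const, smul_eq_mul, smul_eq_mul]
      rw [e, e3] at h1
      rw [Ct_succ]
      exact h1) T le_rfl
  have hE := Ct_state β σ₀ T
  have h1 : Ct β σ₀ T dd ≤ Ct β σ₀ T (dd + ac q β • WW) := by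
    apply hE.mono
    intro x
    have : 0 ≤ WW x := by
      unfold WW
      have := V_nonneg x.1
      have := V_nonneg x.2
      positivity
    have : 0 ≤ ac q β * WW x := by positivity
    simp only [Pi.add_apply, Pi.smul_apply, smul_eq_mul]
    linarith
  have h0 : Ct β σ₀ 0 (dd + ac q β • WW) ≤ n * (1 + ac q β * (2 * q + 1)) := by
    have hE := Ct_state β σ₀ 0
    rw [← hE.const (n * (1 + ac q β * (2 * q + 1)))]
    apply hE.mono
    intro x
    have hW : WW x ≤ n * (2 * q + 1) := by
      unfold WW
      have a1 := V_le x.1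
      have a2 := V_le x.2
      have a3 : dd x ^ 2 / n ≤ n := by
        rw [div_le_iff₀ hn]
        nlinarith [dd_le x, dd_nonneg x]
      nlinarith
    simp only [Pi.add_apply, Pi.smul_apply, smul_eq_mul]
    nlinarith [dd_le x]
  have hp : 0 ≤ (1 - rho q β / n) ^ T := pow_nonneg (by linarith) T
  have h2 : ∑ s ∈ range T, (Et β (ev σ₀) s (bad δ) + muF q n β (bad δ)) ≤ 2 := by
    rw [Finset.sum_add_distrib]
    simp only [Finset.sum_const, Finset.card_range, nsmul_eq_mul]
    linarith
  have h3 := mul_le_mul_of_nonneg_left h2 (by positivity : 0 ≤ ac q β * KC q β)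
  have h4 := mul_le_mul_of_nonneg_left h0 hp
  have h5 : (16 * β ^ 2 + ac q β * KC q β) / n / (rho q β / n) =
    (16 * β ^ 2 + ac q β * KC q β) / rho q β := by field_simp
  rw [h5] at hrec
  have h6 : 0 ≤ (16 * β ^ 2 + ac q β * KC q β) / rho q β := by positivity
  have h7 : 0 ≤ n * (1 - rho q β / n) ^ T := by positivity
  have h8 : 0 ≤ ac q β * (2 * q + 1) := by positivity
  have h9 : 0 ≤ ac q β * KC q β := by positivity
  have h10 : 0 ≤ n * (1 - rho q β / n) ^ T *
    ((16 * β ^ 2 + ac q β * KC q β) / rho q β + 2 * (ac q β * KC q β)) := by positivity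
  calc _ ≤ _ := h1
    _ ≤ _ := hrec
    _ ≤ (1 - rho q β / n) ^ T * (n * (1 + ac q β * (2 * q + 1))) +
        (16 * β ^ 2 + ac q β * KC q β) / rho q β + ac q β * KC q β * 2 := by linarith
    _ ≤ _ := by unfold CC; linarith

lemma couple_final {q n : ℕ} [NeZero q] [NeZero n] {β δ : ℝ} (h : Par q β δ) (σ₀ : Fin n → Fin q)
    (T : ℕ) (hb : ∑ s ∈ range T, Et β (ev σ₀) s (bad δ) ≤ 1) (hπ : T * muF q n β (bad δ) ≤ 1)
    (F : (Fin n → Fin q) → ℝ) (L : ℝ) (hL : 0 ≤ L) (hF : ∀ x y, |F x - F y| ≤ L * dd (x, y)) :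
    |Et β (ev σ₀) T F - muF q n β F| ≤ L * (CC q β * (n * (1 - rho q β / n) ^ T + 1)) := by
  have hE := Ct_state β σ₀ T
  have h0 := mul_le_mul_of_nonneg_left (Ct_dd h σ₀ T hb hπ) hL
  have e : Et β (ev σ₀) T F - muF q n β F = Ct β σ₀ T ((fun x => F x.1) - (fun x => F x.2)) := by
    rw [map_sub, Ct_fst, Ct_snd]
  have e2 : L * Ct β σ₀ T dd = Ct β σ₀ T (L • dd) := by rw [map_smul]; rfl
  refine le_trans ?_ h0
  rw [e, e2, abs_le]
  constructor
  · rw [← map_neg]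
    exact hE.mono fun x => by
      have := (abs_le.1 (hF x.1 x.2)).1
      simpa using this
  · exact hE.mono fun x => by
      have := (abs_le.1 (hF x.1 x.2)).2
      simpa using this

end EM

namespace EM

lemma sm_lower {q : ℕ} [NeZero q] (a : Fin q → ℝ) (e A : ℝ) (h : ∀ j, |a j - e| ≤ A) (k) :
    Real.exp (-(2 * A)) / q ≤ sm a k := by
  have hq := ncast_pos q
  unfold sm
  rw [div_le_div_iff₀ hq (sumexp_pos a)]
  have h1 : ∑ j, Real.exp (a j) ≤ q * Real.exp (e + A) := by
    calc _ ≤ ∑ j : Fin q, Real.exp (e + A) :=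
          Finset.sum_le_sum fun j _ => Real.exp_le_exp.2 (by linarith [(abs_le.1 (h j)).2])
      _ = _ := by simp
  have h2 : Real.exp (-(2 * A)) * Real.exp (e + A) ≤ Real.exp (a k) := by
    rw [← Real.exp_add]
    exact Real.exp_le_exp.2 (by linarith [(abs_le.1 (h k)).1])
  calc _ ≤ Real.exp (-(2 * A)) * (q * Real.exp (e + A)) :=
        mul_le_mul_of_nonneg_left h1 (Real.exp_pos _).le
    _ = (Real.exp (-(2 * A)) * Real.exp (e + A)) * q := by ring
    _ ≤ _ := mul_le_mul_of_nonneg_right h2 hq.le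

lemma Pop0_apply {q n : ℕ} [NeZero q] (f : (Fin n → Fin q) → ℝ) (σ) :
    Pop q n 0 f σ = (1 / n) * ∑ u, ∑ k, (1 / q : ℝ) * f (Function.update σ u k) := by
  rw [Pop_apply]
  have : ∀ u, fld 0 σ u = fun _ => (0 : ℝ) := by intro u; ext; simp [fld]
  simp_rw [this, sm_const]

/-- chi-square type distance between one step of the dynamics and free dynamics -/
noncomputable def chi {q n : ℕ} (β : ℝ) (σ : Fin n → Fin q) : ℝ :=
  (1 / n) * ∑ u, ∑ k, (sm (fld β σ u) k - 1 / q) ^ 2 / sm (fld β σ u) k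

/-- constant for chi -/
noncomputable def CX (q : ℕ) (β : ℝ) : ℝ := 32 * β ^ 2 * q ^ 2 * Real.exp (2 * (2 * β * (√q + 1)))

lemma chi_le {q n : ℕ} [NeZero q] [NeZero n] (β : ℝ) (hβ : 0 ≤ β) (σ : Fin n → Fin q) :
    chi β σ ≤ CX q β * (V σ + 1 / n ^ 2) := by
  have hn := ncast_pos n
  have hn1 := ncast_one_le n
  have hq := ncast_pos q
  have hVn := V_nonneg σ
  set B := Real.exp (2 * (2 * β * (√q + 1)))
  have hB : 0 < B := Real.exp_pos _
  have key : ∀ u k, (sm (fld β σ u) k - 1 / q) ^ 2 / sm (fld β σ u) k ≤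
      32 * β ^ 2 * (V σ + 1 / n ^ 2) * (q * B) := by
    intro u k
    have h1 : 1 / (q * B) ≤ sm (fld β σ u) k := by
      have := sm_lower (fld β σ u) (2 * β / q) (2 * β * (√q + 1)) (fun j => by
        refine (fld_near β hβ σ u √q (Real.sqrt_le_sqrt (V_le σ)) j).trans ?_
        have : 1 / (n:ℝ) ≤ 1 := by rw [div_le_one hn]; exact hn1
        gcongr) k
      rw [Real.exp_neg] at this
      refine le_trans (le_of_eq ?_) this
      rw [div_eq_mul_inv, one_mul, mul_inv, mul_comm, ← div_eq_mul_inv]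
    have h2 := sm_near (fld β σ u) (2 * β / q) (2 * β * (√(V σ) + 1 / n)) (fld_near β hβ σ u _ le_rfl) k
    have h3 : (sm (fld β σ u) k - 1 / q) ^ 2 ≤ 32 * β ^ 2 * (V σ + 1 / n ^ 2) := by
      rw [← sq_abs]
      calc _ ≤ (2 * (2 * β * (√(V σ) + 1 / n))) ^ 2 := pow_le_pow_left₀ (abs_nonneg _) h2 2
        _ = 16 * β ^ 2 * (√(V σ) + 1 / n) ^ 2 := by ring
        _ ≤ 16 * β ^ 2 * (2 * (V σ + 1 / n ^ 2)) := by
          apply mul_le_mul_of_nonneg_left _ (by positivity)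
          have a1 := Real.sq_sqrt hVn
          have a2 : (1 / (n:ℝ)) ^ 2 = 1 / n ^ 2 := by ring
          nlinarith [sq_nonneg (√(V σ) - 1 / n)]
        _ = _ := by ring
    rw [div_le_iff₀ (sm_pos _ _)]
    have h4 : 1 ≤ (q * B) * sm (fld β σ u) k := by
      rw [div_le_iff₀ (by positivity)] at h1; linarith
    have h5 : 0 ≤ 32 * β ^ 2 * (V σ + 1 / n ^ 2) := by positivity
    nlinarith
  unfold chi
  calc _ ≤ (1 / (n:ℝ)) * ∑ u : Fin n, ∑ k : Fin q, 32 * β ^ 2 * (V σ + 1 / n ^ 2) * (q * B) := by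
        apply mul_le_mul_of_nonneg_left _ (by positivity)
        exact Finset.sum_le_sum fun u _ => Finset.sum_le_sum fun k _ => key u k
    _ = _ := by
        simp only [Finset.sum_const, Finset.card_univ, Fintype.card_fin, nsmul_eq_mul]
        have e : CX q β = 32 * β ^ 2 * q ^ 2 * B := rfl
        rw [e]
        clear_value B
        field_simp

lemma amgm (a b p l : ℝ) (hp : 0 < p) (hl : 0 < l) :
    |a * b| ≤ (l / 2) * (a ^ 2 / p) + 1 / (2 * l) * (p * b ^ 2) := by
  have e1 : (l / 2) * (a ^ 2 / p) + 1 / (2 * l) * (p * b ^ 2) - a * b =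
      (1 / (2 * l * p)) * (l * a - p * b) ^ 2 := by field_simp; ring
  have e2 : (l / 2) * (a ^ 2 / p) + 1 / (2 * l) * (p * b ^ 2) + a * b =
      (1 / (2 * l * p)) * (l * a + p * b) ^ 2 := by field_simp; ring
  have h1 : 0 ≤ (1 / (2 * l * p)) * (l * a - p * b) ^ 2 := by positivity
  have h2 : 0 ≤ (1 / (2 * l * p)) * (l * a + p * b) ^ 2 := by positivity
  rw [abs_le]; constructor <;> linarith

lemma markov_01 {α : Type*} {K : (α → ℝ) →ₗ[ℝ] (α → ℝ)} (hK : IsMarkov K) {f : α → ℝ}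
    (h0 : ∀ x, 0 ≤ f x) (h1 : ∀ x, f x ≤ 1) : (∀ x, 0 ≤ K f x) ∧ (∀ x, K f x ≤ 1) := by
  refine ⟨hK.1 f h0, fun x => ?_⟩
  have := (hK.ev x).mono h1
  rwa [(hK.ev x).const 1] at this

lemma one_step_cmp {q n : ℕ} [NeZero q] [NeZero n] (β : ℝ) (h : (Fin n → Fin q) → ℝ)
    (h0 : ∀ x, 0 ≤ h x) (h1 : ∀ x, h x ≤ 1) (l : ℝ) (hl : 2 ≤ l) (σ) :
    |Pop q n β h σ - Pop q n 0 h σ| ≤ l * chi β σ +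
      1 / l * (Pop q n β (fun x => h x ^ 2) σ - Pop q n 0 h σ ^ 2) := by
  have hn := ncast_pos n
  have hq := ncast_pos q
  have hl0 : 0 < l := by linarith
  set c := Pop q n 0 h σ with hc
  obtain ⟨hc0, hc1⟩ := markov_01 (Pop_markov (q := q) (n := n) 0) h0 h1
  have hc0 : 0 ≤ c := hc0 σ
  have hc1 : c ≤ 1 := hc1 σ
  have e1 : Pop q n β h σ - c = (1 / n) * ∑ u, ∑ k, (sm (fld β σ u) k - 1 / q) *
      (h (Function.update σ u k) - c) := by
    have a : ∀ u, ∑ k, (sm (fld β σ u) k - 1 / q) * (h (Function.update σ u k) - c) =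
        ∑ k, sm (fld β σ u) k * h (Function.update σ u k) -
        ∑ k, (1 / q : ℝ) * h (Function.update σ u k) := by
      intro u
      have : ∑ k : Fin q, (sm (fld β σ u) k - 1 / q) = 0 := by
        rw [Finset.sum_sub_distrib, sm_sum]; simp
      calc _ = ∑ k, ((sm (fld β σ u) k * h (Function.update σ u k) -
            (1 / q : ℝ) * h (Function.update σ u k)) - (sm (fld β σ u) k - 1 / q) * c) :=
            Finset.sum_congr rfl fun k _ => by ring
        _ = _ := by
          rw [Finset.sum_sub_distrib, Finset.sum_sub_distrib, ← Finset.sum_mul, this]; ring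
    simp_rw [a]
    rw [Finset.sum_sub_distrib, mul_sub, ← Pop_apply, ← Pop0_apply]
  have e2 : Pop q n β (fun x => (h x - c) ^ 2) σ =
      Pop q n β (fun x => h x ^ 2) σ - 2 * c * Pop q n β h σ + c ^ 2 := by
    have e : (fun x => (h x - c) ^ 2) = (fun x => h x ^ 2) - (2 * c) • h + fun _ => c ^ 2 := by
      ext x; simp; ring
    have := ((Pop_markov (q := q) (n := n) β).ev σ).const (c ^ 2)
    change Pop q n β (fun _ => c ^ 2) σ = c ^ 2 at this
    rw [e, map_add, map_sub, map_smul, Pi.add_apply, this]; rfl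
  have h2 : |Pop q n β h σ - c| ≤ (l / 2) * chi β σ + 1 / (2 * l) * Pop q n β (fun x => (h x - c) ^ 2) σ := by
    rw [e1, abs_mul, abs_of_pos (by positivity : 0 < 1 / (n:ℝ)), Pop_apply]
    unfold chi
    calc _ ≤ (1 / (n:ℝ)) * ∑ u, ∑ k, ((l / 2) * ((sm (fld β σ u) k - 1 / q) ^ 2 / sm (fld β σ u) k) +
          1 / (2 * l) * (sm (fld β σ u) k * (h (Function.update σ u k) - c) ^ 2)) := by
          apply mul_le_mul_of_nonneg_left _ (by positivity)
          refine (Finset.abs_sum_le_sum_abs _ _).trans (Finset.sum_le_sum fun u _ => ?_)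
          refine (Finset.abs_sum_le_sum_abs _ _).trans (Finset.sum_le_sum fun k _ => ?_)
          exact amgm _ _ _ _ (sm_pos _ _) hl0
      _ = _ := by
          simp_rw [Finset.sum_add_distrib, ← Finset.mul_sum]; ring
  rw [e2] at h2
  set D := Pop q n β h σ - c with hD
  have h3 : Pop q n β (fun x => h x ^ 2) σ - 2 * c * Pop q n β h σ + c ^ 2 ≤
      (Pop q n β (fun x => h x ^ 2) σ - c ^ 2) + 2 * |D| := by
    have : -(2 * c * D) ≤ 2 * |D| := by
      have a1 := neg_le_abs D
      have a2 := abs_nonneg D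
      nlinarith
    have e : Pop q n β h σ = D + c := by rw [hD]; ring
    rw [e]; nlinarith
  have h4 := mul_le_mul_of_nonneg_left h3 (by positivity : 0 ≤ 1 / (2 * l))
  have h5 : 1 / (2 * l) * (2 * |D|) ≤ (1 / 2) * |D| := by
    have : 1 / (2 * l) * (2 * |D|) = (1 / l) * |D| := by field_simp
    rw [this]
    apply mul_le_mul_of_nonneg_right _ (abs_nonneg _)
    exact one_div_le_one_div_of_le (by norm_num) hl
  have e6 : 1 / l * (Pop q n β (fun x => h x ^ 2) σ - c ^ 2) =
    2 * (1 / (2 * l) * (Pop q n β (fun x => h x ^ 2) σ - c ^ 2)) := by field_simp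
  rw [e6]
  nlinarith

lemma cmp_steps {q n : ℕ} [NeZero q] [NeZero n] (β : ℝ) {φ : ((Fin n → Fin q) → ℝ) →ₗ[ℝ] ℝ}
    (hφ : IsState φ) (l : ℝ) (hl : 2 ≤ l) (m : ℕ) (f : (Fin n → Fin q) → ℝ)
    (h0 : ∀ x, 0 ≤ f x) (h1 : ∀ x, f x ≤ 1) :
    |Et β φ m f - φ ((Pop q n 0 ^ m) f)| ≤ l * ∑ t ∈ range m, Et β φ t (chi β) +
      1 / l * (Et β φ m (fun x => f x ^ 2) - φ (fun x => ((Pop q n 0 ^ m) f) x ^ 2)) := by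
  induction m generalizing f with
  | zero => simp [Et_zero]
  | succ m ih =>
    obtain ⟨g0, g1⟩ := markov_01 (Pop_markov (q := q) (n := n) 0) h0 h1
    have i := ih (Pop q n 0 f) g0 g1
    have hE := Et_state β hφ m
    have e : (Pop q n 0 ^ (m + 1)) f = (Pop q n 0 ^ m) (Pop q n 0 f) := by rw [pow_succ]; rfl
    rw [e, Finset.sum_range_succ, Et_succ, Et_succ]
    have s : |Et β φ m (Pop q n β f) - Et β φ m (Pop q n 0 f)| ≤ l * Et β φ m (chi β) +
        1 / l * (Et β φ m (Pop q n β (fun x => f x ^ 2)) - Et β φ m (fun x => Pop q n 0 f x ^ 2)) := by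
      have a1 : Et β φ m (l • chi β + (1 / l) • (Pop q n β (fun x => f x ^ 2) - fun x => Pop q n 0 f x ^ 2)) =
         l * Et β φ m (chi β) + 1 / l * (Et β φ m (Pop q n β (fun x => f x ^ 2)) -
          Et β φ m (fun x => Pop q n 0 f x ^ 2)) := by
        rw [map_add, map_smul, map_smul, map_sub]; rfl
      rw [← a1, ← map_sub, abs_le]
      constructor
      · rw [← map_neg]
        exact hE.mono fun x => by
          have := (abs_le.1 (one_step_cmp β f h0 h1 l hl x)).1
          simpa using this
      · exact hE.mono fun x => by
          have := (abs_le.1 (one_step_cmp β f h0 h1 l hl x)).2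
          simpa using this
    have t := abs_sub_le (Et β φ m (Pop q n β f)) (Et β φ m (Pop q n 0 f))
      (φ ((Pop q n 0 ^ m) (Pop q n 0 f)))
    have r : l * (∑ t ∈ range m, Et β φ t (chi β) + Et β φ m (chi β)) =
      l * ∑ t ∈ range m, Et β φ t (chi β) + l * Et β φ m (chi β) := by ring
    rw [r]
    linarith

lemma cmp_final {q n : ℕ} [NeZero q] [NeZero n] (β : ℝ) (hβ : 0 ≤ β)
    {φ : ((Fin n → Fin q) → ℝ) →ₗ[ℝ] ℝ}
    (hφ : IsState φ) (l : ℝ) (hl : 2 ≤ l) (m : ℕ) (f : (Fin n → Fin q) → ℝ)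
    (h0 : ∀ x, 0 ≤ f x) (h1 : ∀ x, f x ≤ 1) (M : ℝ) (hM : ∀ t < m, Et β φ t V ≤ M) :
    |Et β φ m f - φ ((Pop q n 0 ^ m) f)| ≤ l * (m * (CX q β * (M + 1 / n ^ 2))) + 1 / l := by
  refine (cmp_steps β hφ l hl m f h0 h1).trans ?_
  have hl0 : 0 < l := by linarith
  have hCX : 0 ≤ CX q β := by unfold CX; positivity
  have a1 : ∑ t ∈ range m, Et β φ t (chi β) ≤ m * (CX q β * (M + 1 / n ^ 2)) := by
    calc _ ≤ ∑ t ∈ range m, CX q β * (M + 1 / n ^ 2) := by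
          refine Finset.sum_le_sum fun t ht => ?_
          have hE := Et_state β hφ t
          have b1 := hE.mono (fun σ => chi_le β hβ σ)
          have e : (fun σ : Fin n → Fin q => CX q β * (V σ + 1 / n ^ 2)) =
            fun σ => CX q β * V σ + CX q β * (1 / n ^ 2) := by ext; ring
          rw [e, state_const hE] at b1
          have := mul_le_mul_of_nonneg_left (hM t (Finset.mem_range.1 ht)) hCX
          linarith
      _ = _ := by simp
  have a2 : Et β φ m (fun x => f x ^ 2) ≤ 1 := by
    have hE := Et_state β hφ m
    rw [← hE.const 1]
    exact hE.mono fun x => pow_le_one₀ (h0 x) (h1 x)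
  have a3 : 0 ≤ φ (fun x => ((Pop q n 0 ^ m) f) x ^ 2) := hφ.1 _ fun x => sq_nonneg _
  have a4 : 1 / l * (Et β φ m (fun x => f x ^ 2) - φ (fun x => ((Pop q n 0 ^ m) f) x ^ 2)) ≤ 1 / l * 1 :=
    mul_le_mul_of_nonneg_left (by linarith) (by positivity)
  have a5 := mul_le_mul_of_nonneg_left a1 hl0.le
  linarith

end EM

namespace EM

lemma sum_self_update {q n : ℕ} [NeZero q] (u : Fin n) (G : (Fin n → Fin q) → Fin q → ℝ)
    (hG : ∀ z k j, G (Function.update z u k) j = G z j) :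
    ∑ z, G z (z u) = (1 / q) * ∑ z, ∑ k, G z k := by
  have hq := ncast_pos q
  have h := sum_update_swap (q := q) u (fun z w : Fin n → Fin q => G w (w u))
  simp only [Function.update_self, hG] at h
  rw [h]
  simp only [Finset.sum_const, Finset.card_univ, Fintype.card_fin, nsmul_eq_mul]
  rw [← Finset.mul_sum]
  field_simp

/-- resampling of the coordinates in `R` -/
noncomputable def TT {q n : ℕ} (f : (Fin n → Fin q) → ℝ) (R : Finset (Fin n))
    (x : Fin n → Fin q) : ℝ := (1 / (q : ℝ) ^ n) * ∑ z, f (R.piecewise z x)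

lemma card_pos' (q n : ℕ) [NeZero q] : (0:ℝ) < (q : ℝ) ^ n := pow_pos (ncast_pos q) n

lemma TT_empty {q n : ℕ} [NeZero q] (f : (Fin n → Fin q) → ℝ) : TT f ∅ = f := by
  ext x
  have := card_pos' q n
  unfold TT
  simp only [Finset.piecewise_empty, Finset.sum_const, Finset.card_univ, Fintype.card_fun,
    Fintype.card_fin, nsmul_eq_mul, Nat.cast_pow]
  field_simp

lemma TT_insert {q n : ℕ} [NeZero q] (f : (Fin n → Fin q) → ℝ) (R : Finset (Fin n)) (u : Fin n)
    (x : Fin n → Fin q) :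
    ∑ k, (1 / q : ℝ) * TT f R (Function.update x u k) = TT f (insert u R) x := by
  have hq := ncast_pos q
  unfold TT
  by_cases hu : u ∈ R
  · rw [Finset.insert_eq_of_mem hu]
    have : ∀ k z, R.piecewise z (Function.update x u k) = R.piecewise z x := by
      intro k z
      ext v
      by_cases hv : v ∈ R
      · simp [hv]
      · have : v ≠ u := fun h => hv (h ▸ hu)
        simp [hv, this]
    simp_rw [this]
    simp only [Finset.sum_const, Finset.card_univ, Fintype.card_fin, nsmul_eq_mul]
    field_simp
  · have e : ∀ z : Fin n → Fin q, (insert u R).piecewise z x = R.piecewise z (Function.update x u (z u)) := by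
      intro z
      ext v
      by_cases hv : v = u
      · subst hv; simp [hu]
      · by_cases hvR : v ∈ R <;> simp [hv, hvR]
    simp_rw [e]
    rw [sum_self_update u (fun z k => f (R.piecewise z (Function.update x u k)))]
    · rw [← Finset.mul_sum, ← Finset.mul_sum, Finset.sum_comm]; ring
    · intro z k j
      congr 1
      ext v
      by_cases hvR : v ∈ R
      · have : v ≠ u := fun h => hu (h ▸ hvR)
        simp [hvR, this]
      · simp [hvR]

lemma Pop0_TT {q n : ℕ} [NeZero q] (f : (Fin n → Fin q) → ℝ) (R : Finset (Fin n)) :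
    Pop q n 0 (TT f R) = ∑ u, (1 / n : ℝ) • TT f (insert u R) := by
  ext x
  rw [Pop0_apply]
  simp_rw [TT_insert]
  rw [Finset.mul_sum]
  simp [Finset.sum_apply]

/-- the sum of centered indicators -/
noncomputable def SS {q n : ℕ} (R : Finset (Fin n)) (a b : Fin q) (z : Fin n → Fin q) : ℝ :=
  ∑ w ∈ R, ((if z w = a then (1:ℝ) else 0) - (if z w = b then 1 else 0))

lemma SS_second {q n : ℕ} [NeZero q] (R : Finset (Fin n)) (a b : Fin q) :
    ∑ z : Fin n → Fin q, SS R a b z ^ 2 ≤ (q : ℝ) ^ n * R.card := by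
  set ξ : Fin q → ℝ := fun k => (if k = a then (1:ℝ) else 0) - (if k = b then 1 else 0) with hξ
  have hξ1 : ∀ k, ξ k ^ 2 ≤ 1 := by
    intro k; simp only [hξ]; split_ifs <;> norm_num
  have hξ0 : ∑ k, ξ k = 0 := by simp [hξ]
  have off : ∀ w w', w ≠ w' → ∑ z : Fin n → Fin q, ξ (z w) * ξ (z w') = 0 := by
    intro w w' hw
    rw [sum_self_update w (fun z k => ξ k * ξ (z w'))]
    · simp_rw [← Finset.sum_mul, hξ0]; simp
    · intro z k j
      rw [Function.update_of_ne hw.symm]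
  have e : ∀ z : Fin n → Fin q, SS R a b z ^ 2 = ∑ w ∈ R, ∑ w' ∈ R, ξ (z w) * ξ (z w') := by
    intro z
    unfold SS
    rw [sq, Finset.sum_mul_sum]
  simp_rw [e]
  rw [Finset.sum_comm]
  calc _ ≤ ∑ w ∈ R, (q : ℝ) ^ n := by
        refine Finset.sum_le_sum fun w hw => ?_
        rw [Finset.sum_comm, Finset.sum_eq_single_of_mem w hw (fun w' _ hne => off w w' hne.symm)]
        calc _ ≤ ∑ z : Fin n → Fin q, (1:ℝ) :=
              Finset.sum_le_sum fun z _ => by rw [← sq]; exact hξ1 _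
          _ = _ := by simp
    _ = _ := by simp; ring

lemma SS_abs {q n : ℕ} [NeZero q] (R : Finset (Fin n)) (hR : 0 < R.card) (a b : Fin q) (l : ℝ) (hl : 0 < l)
    (g : (Fin n → Fin q) → ℝ) (h0 : ∀ z, 0 ≤ g z) (h1 : ∀ z, g z ≤ 1) :
    |(1 / (q : ℝ) ^ n) * ∑ z, SS R a b z * g z| ≤ R.card * ((1/2) * (l / R.card + 1 / l)) := by
  have hc := card_pos' q n
  have hr : (0:ℝ) < R.card := by exact_mod_cast hR
  rw [abs_mul, abs_of_pos (by positivity)]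
  have : ∀ z, |SS R a b z * g z| ≤ (l / (2 * R.card)) * SS R a b z ^ 2 + R.card / (2 * l) := by
    intro z
    rw [abs_mul, abs_of_nonneg (h0 z)]
    have a1 : |SS R a b z| * g z ≤ |SS R a b z| := mul_le_of_le_one_right (abs_nonneg _) (h1 z)
    refine a1.trans ?_
    have := amgm (SS R a b z) 1 R.card l hr hl
    rw [mul_one] at this
    refine this.trans (le_of_eq ?_)
    field_simp
  have h2 : |∑ z, SS R a b z * g z| ≤ (l / (2 * R.card)) * ((q:ℝ) ^ n * R.card) + (q:ℝ) ^ n * (R.card / (2 * l)) := by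
    refine (Finset.abs_sum_le_sum_abs _ _).trans ?_
    refine (Finset.sum_le_sum fun z _ => this z).trans ?_
    rw [Finset.sum_add_distrib, ← Finset.mul_sum]
    have := mul_le_mul_of_nonneg_left (SS_second R a b) (by positivity : 0 ≤ l / (2 * (R.card:ℝ)))
    simp only [Finset.sum_const, Finset.card_univ, Fintype.card_fun, Fintype.card_fin, nsmul_eq_mul,
      Nat.cast_pow]
    linarith
  calc _ ≤ _ := mul_le_mul_of_nonneg_left h2 (by positivity)
    _ = _ := by field_simp

/-- invariance under swaps inside classes of `s` -/
def Inv {q n : ℕ} (s : Fin n → Fin q) (f : (Fin n → Fin q) → ℝ) : Prop :=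
  ∀ v w, s v = s w → ∀ x, f (x ∘ Equiv.swap v w) = f x

lemma TT_diff {q n : ℕ} [NeZero q] (s : Fin n → Fin q) (f : (Fin n → Fin q) → ℝ)
    (h0 : ∀ z, 0 ≤ f z) (h1 : ∀ z, f z ≤ 1) (hs : Inv s f) (R : Finset (Fin n)) (v : Fin n)
    (x : Fin n → Fin q) (a b : Fin q) (l : ℝ) (hl : 0 < l) :
    |TT f R (Function.update x v a) - TT f R (Function.update x v b)| ≤
      q / 2 * (l * (1 / (1 + (R.filter (fun w => s w = s v)).card)) + 1 / l) := by
  have hq := ncast_pos q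
  have hc := card_pos' q n
  by_cases hv : v ∈ R
  · have e : ∀ c, TT f R (Function.update x v c) = TT f R x := by
      intro c
      unfold TT
      congr 1
      refine Finset.sum_congr rfl fun z _ => ?_
      congr 1
      ext w
      by_cases hw : w ∈ R
      · simp [hw]
      · have : w ≠ v := fun h => hw (h ▸ hv)
        simp [hw, this]
    rw [e, e, sub_self, abs_zero]
    positivity
  · set g : (Fin n → Fin q) → ℝ := fun z => f ((insert v R).piecewise z x) with hg
    set Q := insert v (R.filter (fun w => s w = s v)) with hQ
    have hQc : (Q.card : ℝ) = 1 + (R.filter (fun w => s w = s v)).card := by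
      rw [hQ, Finset.card_insert_of_notMem (by simp [hv])]; push_cast; ring
    have hQpos : 0 < Q.card := Finset.card_pos.2 ⟨v, by simp [hQ]⟩
    have hQp : (0:ℝ) < Q.card := by exact_mod_cast hQpos
    have e1 : ∀ c, TT f R (Function.update x v c) = (q / q ^ n : ℝ) * ∑ z, (if z v = c then 1 else 0) * g z := by
      intro c
      unfold TT
      have : ∀ z : Fin n → Fin q, (if z v = c then (1:ℝ) else 0) * g z =
          (fun (z : Fin n → Fin q) k => (if k = c then (1:ℝ) else 0) * f (R.piecewise z (Function.update x v k))) z (z v) := by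
        intro z
        simp only [hg]
        congr 2
        ext w
        by_cases hw : w = v
        · subst hw; simp [hv]
        · by_cases hwR : w ∈ R <;> simp [hw, hwR]
      rw [Finset.sum_congr rfl (fun z _ => this z), sum_self_update v (fun z k => (if k = c then (1:ℝ) else 0) * f (R.piecewise z (Function.update x v k)))]
      · simp
        field_simp
      · intro z k j
        congr 2
        ext w
        by_cases hvR : w ∈ R
        · have : w ≠ v := fun h => hv (h ▸ hvR)
          simp [hvR, this]
        · simp [hvR]
    have e2 : ∀ c, ∀ w ∈ Q, ∑ z, (if z w = c then (1:ℝ) else 0) * g z = ∑ z, (if z v = c then 1 else 0) * g z := by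
      intro c w hw
      have hwR : w ∈ insert v R := by
        rw [hQ] at hw
        rcases Finset.mem_insert.1 hw with h | h
        · simp [h]
        · exact Finset.mem_insert_of_mem (Finset.mem_filter.1 h).1
      have hws : s v = s w := by
        rw [hQ] at hw
        rcases Finset.mem_insert.1 hw with h | h
        · rw [h]
        · exact ((Finset.mem_filter.1 h).2).symm
      rw [← Equiv.sum_comp (Equiv.arrowCongr (Equiv.swap v w) (Equiv.refl (Fin q)))
        (fun z => (if z w = c then (1:ℝ) else 0) * g z)]
      refine Finset.sum_congr rfl fun z _ => ?_
      have e3 : (Equiv.arrowCongr (Equiv.swap v w) (Equiv.refl (Fin q))) z = z ∘ Equiv.swap v w := by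
        ext y; simp
      rw [e3]
      have e4 : (z ∘ Equiv.swap v w) w = z v := by simp
      have e5 : g (z ∘ Equiv.swap v w) = g z := by
        simp only [hg]
        rw [← hs v w hws]
        congr 1
        ext y
        simp only [Function.comp]
        by_cases hyv : y = v
        · subst hyv
          have : y ∈ insert y R := by simp
          simp [hwR, this]
        · by_cases hyw : y = w
          · subst hyw
            have : v ∈ insert v R := by simp
            simp [hwR, this]
          · rw [Equiv.swap_apply_of_ne_of_ne hyv hyw]
            by_cases hy : y ∈ insert v R
            · simp only [hy, Finset.piecewise_eq_of_mem, Function.comp]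
              rw [Equiv.swap_apply_of_ne_of_ne hyv hyw]
            · simp only [hy, not_false_eq_true, Finset.piecewise_eq_of_notMem]
      rw [e4, e5]
    have e6 : TT f R (Function.update x v a) - TT f R (Function.update x v b) =
        (q / Q.card) * ((1 / (q:ℝ) ^ n) * ∑ z, SS Q a b z * g z) := by
      have : ∑ z, SS Q a b z * g z = Q.card * (∑ z, (if z v = a then 1 else 0) * g z -
          ∑ z, (if z v = b then 1 else 0) * g z) := by
        unfold SS
        simp_rw [Finset.sum_mul]
        rw [Finset.sum_comm]
        have : ∀ w ∈ Q, ∑ z : Fin n → Fin q, ((if z w = a then (1:ℝ) else 0) - (if z w = b then 1 else 0)) * g z =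
          (∑ z, (if z v = a then 1 else 0) * g z - ∑ z, (if z v = b then 1 else 0) * g z) := by
          intro w hw
          simp_rw [sub_mul]
          rw [Finset.sum_sub_distrib, e2 a w hw, e2 b w hw]
        rw [Finset.sum_congr rfl this]
        rw [Finset.sum_const, nsmul_eq_mul]
      rw [this, e1, e1]
      field_simp
    rw [e6, abs_mul, abs_of_pos (by positivity : 0 < (q:ℝ) / Q.card), ← hQc]
    have := SS_abs Q hQpos a b l hl g (fun z => h0 _) (fun z => h1 _)
    calc _ ≤ _ := mul_le_mul_of_nonneg_left this (by positivity)
      _ = _ := by field_simp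

lemma hstep (p c s : ℝ) (hs : 1 ≤ s) (hc : 0 ≤ c) (hp : 2 * c ≤ p) :
    p * (1 / (s + 1)) + (1 - p) * (1 / s) ≤ 1 / (s + c) := by
  have h1 : 0 < s := by linarith
  have h2 : 0 < s + c := by linarith
  have e : 1 / (s + c) - (p * (1 / (s + 1)) + (1 - p) * (1 / s)) =
      (p * (s + c) - c * (s + 1)) / (s * (s + 1) * (s + c)) := by field_simp; ring
  have : 0 ≤ (p * (s + c) - c * (s + 1)) / (s * (s + 1) * (s + c)) := by
    apply div_nonneg _ (by positivity)
    nlinarith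
  linarith

/-- class of `v` -/
def cls {q n : ℕ} (s : Fin n → Fin q) (v : Fin n) : Finset (Fin n) := univ.filter (fun w => s w = s v)

lemma smooth_ind {q n : ℕ} [NeZero q] [NeZero n] (s : Fin n → Fin q) (f : (Fin n → Fin q) → ℝ)
    (h0 : ∀ z, 0 ≤ f z) (h1 : ∀ z, f z ≤ 1) (hs : Inv s f) (v : Fin n)
    (x : Fin n → Fin q) (a b : Fin q) (l : ℝ) (hl : 0 < l) (c : ℝ) (hc : 0 ≤ c) (m : ℕ) :
    ∀ R : Finset (Fin n), ((R.filter (fun w => s w = s v)).card : ℝ) + m + 2 * c * n ≤ (cls s v).card →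
    |((Pop q n 0 ^ m) (TT f R)) (Function.update x v a) - ((Pop q n 0 ^ m) (TT f R)) (Function.update x v b)| ≤
      q / 2 * (l * (1 / (1 + (R.filter (fun w => s w = s v)).card + c * m)) + 1 / l) := by
  have hn := ncast_pos n
  have hq := ncast_pos q
  induction m with
  | zero =>
    intro R _
    simpa using TT_diff s f h0 h1 hs R v x a b l hl
  | succ m ih =>
    intro R hR
    set r : ℝ := ((R.filter (fun w => s w = s v)).card : ℝ) with hr
    have hr0 : 0 ≤ r := by positivity
    have e : ∀ y, ((Pop q n 0 ^ (m + 1)) (TT f R)) y =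
        ∑ u, (1 / n : ℝ) * ((Pop q n 0 ^ m) (TT f (insert u R))) y := by
      intro y
      rw [pow_succ, Module.End.mul_apply, Pop0_TT, map_sum, Finset.sum_apply]
      simp
    rw [e, e, ← Finset.sum_sub_distrib]
    push_cast at hR
    have cardi : ∀ u, (((insert u R).filter (fun w => s w = s v)).card : ℝ) =
        r + if u ∈ cls s v \ R then 1 else 0 := by
      intro u
      rw [Finset.filter_insert]
      by_cases hu : s u = s v
      · by_cases huR : u ∈ R
        · have : u ∈ R.filter (fun w => s w = s v) := by simp [hu, huR]
          simp [hu, huR, Finset.insert_eq_of_mem this, hr]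
        · rw [if_pos hu, Finset.card_insert_of_notMem (by simp [huR])]
          simp [cls, hu, huR, hr]
      · simp [cls, hu, hr]
    have b1 : ∀ u, |((Pop q n 0 ^ m) (TT f (insert u R))) (Function.update x v a) -
        ((Pop q n 0 ^ m) (TT f (insert u R))) (Function.update x v b)| ≤
        q / 2 * (l * (1 / (1 + r + c * m) + (if u ∈ cls s v \ R then 1 else 0) *
          (1 / (1 + r + c * m + 1) - 1 / (1 + r + c * m))) + 1 / l) := by
      intro u
      have := ih (insert u R) (by
        rw [cardi]
        split_ifs <;> linarith)
      rw [cardi] at this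
      refine this.trans (le_of_eq ?_)
      split_ifs
      · have : 1 + (r + 1) + c * m = 1 + r + c * m + 1 := by ring
        rw [this]; ring
      · ring
    have hcard : ∑ u : Fin n, (if u ∈ cls s v \ R then (1:ℝ) else 0) = (cls s v).card - r := by
      have h3 : (cls s v \ R).card + (R.filter (fun w => s w = s v)).card = (cls s v).card := by
        rw [← Finset.card_sdiff_add_card_inter (cls s v) R]
        congr 2
        ext w; simp [cls, and_comm]
      simp only [Finset.sum_boole]
      rw [hr, ← h3]
      push_cast
      have : (univ.filter (fun u => u ∈ cls s v \ R)) = cls s v \ R := by ext; simp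
      rw [this]; ring
    set S := 1 + r + c * m with hS
    have hS1 : 1 ≤ S := by
      have : 0 ≤ c * m := by positivity
      linarith
    set p := ((cls s v).card - r) / (n : ℝ) with hp
    have hp2 : 2 * c ≤ p := by
      rw [hp, le_div_iff₀ hn]
      have : (0:ℝ) ≤ m := by positivity
      linarith
    have hst := hstep p c S hS1 hc hp2
    calc _ ≤ ∑ u : Fin n, (1 / n : ℝ) * (q / 2 * (l * (1 / S + (if u ∈ cls s v \ R then 1 else 0) *
          (1 / (S + 1) - 1 / S)) + 1 / l)) := by
          refine (Finset.abs_sum_le_sum_abs _ _).trans (Finset.sum_le_sum fun u _ => ?_)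
          rw [← mul_sub, abs_mul, abs_of_pos (by positivity : 0 < 1 / (n:ℝ))]
          exact mul_le_mul_of_nonneg_left (b1 u) (by positivity)
      _ = q / 2 * (l * (p * (1 / (S + 1)) + (1 - p) * (1 / S)) + 1 / l) := by
          rw [← Finset.mul_sum, ← Finset.mul_sum, Finset.sum_add_distrib, ← Finset.mul_sum,
            Finset.sum_add_distrib, ← Finset.sum_mul, hcard]
          simp only [Finset.sum_const, Finset.card_univ, Fintype.card_fin, nsmul_eq_mul]
          have : ((cls s v).card : ℝ) - r = n * p := by rw [hp]; field_simp
          rw [this]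
          field_simp
          ring
      _ ≤ q / 2 * (l * (1 / (S + c)) + 1 / l) := by gcongr
      _ = _ := by
          have : S + c = 1 + r + c * ((m + 1 : ℕ) : ℝ) := by rw [hS]; push_cast; ring
          rw [this]

lemma lip_of_single {q n : ℕ} (F : (Fin n → Fin q) → ℝ) (L : ℝ)
    (h : ∀ x v a b, |F (Function.update x v a) - F (Function.update x v b)| ≤ L) (x y) :
    |F x - F y| ≤ L * dd (x, y) := by
  have key : ∀ D : Finset (Fin n), |F x - F (D.piecewise y x)| ≤
      L * ∑ v ∈ D, (if x v = y v then (0:ℝ) else 1) := by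
    intro D
    induction D using Finset.induction_on with
    | empty => simp
    | insert v D hv ih =>
      rw [Finset.sum_insert hv, Finset.piecewise_insert]
      split_ifs with hxy
      · have : Function.update (D.piecewise y x) v (y v) = D.piecewise y x := by
          rw [← hxy]
          conv_lhs => rw [show x v = D.piecewise y x v by simp [hv]]
          exact Function.update_eq_self _ _
        rw [this, zero_add]; exact ih
      · have h2 := h (D.piecewise y x) v (D.piecewise y x v) (y v)
        rw [Function.update_eq_self] at h2
        have := abs_sub_le (F x) (F (D.piecewise y x)) (F (Function.update (D.piecewise y x) v (y v)))
        linarith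
  have := key univ
  rw [Finset.piecewise_univ] at this
  exact this

lemma smooth_final {q n : ℕ} [NeZero q] [NeZero n] (s : Fin n → Fin q) (f : (Fin n → Fin q) → ℝ)
    (h0 : ∀ z, 0 ≤ f z) (h1 : ∀ z, f z ≤ 1) (hs : Inv s f) (l : ℝ) (hl : 0 < l) (c : ℝ) (hc : 0 ≤ c)
    (m : ℕ) (hm : ∀ v, (m : ℝ) + 2 * c * n ≤ (cls s v).card) (x y) :
    |((Pop q n 0 ^ m) f) x - ((Pop q n 0 ^ m) f) y| ≤
      (q / 2 * (l * (1 / (1 + c * m)) + 1 / l)) * dd (x, y) := by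
  apply lip_of_single
  intro x v a b
  have := smooth_ind s f h0 h1 hs v x a b l hl c hc m ∅ (by simpa using hm v)
  rw [TT_empty] at this
  simpa using this

end EM

namespace EM

/-- permutation action on functions -/
def Rg {q n : ℕ} (g : Equiv.Perm (Fin n)) (f : (Fin n → Fin q) → ℝ) : (Fin n → Fin q) → ℝ :=
  fun x => f (x ∘ g)

lemma cnt_perm {q n : ℕ} (g : Equiv.Perm (Fin n)) (σ : Fin n → Fin q) : cnt (σ ∘ g) = cnt σ := by
  ext k
  unfold cnt
  exact Equiv.sum_comp g (fun v => if σ v = k then (1:ℝ) else 0)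

lemma fld_perm {q n : ℕ} (β : ℝ) (g : Equiv.Perm (Fin n)) (σ : Fin n → Fin q) (u : Fin n) :
    fld β (σ ∘ g) u = fld β σ (g u) := by
  ext k
  unfold fld
  rw [cnt_perm]; rfl

lemma update_perm {q n : ℕ} (g : Equiv.Perm (Fin n)) (σ : Fin n → Fin q) (u : Fin n) (k : Fin q) :
    Function.update (σ ∘ g) u k = Function.update σ (g u) k ∘ g := by
  ext w
  by_cases h : w = u
  · subst h; simp
  · have : g w ≠ g u := fun e => h (g.injective e)
    simp [h, this]

lemma Pop_perm {q n : ℕ} (β : ℝ) (g : Equiv.Perm (Fin n)) (f : (Fin n → Fin q) → ℝ) :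
    Pop q n β (Rg g f) = Rg g (Pop q n β f) := by
  ext σ
  show _ = Pop q n β f (σ ∘ g)
  rw [Pop_apply, Pop_apply]
  congr 1
  rw [← Equiv.sum_comp g]
  refine Finset.sum_congr rfl fun u _ => Finset.sum_congr rfl fun k _ => ?_
  rw [fld_perm, update_perm]; rfl

lemma Pop_perm_pow {q n : ℕ} (β : ℝ) (g : Equiv.Perm (Fin n)) (t : ℕ) (f : (Fin n → Fin q) → ℝ) :
    (Pop q n β ^ t) (Rg g f) = Rg g ((Pop q n β ^ t) f) := by
  induction t generalizing f with
  | zero => simp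
  | succ t ih => rw [pow_succ, Module.End.mul_apply, Module.End.mul_apply, Pop_perm, ih]

lemma weight_perm {q n : ℕ} (β : ℝ) (g : Equiv.Perm (Fin n)) (σ : Fin n → Fin q) :
    pottsWeight q n β (σ ∘ g) = pottsWeight q n β σ := by
  unfold pottsWeight
  rw [energy_eq, energy_eq, cnt_perm]

lemma muF_perm {q n : ℕ} (β : ℝ) (g : Equiv.Perm (Fin n)) (f : (Fin n → Fin q) → ℝ) :
    muF q n β (Rg g f) = muF q n β f := by
  rw [muF_apply, muF_apply]
  rw [← Equiv.sum_comp (Equiv.arrowCongr g.symm (Equiv.refl (Fin q))) (fun σ => pottsMeasure q n β σ * f σ)]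
  refine Finset.sum_congr rfl fun σ _ => ?_
  have e : (Equiv.arrowCongr g.symm (Equiv.refl (Fin q))) σ = σ ∘ g := by ext; simp
  rw [e]
  unfold pottsMeasure
  rw [weight_perm]; rfl

/-- stabilizer -/
def stab {q n : ℕ} (s : Fin n → Fin q) : Finset (Equiv.Perm (Fin n)) :=
  univ.filter (fun g => s ∘ g = s)

/-- symmetrization -/
noncomputable def symm {q n : ℕ} (s : Fin n → Fin q) (f : (Fin n → Fin q) → ℝ) : (Fin n → Fin q) → ℝ :=
  (1 / ((stab s).card : ℝ)) • ∑ g ∈ stab s, Rg g f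

lemma stab_card {q n : ℕ} (s : Fin n → Fin q) : (0:ℝ) < (stab s).card := by
  have : 0 < (stab s).card := Finset.card_pos.2 ⟨1, by simp [stab]⟩
  exact_mod_cast this

lemma symm_lin {q n : ℕ} (s : Fin n → Fin q) (f : (Fin n → Fin q) → ℝ)
    (φ : ((Fin n → Fin q) → ℝ) →ₗ[ℝ] ℝ) (h : ∀ g ∈ stab s, φ (Rg g f) = φ f) : φ (symm s f) = φ f := by
  have := stab_card s
  unfold symm
  rw [map_smul, map_sum, Finset.sum_congr rfl h]
  simp
  field_simp

lemma symm_mu {q n : ℕ} (β : ℝ) (s : Fin n → Fin q) (f : (Fin n → Fin q) → ℝ) :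
    muF q n β (symm s f) = muF q n β f := symm_lin s f _ (fun g _ => muF_perm β g f)

lemma symm_Et {q n : ℕ} (β : ℝ) (s : Fin n → Fin q) (t : ℕ) (f : (Fin n → Fin q) → ℝ) :
    Et β (ev s) t (symm s f) = Et β (ev s) t f := by
  refine symm_lin s f _ (fun g hg => ?_)
  show ((Pop q n β ^ t) (Rg g f)) s = ((Pop q n β ^ t) f) s
  rw [Pop_perm_pow]
  show ((Pop q n β ^ t) f) (s ∘ g) = _
  have : s ∘ g = s := by simpa [stab] using hg
  rw [this]

lemma symm_nonneg {q n : ℕ} (s : Fin n → Fin q) (f : (Fin n → Fin q) → ℝ) (h : ∀ x, 0 ≤ f x) (x) :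
    0 ≤ symm s f x := by
  have := stab_card s
  unfold symm
  simp only [Pi.smul_apply, Finset.sum_apply, smul_eq_mul]
  exact mul_nonneg (by positivity) (Finset.sum_nonneg fun g _ => h _)

lemma symm_le {q n : ℕ} (s : Fin n → Fin q) (f : (Fin n → Fin q) → ℝ) (h : ∀ x, f x ≤ 1) (x) :
    symm s f x ≤ 1 := by
  have hc := stab_card s
  unfold symm
  simp only [Pi.smul_apply, Finset.sum_apply, smul_eq_mul]
  have : ∑ g ∈ stab s, Rg g f x ≤ ∑ g ∈ stab s, (1:ℝ) := Finset.sum_le_sum fun g _ => h _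
  rw [Finset.sum_const, nsmul_eq_mul, mul_one] at this
  rw [div_mul_eq_mul_div, one_mul, div_le_one hc]
  exact this

lemma symm_inv {q n : ℕ} (s : Fin n → Fin q) (f : (Fin n → Fin q) → ℝ) : Inv s (symm s f) := by
  intro v w hvw x
  unfold symm
  simp only [Pi.smul_apply, Finset.sum_apply, smul_eq_mul]
  congr 1
  have hsw : s ∘ Equiv.swap v w = s := by
    ext y
    simp only [Function.comp]
    by_cases hv : y = v
    · subst hv; simp [hvw]
    · by_cases hw : y = w
      · subst hw; simp [hvw]
      · rw [Equiv.swap_apply_of_ne_of_ne hv hw]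
  refine Finset.sum_nbij' (fun g => Equiv.swap v w * g) (fun g => Equiv.swap v w * g) ?_ ?_ ?_ ?_ ?_
  · intro g hg
    have hg : s ∘ g = s := by simpa [stab] using hg
    simp only [stab, Finset.mem_filter, Finset.mem_univ, true_and]
    rw [Equiv.Perm.coe_mul, ← Function.comp_assoc, hsw, hg]
  · intro g hg
    have hg : s ∘ g = s := by simpa [stab] using hg
    simp only [stab, Finset.mem_filter, Finset.mem_univ, true_and]
    rw [Equiv.Perm.coe_mul, ← Function.comp_assoc, hsw, hg]
  · intro g _; simp
  · intro g _; simp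
  · intro g _
    unfold Rg
    rw [Equiv.Perm.coe_mul, Function.comp_assoc]

lemma Et_add {q n : ℕ} (β : ℝ) (φ : ((Fin n → Fin q) → ℝ) →ₗ[ℝ] ℝ) (s t : ℕ) (f) :
    Et β (Et β φ s) t f = Et β φ (s + t) f := by
  unfold Et
  rw [pow_add]; rfl

lemma ev_state {α : Type*} (x : α) : IsState (ev x) := ⟨fun _ hf => hf x, rfl⟩

lemma upper_det {q n : ℕ} [NeZero q] [NeZero n] {β δ : ℝ} (h : Par q β δ) (σ₀ : Fin n → Fin q)
    (t1 m : ℕ) (hb : ∑ s ∈ range t1, Et β (ev σ₀) s (bad δ) ≤ 1) (hπ : t1 * muF q n β (bad δ) ≤ 1)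
    (l : ℝ) (hl : 2 ≤ l) (c : ℝ) (hc : 0 ≤ c) (hm : ∀ v, (m : ℝ) + 2 * c * n ≤ (cls σ₀ v).card)
    (l' : ℝ) (hl' : 0 < l') (M : ℝ) (hM : ∀ t < m, Et β (ev σ₀) (t1 + t) V ≤ M)
    (hM' : muF q n β V ≤ M) (f : (Fin n → Fin q) → ℝ) (h0 : ∀ x, 0 ≤ f x) (h1 : ∀ x, f x ≤ 1) :
    |Et β (ev σ₀) (t1 + m) f - muF q n β f| ≤
      2 * (l * (m * (CX q β * (M + 1 / n ^ 2))) + 1 / l) +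
      (q / 2 * (l' * (1 / (1 + c * m)) + 1 / l')) * (CC q β * (n * (1 - rho q β / n) ^ t1 + 1)) := by
  have g0 := symm_nonneg σ₀ f h0
  have g1 := symm_le σ₀ f h1
  have gi := symm_inv σ₀ f
  rw [← symm_Et, ← symm_mu β σ₀]
  set g := symm σ₀ f
  have a1 := cmp_final β h.hβ (Et_state β (ev_state σ₀) t1) l hl m g g0 g1 M
    (fun t ht => by rw [Et_add]; exact hM t ht)
  have a2 := cmp_final β h.hβ (muF_state q n β) l hl m g g0 g1 M
    (fun t ht => by rw [Epi]; exact hM')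
  have a3 := couple_final h σ₀ t1 hb hπ ((Pop q n 0 ^ m) g) (q / 2 * (l' * (1 / (1 + c * m)) + 1 / l'))
    (by positivity) (fun x y => smooth_final σ₀ g g0 g1 gi l' hl' c hc m hm x y)
  rw [Et_add] at a1
  rw [Epi] at a2
  have := abs_le.1 a1
  have := abs_le.1 a2
  have := abs_le.1 a3
  rw [abs_le]
  constructor <;> linarith

end EM

namespace EM

/-- log-odds -/
noncomputable def HH (y : ℝ) : ℝ := Real.log (1 + y) - Real.log (1 - y)

lemma HH_cmp {y z : ℝ} (hy : 0 ≤ y) (hyz : y ≤ z) (hz : z < 1) : HH y * z ≤ HH z * y := by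
  have h1 := Real.hasSum_log_sub_log_of_abs_lt_one (x := y) (by rw [abs_of_nonneg hy]; linarith)
  have h2 := Real.hasSum_log_sub_log_of_abs_lt_one (x := z) (by rw [abs_of_nonneg (by linarith)]; linarith)
  refine hasSum_le (fun k => ?_) (h1.mul_right z) (h2.mul_right y)
  have : y ^ (2 * k) ≤ z ^ (2 * k) := pow_le_pow_left₀ hy hyz _
  rw [pow_succ, pow_succ]
  have h0 : 0 ≤ (2 : ℝ) * (1 / (2 * k + 1)) * (y * z) := by
    have := hy.trans hyz
    positivity
  calc _ = (2 : ℝ) * (1 / (2 * k + 1)) * (y * z) * y ^ (2 * k) := by ring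
    _ ≤ (2 : ℝ) * (1 / (2 * k + 1)) * (y * z) * z ^ (2 * k) := mul_le_mul_of_nonneg_left this h0
    _ = _ := by ring

lemma HH_ge {y : ℝ} (hy : 0 ≤ y) (hy1 : y < 1) : 2 * y ≤ HH y := by
  have h1 := Real.hasSum_log_sub_log_of_abs_lt_one (x := y) (by rw [abs_of_nonneg hy]; linarith)
  have h2 := hasSum_ite_eq (0:ℕ) (2 * y)
  refine hasSum_le (fun k => ?_) h2 h1
  split_ifs with h
  · subst h; simp
  · positivity

/-- entropy sum -/
noncomputable def DD (y : ℝ) : ℝ := (1 + y) * Real.log (1 + y) + (1 - y) * Real.log (1 - y)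

lemma DD_cont : Continuous DD := by
  unfold DD
  exact (Real.continuous_mul_log.comp (continuous_const.add continuous_id)).add
    (Real.continuous_mul_log.comp (continuous_const.sub continuous_id))

lemma DD_deriv {y : ℝ} (h0 : -1 < y) (h1 : y < 1) : HasDerivAt DD (HH y) y := by
  have a : HasDerivAt (fun y : ℝ => 1 + y) 1 y := (hasDerivAt_id y).const_add 1
  have b : HasDerivAt (fun y : ℝ => 1 - y) (-1) y := (hasDerivAt_id y).const_sub 1
  have a' := (Real.hasDerivAt_mul_log (x := 1 + y) (by linarith)).comp y a
  have b' := (Real.hasDerivAt_mul_log (x := 1 - y) (by linarith)).comp y b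
  have := a'.add b'
  refine this.congr_deriv ?_
  unfold HH
  ring

lemma DD_tangent_nonneg {y0 a : ℝ} (h0 : 0 ≤ y0) (h1 : y0 < 1)
    (hlo : ∀ y, 0 < y → y < y0 → HH y ≤ 2 * a * y) (hhi : ∀ y, y0 < y → y < 1 → 2 * a * y ≤ HH y)
    {y : ℝ} (hy : 0 ≤ y) (hy1 : y ≤ 1) : DD y0 - a * y0 ^ 2 ≤ DD y - a * y ^ 2 := by
  set K : ℝ → ℝ := fun y => DD y - a * y ^ 2 with hK
  have hc : Continuous K := DD_cont.sub (by fun_prop)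
  have hd : ∀ y, -1 < y → y < 1 → HasDerivAt K (HH y - 2 * a * y) y := by
    intro y h0 h1
    have := (DD_deriv h0 h1).sub ((hasDerivAt_pow 2 y).const_mul a)
    refine this.congr_deriv ?_
    simp; ring
  rcases le_total y y0 with hyy | hyy
  · have : AntitoneOn K (Set.Icc 0 y0) := by
      apply antitoneOn_of_deriv_nonpos (convex_Icc _ _) hc.continuousOn
      · rw [interior_Icc]
        intro z hz
        exact (hd z (by linarith [hz.1]) (by linarith [hz.2])).differentiableAt.differentiableWithinAt
      · rw [interior_Icc]
        intro z hz
        rw [(hd z (by linarith [hz.1]) (by linarith [hz.2])).deriv]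
        linarith [hlo z hz.1 hz.2]
    exact this ⟨hy, hyy⟩ ⟨h0, le_rfl⟩ hyy
  · have : MonotoneOn K (Set.Icc y0 1) := by
      apply monotoneOn_of_deriv_nonneg (convex_Icc _ _) hc.continuousOn
      · rw [interior_Icc]
        intro z hz
        exact (hd z (by linarith [hz.1]) (by linarith [hz.2])).differentiableAt.differentiableWithinAt
      · rw [interior_Icc]
        intro z hz
        rw [(hd z (by linarith [hz.1]) (by linarith [hz.2])).deriv]
        linarith [hhi z hz.1 hz.2]
    exact this ⟨le_rfl, h1.le⟩ ⟨hyy, hy1⟩ hyy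

lemma DD_neg (y : ℝ) : DD (-y) = DD y := by
  unfold DD
  rw [← sub_eq_add_neg, sub_neg_eq_add]; ring

lemma DD_tangent {y0 a : ℝ} (h0 : 0 ≤ y0) (h1 : y0 < 1)
    (hlo : ∀ y, 0 < y → y < y0 → HH y ≤ 2 * a * y) (hhi : ∀ y, y0 < y → y < 1 → 2 * a * y ≤ HH y)
    {y : ℝ} (hy : -1 ≤ y) (hy1 : y ≤ 1) : DD y0 - a * y0 ^ 2 ≤ DD y - a * y ^ 2 := by
  rcases le_total 0 y with h | h
  · exact DD_tangent_nonneg h0 h1 hlo hhi h hy1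
  · have := DD_tangent_nonneg h0 h1 hlo hhi (y := -y) (by linarith) (by linarith)
    rw [DD_neg, neg_sq] at this
    exact this

/-- critical constants -/
noncomputable def bq (q : ℕ) : ℝ :=
  if q ≤ 2 then 1 else ((q : ℝ) - 1) * Real.log ((q : ℝ) - 1) / ((q : ℝ) - 2)

lemma ent_eq (x : ℝ) (hx0 : 0 ≤ x) (hx1 : x ≤ 1) : x * Real.log x + (1 - x) * Real.log (1 - x) =
    DD (1 - 2 * x) / 2 - Real.log 2 := by
  unfold DD
  have e1 : 1 + (1 - 2 * x) = 2 * (1 - x) := by ring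
  have e2 : 1 - (1 - 2 * x) = 2 * x := by ring
  rw [e1, e2]
  have a : ∀ z : ℝ, 0 ≤ z → 2 * z * Real.log (2 * z) = 2 * z * Real.log 2 + 2 * z * Real.log z := by
    intro z hz
    rcases eq_or_lt_of_le hz with h | h
    · rw [← h]; simp
    · rw [Real.log_mul (by norm_num) h.ne']; ring
  rw [a x hx0, a (1 - x) (by linarith)]
  ring

lemma binary (m : ℕ) (hm : 1 ≤ m) (x : ℝ) (hx0 : 0 ≤ x) (hx1 : x ≤ 1) :
    bq (m + 1) * (x ^ 2 + (1 - x) ^ 2 / m - 1 / (m + 1)) ≤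
      x * Real.log x + (1 - x) * Real.log (1 - x) + Real.log (m + 1) - (1 - x) * Real.log m := by
  rw [ent_eq x hx0 hx1]
  rcases eq_or_lt_of_le hm with h | h
  · subst h
    have := DD_tangent (y0 := 0) (a := 1) le_rfl one_pos (fun y h h' => by linarith)
      (fun y h h' => by linarith [HH_ge h.le h']) (y := 1 - 2 * x) (by linarith) (by linarith)
    have e : DD 0 = 0 := by simp [DD]
    rw [e] at this
    unfold bq
    norm_num
    nlinarith
  · have hm0 : (2:ℝ) ≤ m := by exact_mod_cast h
    set y0 : ℝ := ((m:ℝ) - 1) / (m + 1) with hy0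
    have hy0p : 0 < y0 := div_pos (by linarith) (by linarith)
    have hy01 : y0 < 1 := by rw [hy0, div_lt_one (by linarith)]; linarith
    have e1 : 1 + y0 = 2 * m / (m + 1) := by rw [hy0]; field_simp; ring
    have e2 : 1 - y0 = 2 / (m + 1) := by rw [hy0]; field_simp; ring
    have l1 : Real.log (1 + y0) = Real.log 2 + Real.log m - Real.log (m + 1) := by
      rw [e1, Real.log_div (by positivity) (by positivity), Real.log_mul (by positivity) (by positivity)]
    have l2 : Real.log (1 - y0) = Real.log 2 - Real.log (m + 1) := by
      rw [e2, Real.log_div (by positivity) (by positivity)]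
    have hH : HH y0 = Real.log m := by unfold HH; rw [l1, l2]; ring
    have := DD_tangent (y0 := y0) (a := HH y0 / (2 * y0)) hy0p.le hy01
      (fun y h h' => by
        have := HH_cmp h.le h'.le hy01
        rw [show 2 * (HH y0 / (2 * y0)) * y = HH y0 * y / y0 by field_simp, le_div_iff₀ hy0p]
        exact this)
      (fun y h h' => by
        have := HH_cmp hy0p.le h.le h'
        rw [show 2 * (HH y0 / (2 * y0)) * y = HH y0 * y / y0 by field_simp, div_le_iff₀ hy0p]
        exact this) (y := 1 - 2 * x) (by linarith) (by linarith)
    have hD : DD y0 = 2 * Real.log 2 + 2 * m / (m + 1) * Real.log m - 2 * Real.log (m + 1) := by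
      unfold DD
      rw [l1, l2, e1, e2]
      field_simp
      ring
    rw [hD, hH] at this
    have hb : bq (m + 1) = m * Real.log m / (m - 1) := by
      unfold bq
      rw [if_neg (by omega)]
      push_cast
      rw [show (m:ℝ) + 1 - 1 = m by ring, show (m:ℝ) + 1 - 2 = m - 1 by ring]
    rw [hb]
    have hm1 : (m:ℝ) - 1 ≠ 0 := by linarith
    have e : m * Real.log m / (m - 1) * (x ^ 2 + (1 - x) ^ 2 / m - 1 / (m + 1)) =
       (2 * m / (m + 1) * Real.log m) / 2 - Real.log m / (2 * y0) * y0 ^ 2 / 2 + 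
        Real.log m / (2 * y0) * (1 - 2 * x) ^ 2 / 2 - (1 - x) * Real.log m := by
      rw [hy0]
      field_simp
      ring
    rw [e]
    linarith

lemma G_anti : AntitoneOn (fun M : ℝ => M * Real.log M / (M ^ 2 - 1)) (Set.Ici 2) := by
  have hd : ∀ M : ℝ, 2 ≤ M → HasDerivAt (fun M : ℝ => M * Real.log M / (M ^ 2 - 1))
     (((Real.log M + 1) * (M ^ 2 - 1) - M * Real.log M * (2 * M)) / (M ^ 2 - 1) ^ 2) M := by
    intro M hM
    have a := Real.hasDerivAt_mul_log (x := M) (by linarith)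
    have b : HasDerivAt (fun M : ℝ => M ^ 2 - 1) (2 * M) M := by
      simpa using (hasDerivAt_pow 2 M).sub_const 1
    exact a.div b (by nlinarith)
  apply antitoneOn_of_deriv_nonpos (convex_Ici _)
  · intro M hM; exact (hd M hM).continuousAt.continuousWithinAt
  · rw [interior_Ici]
    intro M hM
    exact (hd M (le_of_lt hM)).differentiableAt.differentiableWithinAt
  · rw [interior_Ici]
    intro M hM
    have hM : 2 < M := hM
    rw [(hd M hM.le).deriv]
    apply div_nonpos_of_nonpos_of_nonneg _ (sq_nonneg _)
    have h := HH_ge (y := (M - 1) / (M + 1)) (by apply div_nonneg <;> linarith) (by rw [div_lt_one] <;> linarith)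
    have : HH ((M - 1) / (M + 1)) = Real.log M := by
      unfold HH
      rw [show 1 + (M - 1) / (M + 1) = 2 * M / (M + 1) by field_simp; ring,
        show 1 - (M - 1) / (M + 1) = 2 / (M + 1) by field_simp; ring,
        Real.log_div (by positivity) (by positivity), Real.log_div (by positivity) (by positivity),
        Real.log_mul (by positivity) (by positivity)]
      ring
    rw [this] at h
    rw [← mul_div_assoc, div_le_iff₀ (by linarith)] at h
    have h2 : (M ^ 2 - 1) ≤ Real.log M * (M ^ 2 + 1) := by
      have : (M ^ 2 + 1) * (2 * (M - 1)) ≤ (M ^ 2 + 1) * (Real.log M * (M + 1)) :=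
        mul_le_mul_of_nonneg_left h (by positivity)
      have h3 : (M ^ 2 - 1) * (M + 1) ≤ (Real.log M * (M ^ 2 + 1)) * (M + 1) := by nlinarith [mul_nonneg (sub_nonneg.2 hM.le) (sq_nonneg (M - 1))]
      exact le_of_mul_le_mul_right h3 (by linarith)
    nlinarith

lemma bq_div (M : ℕ) (hM : 2 ≤ M) : bq (M + 1) = (M + 1) * ((M:ℝ) * Real.log M / ((M:ℝ) ^ 2 - 1)) := by
  have : (2:ℝ) ≤ M := by exact_mod_cast hM
  unfold bq
  rw [if_neg (by omega)]
  push_cast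
  rw [show (M:ℝ) + 1 - 1 = M by ring, show (M:ℝ) + 1 - 2 = M - 1 by ring,
    show (M:ℝ) ^ 2 - 1 = (M + 1) * (M - 1) by ring]
  have : (M:ℝ) - 1 ≠ 0 := by linarith
  field_simp

lemma bq_mono (m : ℕ) (hm : 2 ≤ m) : bq (m + 1) * m ≤ bq m * (m + 1) := by
  have h2 : (2:ℝ) ≤ m := by exact_mod_cast hm
  rw [bq_div m hm]
  rcases eq_or_lt_of_le hm with h | h
  · subst h
    have : bq 2 = 1 := by simp [bq]
    rw [this]
    have := Real.log_two_lt_d9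
    norm_num
    linarith
  · obtain ⟨M, rfl⟩ : ∃ M, m = M + 1 := ⟨m - 1, by omega⟩
    rw [bq_div M (by omega)]
    have hM : (2:ℝ) ≤ M := by exact_mod_cast (by omega : 2 ≤ M)
    have := G_anti (a := (M:ℝ)) (b := ((M + 1 : ℕ):ℝ)) hM h2 (by push_cast; linarith)
    simp only at this
    push_cast at this ⊢
    have hp : (0:ℝ) ≤ (M + 1 + 1) * (M + 1) := by positivity
    nlinarith [mul_le_mul_of_nonneg_left this hp]

lemma bq_le_two (q : ℕ) (hq : 3 ≤ q) : bq q < q / 2 := by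
  obtain ⟨M, rfl⟩ : ∃ M, q = M + 1 := ⟨q - 1, by omega⟩
  rw [bq_div M (by omega)]
  have hM : (2:ℝ) ≤ M := by exact_mod_cast (by omega : 2 ≤ M)
  have := G_anti (a := (2:ℝ)) (b := (M:ℝ)) (by simp) hM hM
  simp only at this
  have l := Real.log_two_lt_d9
  have : (M:ℝ) * Real.log M / ((M:ℝ) ^ 2 - 1) < 1 / 2 := by
    refine lt_of_le_of_lt this ?_
    norm_num
    linarith
  push_cast
  nlinarith

lemma ent_main {α : Type*} [DecidableEq α] (m : ℕ) : ∀ (I : Finset α), I.card = m + 1 → ∀ s : α → ℝ,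
    (∀ i ∈ I, 0 ≤ s i) → ∑ i ∈ I, s i = 1 →
    bq (m + 1) * (∑ i ∈ I, s i ^ 2 - 1 / (m + 1)) ≤ ∑ i ∈ I, s i * Real.log (s i) + Real.log (m + 1) := by
  induction m with
  | zero =>
    intro I hI s h0 h1
    obtain ⟨a, rfl⟩ := Finset.card_eq_one.1 hI
    simp at h1
    simp [h1]
  | succ m ih =>
    intro I hI s h0 h1
    have hne : I.Nonempty := Finset.card_pos.1 (by omega)
    obtain ⟨a, ha, hax⟩ : ∃ a ∈ I, 1 / ((m:ℝ) + 2) ≤ s a := by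
      by_contra hcon
      push Not at hcon
      have := Finset.sum_lt_sum_of_nonempty hne hcon
      rw [h1, Finset.sum_const, hI, nsmul_eq_mul] at this
      push_cast at this
      have e : ((m:ℝ) + 1 + 1) * (1 / (m + 2)) = 1 := by field_simp; ring
      linarith
    set x := s a with hx
    set J := I.erase a with hJ
    have hJc : J.card = m + 1 := by rw [hJ, Finset.card_erase_of_mem ha, hI]; rfl
    have sumJ : ∀ g : α → ℝ, ∑ i ∈ I, g i = g a + ∑ i ∈ J, g i := fun g => (Finset.add_sum_erase I g ha).symm
    have hsJ : ∑ i ∈ J, s i = 1 - x := by have := sumJ s; linarith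
    have hJ0 : ∀ i ∈ J, 0 ≤ s i := fun i hi => h0 i (Finset.mem_of_mem_erase hi)
    have hx0 : 0 ≤ x := h0 a ha
    have hx1 : x ≤ 1 := by have := Finset.sum_nonneg hJ0; linarith
    have hbin := binary (m + 1) (by omega) x hx0 hx1
    rw [sumJ, sumJ]
    push_cast at hbin ⊢
    rcases eq_or_lt_of_le hx1 with h | h
    · have hz : ∀ i ∈ J, s i = 0 := by
        rw [h, sub_self] at hsJ
        exact (Finset.sum_eq_zero_iff_of_nonneg hJ0).1 hsJ
      rw [Finset.sum_eq_zero (fun i hi => by rw [hz i hi]; simp),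
        Finset.sum_eq_zero (fun i hi => by rw [hz i hi]; simp), ← hx, h]
      rw [h] at hbin
      simp at hbin ⊢
      linarith
    · have h1x : 0 < 1 - x := by linarith
      have hr := ih J hJc (fun i => s i / (1 - x)) (fun i hi => div_nonneg (hJ0 i hi) h1x.le)
        (by rw [← Finset.sum_div, hsJ, div_self h1x.ne'])
      have e1 : ∑ i ∈ J, (s i / (1 - x)) ^ 2 = (∑ i ∈ J, s i ^ 2) / (1 - x) ^ 2 := by
        rw [Finset.sum_div]; exact Finset.sum_congr rfl fun i _ => by rw [div_pow]
      have e2 : ∑ i ∈ J, s i / (1 - x) * Real.log (s i / (1 - x)) =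
          (∑ i ∈ J, s i * Real.log (s i)) / (1 - x) - Real.log (1 - x) := by
        have : ∀ i ∈ J, s i / (1 - x) * Real.log (s i / (1 - x)) =
            s i * Real.log (s i) / (1 - x) - s i * (Real.log (1 - x) / (1 - x)) := by
          intro i hi
          rcases eq_or_lt_of_le (hJ0 i hi) with h | h
          · rw [← h]; simp
          · rw [Real.log_div h.ne' h1x.ne']; ring
        rw [Finset.sum_congr rfl this, Finset.sum_sub_distrib, ← Finset.sum_div, ← Finset.sum_mul, hsJ]
        field_simp
      rw [e1, e2] at hr
      set Q := ∑ i ∈ J, s i ^ 2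
      set E := ∑ i ∈ J, s i * Real.log (s i)
      have hQ : (1 - x) ^ 2 / (m + 1) ≤ Q := by
        have := sq_sum_le_card_mul_sum_sq (s := J) (f := s)
        rw [hsJ, hJc] at this
        push_cast at this
        rw [div_le_iff₀ (by positivity)]
        linarith
      have hb : bq (m + 1 + 1) * (1 - x) ≤ bq (m + 1) ∨ m = 0 := by
        rcases Nat.eq_zero_or_pos m with h | h
        · right; exact h
        · left
          have hbm := bq_mono (m + 1) (by omega)
          push_cast at hbm
          have hbpos : 0 ≤ bq (m + 1 + 1) := by
            rw [bq_div (m + 1) (by omega)]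
            push_cast
            have : (1:ℝ) ≤ m := by exact_mod_cast h
            have : 0 ≤ Real.log ((m:ℝ) + 1) := Real.log_nonneg (by linarith)
            apply mul_nonneg (by positivity)
            apply div_nonneg (by positivity)
            nlinarith
          have : 1 - x ≤ ((m:ℝ) + 1) / (m + 2) := by
            have : ((m:ℝ) + 1) / (m + 2) = 1 - 1 / (m + 2) := by field_simp; ring
            linarith
          calc _ ≤ bq (m + 1 + 1) * (((m:ℝ) + 1) / (m + 2)) := mul_le_mul_of_nonneg_left this hbpos
            _ ≤ _ := by
              rw [← mul_div_assoc, div_le_iff₀ (by positivity)]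
              linarith
      have hr' : bq (m + 1) * ((Q - (1 - x) ^ 2 / (m + 1)) / (1 - x)) ≤
          E - (1 - x) * Real.log (1 - x) + (1 - x) * Real.log (m + 1) := by
        have := mul_le_mul_of_nonneg_left hr h1x.le
        have ea : (1 - x) * (bq (m + 1) * (Q / (1 - x) ^ 2 - 1 / (m + 1))) =
            bq (m + 1) * ((Q - (1 - x) ^ 2 / (m + 1)) / (1 - x)) := by field_simp
        have eb : (1 - x) * (E / (1 - x) - Real.log (1 - x) + Real.log (m + 1)) =
            E - (1 - x) * Real.log (1 - x) + (1 - x) * Real.log (m + 1) := by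
          have : (1 - x) * (E / (1 - x)) = E := by field_simp
          linear_combination this
        rw [ea, eb] at this
        exact this
      have key : bq (m + 1 + 1) * (Q - (1 - x) ^ 2 / (m + 1)) ≤
          bq (m + 1) * ((Q - (1 - x) ^ 2 / (m + 1)) / (1 - x)) := by
        rcases hb with hb | hb
        · have := mul_le_mul_of_nonneg_right hb (div_nonneg (sub_nonneg.2 hQ) h1x.le)
          calc _ = _ := by field_simp
            _ ≤ _ := this
        · subst hb
          obtain ⟨b, hb⟩ := Finset.card_eq_one.1 hJc
          have : Q = (1 - x) ^ 2 := by
            rw [← hsJ]; simp [Q, hb]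
          rw [this]; simp
      have : (m:ℝ) + 1 + 1 = m + 2 := by ring
      linarith

lemma ent_fin (q : ℕ) (hq : 1 ≤ q) (s : Fin q → ℝ) (h0 : ∀ i, 0 ≤ s i) (h1 : ∑ i, s i = 1) :
    bq q * (∑ i, s i ^ 2 - 1 / q) ≤ ∑ i, s i * Real.log (s i) + Real.log q := by
  obtain ⟨m, rfl⟩ : ∃ M, q = M + 1 := ⟨q - 1, by omega⟩
  have := ent_main m univ (by simp) s (fun i _ => h0 i) h1
  push_cast
  exact this

end EM

namespace EM

/-- empirical proportions -/
noncomputable def sp {q n : ℕ} (σ : Fin n → Fin q) (k : Fin q) : ℝ := cnt σ k / n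

lemma sp_nonneg {q n : ℕ} (σ : Fin n → Fin q) (k) : 0 ≤ sp σ k :=
  div_nonneg (cnt_nonneg σ k) (by positivity)

lemma sp_sum {q n : ℕ} [NeZero n] (σ : Fin n → Fin q) : ∑ k, sp σ k = 1 := by
  unfold sp
  rw [← Finset.sum_div, cnt_sum, div_self (ncast_pos n).ne']

lemma sp_sq {q n : ℕ} [NeZero q] [NeZero n] (σ : Fin n → Fin q) : ∑ k, sp σ k ^ 2 = V σ + 1 / q := by
  have hq := ncast_pos q
  have e : ∀ k, sp σ k ^ 2 = X σ k ^ 2 + (2 / q) * sp σ k - 1 / q ^ 2 := by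
    intro k; unfold X sp; ring
  unfold V
  simp_rw [e]
  rw [Finset.sum_sub_distrib, Finset.sum_add_distrib, ← Finset.mul_sum, sp_sum]
  simp
  field_simp
  ring

lemma weight_eq {q n : ℕ} [NeZero q] [NeZero n] (β : ℝ) (σ : Fin n → Fin q) :
    pottsWeight q n β σ = Real.exp (n * β / q) * Real.exp (n * β * V σ) := by
  have hn := ncast_pos n
  unfold pottsWeight
  rw [energy_eq, ← Real.exp_add]
  congr 1
  have : ∑ k, cnt σ k ^ 2 = n ^ 2 * ∑ k, sp σ k ^ 2 := by
    rw [Finset.mul_sum]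
    refine Finset.sum_congr rfl fun k _ => ?_
    unfold sp; field_simp
  rw [this, sp_sq]
  field_simp
  ring

lemma cnt_pos_self {q n : ℕ} (σ : Fin n → Fin q) (v) : 1 ≤ cnt σ (σ v) := by
  unfold cnt
  have := Finset.single_le_sum (f := fun w => if σ w = σ v then (1:ℝ) else 0)
    (fun i _ => by split_ifs <;> norm_num) (Finset.mem_univ v)
  simpa using this

lemma prod_sp {q n : ℕ} [NeZero q] [NeZero n] (σ : Fin n → Fin q) :
    ∏ v, sp σ (σ v) = Real.exp (n * ∑ k, sp σ k * Real.log (sp σ k)) := by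
  have hn := ncast_pos n
  have hp : ∀ v, 0 < sp σ (σ v) := fun v => div_pos (by linarith [cnt_pos_self σ v]) hn
  have : ∀ v, sp σ (σ v) = Real.exp (Real.log (sp σ (σ v))) := fun v => (Real.exp_log (hp v)).symm
  rw [Finset.prod_congr rfl (fun v _ => this v), ← Real.exp_sum]
  congr 1
  have : ∀ v, Real.log (sp σ (σ v)) = ∑ k, (if σ v = k then (1:ℝ) else 0) * Real.log (sp σ k) := by
    intro v; simp
  simp_rw [this]
  rw [Finset.sum_comm, Finset.mul_sum]
  refine Finset.sum_congr rfl fun k _ => ?_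
  rw [← Finset.sum_mul, ← mul_assoc]
  congr 1
  show cnt σ k = _
  unfold sp
  field_simp

lemma prod_sum_le {q n : ℕ} [NeZero q] [NeZero n] :
    ∑ σ : Fin n → Fin q, ∏ v, sp σ (σ v) ≤ ((n:ℝ) + 1) ^ q := by
  have hn := ncast_pos n
  set S : Finset (Fin q → Fin (n + 1)) := univ.filter (fun N => ∑ k, (N k : ℕ) = n) with hS
  have h1 : ∀ σ : Fin n → Fin q, ∏ v, sp σ (σ v) ≤ ∑ N ∈ S, ∏ v, ((N (σ v) : ℕ) : ℝ) / n := by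
    intro σ
    have hlt : ∀ k, (univ.filter (fun v => σ v = k)).card < n + 1 := by
      intro k
      have := Finset.card_le_univ (univ.filter (fun v => σ v = k))
      simp at this
      omega
    set N0 : Fin q → Fin (n + 1) := fun k => ⟨(univ.filter (fun v => σ v = k)).card, hlt k⟩ with hN0
    have hc : ∀ k, ((N0 k : ℕ) : ℝ) = cnt σ k := by
      intro k
      simp [hN0, cnt]
    have hmem : N0 ∈ S := by
      simp only [hS, Finset.mem_filter, Finset.mem_univ, true_and]
      have : ∑ k, ((N0 k : ℕ) : ℝ) = n := by simp_rw [hc]; exact cnt_sum σ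
      exact_mod_cast this
    have := Finset.single_le_sum (f := fun N : Fin q → Fin (n + 1) => ∏ v, ((N (σ v) : ℕ) : ℝ) / n)
      (fun N _ => Finset.prod_nonneg fun v _ => by positivity) hmem
    refine le_trans (le_of_eq ?_) this
    refine Finset.prod_congr rfl fun v _ => ?_
    rw [hc]; rfl
  calc _ ≤ ∑ σ : Fin n → Fin q, ∑ N ∈ S, ∏ v, ((N (σ v) : ℕ) : ℝ) / n := Finset.sum_le_sum fun σ _ => h1 σ
    _ = ∑ N ∈ S, ∑ σ : Fin n → Fin q, ∏ v, ((N (σ v) : ℕ) : ℝ) / n := Finset.sum_comm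
    _ = ∑ N ∈ S, 1 := by
      refine Finset.sum_congr rfl fun N hN => ?_
      have hN' : ∑ k, (N k : ℕ) = n := by simpa [hS] using hN
      have := Finset.prod_univ_sum (fun _ : Fin n => (univ : Finset (Fin q))) (fun _ k => ((N k : ℕ) : ℝ) / n)
      rw [Fintype.piFinset_univ] at this
      rw [← this]
      have : ∑ k, ((N k : ℕ) : ℝ) / n = 1 := by
        rw [← Finset.sum_div, div_eq_one_iff_eq hn.ne']
        exact_mod_cast hN'
      simp [this]
    _ = (S.card : ℝ) := by simp
    _ ≤ (((n + 1) ^ q : ℕ) : ℝ) := by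
      have := Finset.card_le_univ S
      rw [Fintype.card_pi] at this
      simp at this
      exact_mod_cast this
    _ = _ := by push_cast; rfl

lemma exp_bq {q n : ℕ} [NeZero q] [NeZero n] (σ : Fin n → Fin q) :
    Real.exp (n * bq q * V σ) ≤ q ^ n * ∏ v, sp σ (σ v) := by
  have hn := ncast_pos n
  have hq := ncast_pos q
  have := ent_fin q (Nat.pos_of_ne_zero (NeZero.ne q)) (sp σ) (sp_nonneg σ) (sp_sum σ)
  rw [sp_sq, add_sub_cancel_right] at this
  rw [prod_sp, ← Real.exp_log (pow_pos hq n), Real.log_pow, ← Real.exp_add]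
  apply Real.exp_le_exp.2
  nlinarith [mul_le_mul_of_nonneg_left this hn.le]

lemma Z_ge {q n : ℕ} [NeZero q] [NeZero n] (β : ℝ) (hβ : 0 ≤ β) :
    (q:ℝ) ^ n * Real.exp (n * β / q) ≤ ∑ τ : Fin n → Fin q, pottsWeight q n β τ := by
  have : ∑ τ : Fin n → Fin q, Real.exp (n * β / q) = (q:ℝ) ^ n * Real.exp (n * β / q) := by simp
  rw [← this]
  refine Finset.sum_le_sum fun τ _ => ?_
  rw [weight_eq]
  have : 1 ≤ Real.exp (n * β * V τ) := Real.one_le_exp (by have := V_nonneg τ; positivity)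
  nlinarith [Real.exp_pos (n * β / q)]

lemma Z_le {q n : ℕ} [NeZero q] [NeZero n] (β : ℝ) (hb : β ≤ bq q) :
    ∑ τ : Fin n → Fin q, pottsWeight q n β τ ≤ (q:ℝ) ^ n * Real.exp (n * β / q) * ((n:ℝ) + 1) ^ q := by
  have hn := ncast_pos n
  calc _ ≤ ∑ τ : Fin n → Fin q, Real.exp (n * β / q) * (q ^ n * ∏ v, sp τ (τ v)) := by
        refine Finset.sum_le_sum fun τ _ => ?_
        rw [weight_eq]
        refine mul_le_mul_of_nonneg_left (le_trans ?_ (exp_bq τ)) (Real.exp_pos _).le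
        apply Real.exp_le_exp.2
        have := V_nonneg τ
        gcongr
    _ = (q:ℝ) ^ n * Real.exp (n * β / q) * ∑ τ : Fin n → Fin q, ∏ v, sp τ (τ v) := by
        rw [Finset.mul_sum]; exact Finset.sum_congr rfl fun _ _ => by ring
    _ ≤ _ := mul_le_mul_of_nonneg_left prod_sum_le (by positivity)

lemma mu_bad_le {q n : ℕ} [NeZero q] [NeZero n] (β δ : ℝ) (hβ : 0 ≤ β) (hb : β ≤ bq q) :
    muF q n β (bad δ) ≤ ((n:ℝ) + 1) ^ q * Real.exp (-(n * ((bq q - β) * δ ^ 2))) := by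
  have hn := ncast_pos n
  have hq := ncast_pos q
  have hZ := Z_pos q n β
  have e : muF q n β (bad δ) = (∑ σ, pottsWeight q n β σ * bad δ σ) / ∑ τ, pottsWeight q n β τ := by
    rw [muF_apply, Finset.sum_div]
    refine Finset.sum_congr rfl fun σ _ => ?_
    unfold pottsMeasure; ring
  rw [e, div_le_iff₀ hZ]
  set r := Real.exp (-(n * ((bq q - β) * δ ^ 2))) with hr
  have hr0 : 0 < r := Real.exp_pos _
  calc _ ≤ ∑ τ : Fin n → Fin q, Real.exp (n * β / q) * r * (q ^ n * ∏ v, sp τ (τ v)) := by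
        refine Finset.sum_le_sum fun τ _ => ?_
        unfold bad
        have hp : 0 ≤ ∏ v, sp τ (τ v) := Finset.prod_nonneg fun v _ => sp_nonneg _ _
        split_ifs with h
        · rw [mul_zero]; positivity
        · rw [mul_one, weight_eq, mul_assoc (Real.exp (n * β / q)) r]
          refine mul_le_mul_of_nonneg_left (le_trans ?_ (mul_le_mul_of_nonneg_left (exp_bq τ) hr0.le))
            (Real.exp_pos _).le
          rw [hr, ← Real.exp_add]
          apply Real.exp_le_exp.2
          push Not at h
          have : 0 ≤ n * (bq q - β) * (V τ - δ ^ 2) :=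
            mul_nonneg (mul_nonneg hn.le (by linarith)) (by linarith)
          nlinarith
    _ = ((q:ℝ) ^ n * Real.exp (n * β / q)) * (r * ∑ τ : Fin n → Fin q, ∏ v, sp τ (τ v)) := by
        rw [Finset.mul_sum, Finset.mul_sum]; exact Finset.sum_congr rfl fun _ _ => by ring
    _ ≤ (∑ τ, pottsWeight q n β τ) * (r * ((n:ℝ) + 1) ^ q) := by
        have h1 : 0 ≤ ∑ τ : Fin n → Fin q, ∏ v, sp τ (τ v) :=
          Finset.sum_nonneg fun τ _ => Finset.prod_nonneg fun v _ => sp_nonneg _ _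
        exact mul_le_mul (Z_ge β hβ) (mul_le_mul_of_nonneg_left prod_sum_le hr0.le) (by positivity) hZ.le
    _ = _ := by ring

lemma mu_ge {q n : ℕ} [NeZero q] [NeZero n] (β : ℝ) (hβ : 0 ≤ β) (hb : β ≤ bq q) (σ : Fin n → Fin q) :
    1 / ((q:ℝ) ^ n * ((n:ℝ) + 1) ^ q) ≤ pottsMeasure q n β σ := by
  have hq := ncast_pos q
  have hn := ncast_pos n
  unfold pottsMeasure
  rw [le_div_iff₀ (Z_pos q n β), div_mul_eq_mul_div, div_le_iff₀ (by positivity), one_mul]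
  refine (Z_le β hb).trans ?_
  rw [weight_eq]
  have : 1 ≤ Real.exp (n * β * V σ) := Real.one_le_exp (by have := V_nonneg σ; positivity)
  calc _ = Real.exp (n * β / q) * 1 * (q ^ n * ((n:ℝ) + 1) ^ q) := by ring
    _ ≤ _ := by gcongr

end EM

namespace EM

/-- good initial configurations -/
def AA (q : ℕ) (β δ : ℝ) (n : ℕ) : Set (Fin n → Fin q) :=
  {σ | ∑ t ∈ range (n ^ 2), Et β (ev σ) t (bad δ) ≤ δ}

/-- constant for polynomial versus exponential -/
noncomputable def Dk (k : ℕ) (a : ℝ) : ℝ := k.factorial / a ^ k * Real.exp a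

lemma poly_exp (k : ℕ) (a : ℝ) (ha : 0 < a) (n : ℕ) : ((n:ℝ) + 1) ^ k ≤ Dk k a * Real.exp (n * a) := by
  have h := Real.pow_div_factorial_le_exp (x := ((n:ℝ) + 1) * a) (by positivity) k
  have hf : (0:ℝ) < k.factorial := by exact_mod_cast Nat.factorial_pos k
  rw [div_le_iff₀ hf, mul_pow] at h
  unfold Dk
  have e : Real.exp (((n:ℝ) + 1) * a) = Real.exp a * Real.exp (n * a) := by
    rw [← Real.exp_add]; congr 1; ring
  rw [e] at h
  have : k.factorial / a ^ k * Real.exp a * Real.exp (n * a) =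
      (Real.exp a * Real.exp (n * a) * k.factorial) / a ^ k := by ring
  rw [this, le_div_iff₀ (by positivity)]
  exact h

lemma AA_compl {q n : ℕ} [NeZero q] [NeZero n] (β δ : ℝ) (hδ : 0 < δ) :
    ∑ σ : Fin n → Fin q, ((AA q β δ n)ᶜ).indicator (pottsMeasure q n β) σ ≤
      (n:ℝ) ^ 2 * muF q n β (bad δ) / δ := by
  have e : (n:ℝ) ^ 2 * muF q n β (bad δ) =
      ∑ σ, pottsMeasure q n β σ * ∑ t ∈ range (n ^ 2), Et β (ev σ) t (bad δ) := by
    simp_rw [Finset.mul_sum]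
    rw [Finset.sum_comm]
    have : ∀ t ∈ range (n ^ 2), ∑ σ, pottsMeasure q n β σ * Et β (ev σ) t (bad δ) = muF q n β (bad δ) := by
      intro t _
      rw [← muF_stat_pow β t (bad δ), muF_apply]; rfl
    rw [Finset.sum_congr rfl this]
    simp
  rw [e, Finset.sum_div]
  refine Finset.sum_le_sum fun σ _ => ?_
  have hp := mu_pos q n β σ
  have hnn : 0 ≤ ∑ t ∈ range (n ^ 2), Et β (ev σ) t (bad δ) :=
    Finset.sum_nonneg fun t _ => Et_bad_nonneg β δ (ev_state σ) t
  by_cases h : σ ∈ AA q β δ n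
  · rw [Set.indicator_of_notMem (by simpa using h)]
    positivity
  · rw [Set.indicator_of_mem (by simpa using h), le_div_iff₀ hδ]
    have h' : δ < ∑ t ∈ range (n ^ 2), Et β (ev σ) t (bad δ) := by
      simpa [AA] using h
    exact mul_le_mul_of_nonneg_left h'.le hp.le

lemma AA_measure (q : ℕ) [NeZero q] (β δ : ℝ) (hδ : 0 < δ) (hβ : 0 ≤ β) (hb : β < bq q) :
    ∃ C₁ C₂ : ℝ, 0 < C₁ ∧ 0 < C₂ ∧ (∀ n : ℕ, ∑ σ : Fin n → Fin q,
      ((AA q β δ n)ᶜ).indicator (pottsMeasure q n β) σ ≤ C₁ * Real.exp (-C₂ * n)) ∧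
      ∀ n : ℕ, 1 ≤ n → (n:ℝ) ^ 2 * muF q n β (bad δ) ≤ C₁ * Real.exp (-C₂ * n) := by
  set a := (bq q - β) * δ ^ 2 / 2 with ha
  have ha0 : 0 < a := by
    have : 0 < bq q - β := by linarith
    positivity
  have hD : 0 < Dk (q + 2) a := by
    unfold Dk
    have hf : (0:ℝ) < (q + 2).factorial := by exact_mod_cast Nat.factorial_pos _
    positivity
  have key : ∀ n : ℕ, 1 ≤ n → (n:ℝ) ^ 2 * muF q n β (bad δ) ≤ Dk (q + 2) a * Real.exp (-a * n) := by
    intro n hn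
    have : NeZero n := ⟨by omega⟩
    calc _ ≤ (n:ℝ) ^ 2 * (((n:ℝ) + 1) ^ q * Real.exp (-(n * ((bq q - β) * δ ^ 2)))) := by
          gcongr; exact mu_bad_le β δ hβ hb.le
      _ ≤ ((n:ℝ) + 1) ^ 2 * (((n:ℝ) + 1) ^ q * Real.exp (-(n * ((bq q - β) * δ ^ 2)))) := by
          gcongr; linarith
      _ = ((n:ℝ) + 1) ^ (q + 2) * Real.exp (-(n * ((bq q - β) * δ ^ 2))) := by ring
      _ ≤ (Dk (q + 2) a * Real.exp (n * a)) * Real.exp (-(n * ((bq q - β) * δ ^ 2))) := by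
          gcongr; exact poly_exp _ _ ha0 n
      _ = _ := by
          rw [mul_assoc, ← Real.exp_add]; congr 2; rw [ha]; ring
  refine ⟨Dk (q + 2) a / δ + Dk (q + 2) a, a, by positivity, ha0, fun n => ?_, fun n hn => ?_⟩
  · rcases Nat.eq_zero_or_pos n with h | h
    · subst h
      rw [Finset.sum_eq_zero]
      · positivity
      · intro σ _
        rw [Set.indicator_of_notMem]
        simp [AA, hδ.le]
    · have : NeZero n := ⟨by omega⟩
      refine (AA_compl β δ hδ).trans ?_
      have := div_le_div_of_nonneg_right (key n h) hδ.le
      have h2 : 0 < Dk (q + 2) a * Real.exp (-a * n) := by positivity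
      calc _ ≤ _ := this
        _ = Dk (q + 2) a / δ * Real.exp (-a * n) := by ring
        _ ≤ _ := by linarith
  · have h2 : 0 < Dk (q + 2) a / δ * Real.exp (-a * n) := by positivity
    have := key n hn
    linarith

lemma shift_exists {q n : ℕ} [NeZero q] [NeZero n] (S : Finset (Fin n)) (τ : Fin n → Fin q) :
    ∃ τ' : Fin n → Fin q, (∀ v ∉ S, τ' v = τ v) ∧ ((S.card / n : ℝ) * (1 - 1 / q)) ^ 2 ≤ V τ' := by
  have hn := ncast_pos n
  have hq := ncast_pos q
  have hq1 := ncast_one_le q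
  obtain ⟨c, hc⟩ : ∃ c : Fin q, ((n:ℝ) - S.card) / q ≤ ∑ v ∈ Sᶜ, if τ v = c then (1:ℝ) else 0 := by
    by_contra hcon
    push Not at hcon
    have h := Finset.sum_lt_sum_of_nonempty (s := (univ : Finset (Fin q))) ⟨0, Finset.mem_univ _⟩ (fun i _ => hcon i)
    rw [Finset.sum_comm] at h
    have hcard : S.card ≤ n := by simpa using Finset.card_le_univ S
    simp [Finset.card_compl, Nat.cast_sub hcard] at h
    have e : (q:ℝ) * (((n:ℝ) - S.card) / q) = n - S.card := by field_simp
    rw [e] at h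
    exact lt_irrefl _ h
  refine ⟨fun v => if v ∈ S then c else τ v, fun v hv => by simp [hv], ?_⟩
  refine le_trans ?_ (X_sq_le _ c)
  apply pow_le_pow_left₀
  · apply mul_nonneg (by positivity)
    have : 1 / (q:ℝ) ≤ 1 := by rw [div_le_one hq]; exact hq1
    linarith
  · unfold X cnt
    rw [← Finset.sum_add_sum_compl S]
    have e1 : ∑ v ∈ S, (if (if v ∈ S then c else τ v) = c then (1:ℝ) else 0) = S.card := by
      rw [Finset.sum_congr rfl (fun v hv => by rw [if_pos hv, if_pos rfl])]; simp
    have e2 : ∑ v ∈ Sᶜ, (if (if v ∈ S then c else τ v) = c then (1:ℝ) else 0) =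
        ∑ v ∈ Sᶜ, (if τ v = c then (1:ℝ) else 0) :=
      Finset.sum_congr rfl (fun v hv => by simp only [Finset.mem_compl] at hv; simp only [hv, if_false])
    rw [e1, e2]
    have : (S.card / n : ℝ) * (1 - 1 / q) = (S.card + ((n:ℝ) - S.card) / q) / n - 1 / q := by
      field_simp; ring
    rw [this]
    gcongr

lemma fiber_card {q n : ℕ} (S : Finset (Fin n)) (r : Fin n → Fin q) :
    (univ.filter (fun τ : Fin n → Fin q => ∀ v ∉ S, r v = τ v)).card ≤ q ^ S.card := by
  have : q ^ S.card = (univ : Finset (S → Fin q)).card := by simp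
  rw [this]
  apply Finset.card_le_card_of_injOn (fun (τ : Fin n → Fin q) (v : S) => τ v.1) (fun _ _ => by simp)
  intro a ha b hb hab
  simp at ha hb
  ext v
  by_cases hv : v ∈ S
  · have := congrFun hab ⟨v, hv⟩
    simp only at this
    rw [this]
  · rw [← ha v hv, ← hb v hv]

lemma shift_card {q n : ℕ} [NeZero q] [NeZero n] (S : Finset (Fin n)) :
    q ^ n ≤ q ^ S.card * (univ.filter (fun τ : Fin n → Fin q =>
      ((S.card / n : ℝ) * (1 - 1 / q)) ^ 2 ≤ V τ)).card := by
  choose g hg1 hg2 using (shift_exists (q := q) S)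
  have h := Finset.card_le_mul_card_image (f := g) univ (q ^ S.card) (fun r _ => by
    refine le_trans (Finset.card_le_card ?_) (fiber_card S r)
    intro τ hτ
    simp at hτ ⊢
    intro v hv
    rw [← hτ, hg1 τ v hv])
  simp only [Finset.card_univ, Fintype.card_fun, Fintype.card_fin] at h
  refine h.trans (Nat.mul_le_mul_left _ (Finset.card_le_card ?_))
  intro r hr
  simp at hr ⊢
  obtain ⟨τ, rfl⟩ := hr
  have := hg2 τ
  simpa using this

lemma displaced (q : ℕ) [NeZero q] (hq2 : 2 ≤ q) (β δ : ℝ) (hβ : 0 ≤ β) (hb : β < bq q)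
    (C₁ C₂ : ℝ) (hC₁ : 0 < C₁) (hC₂ : 0 < C₂) (h : ∀ n : ℕ, ∑ σ : Fin n → Fin q,
      ((AA q β δ n)ᶜ).indicator (pottsMeasure q n β) σ ≤ C₁ * Real.exp (-C₂ * n)) :
    ∃ v0 : ℝ, 0 < v0 ∧ ∀ᶠ n : ℕ in atTop, ∃ σ ∈ AA q β δ n, v0 ≤ V σ := by
  have hq2' : (2:ℝ) ≤ q := by exact_mod_cast hq2
  have hlq : 0 < Real.log q := Real.log_pos (by linarith)
  set κ := min (1 / 2) (C₂ / (4 * Real.log q)) with hκ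
  have hκ0 : 0 < κ := lt_min (by norm_num) (by positivity)
  have hκ1 : κ ≤ 1 / 2 := min_le_left _ _
  have hκ2 : κ * Real.log q ≤ C₂ / 4 := by
    have : κ ≤ C₂ / (4 * Real.log q) := min_le_right _ _
    rw [le_div_iff₀ (by positivity)] at this
    linarith
  have hiq : 1 / (q:ℝ) ≤ 1 / 2 := one_div_le_one_div_of_le (by norm_num) hq2'
  refine ⟨(κ / 2 * (1 - 1 / q)) ^ 2, by
    have : 0 < 1 - 1 / (q:ℝ) := by linarith
    positivity, ?_⟩
  set D := Dk q (C₂ / 4) with hD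
  have ev1 : ∀ᶠ n : ℕ in atTop, C₁ * D < Real.exp (C₂ / 2 * n) := by
    have : Tendsto (fun n : ℕ => Real.exp (C₂ / 2 * n)) atTop atTop :=
      Real.tendsto_exp_atTop.comp (tendsto_natCast_atTop_atTop.const_mul_atTop (by positivity))
    exact this.eventually_gt_atTop _
  have ev2 : ∀ᶠ n : ℕ in atTop, 2 / κ ≤ (n:ℝ) := tendsto_natCast_atTop_atTop.eventually_ge_atTop _
  filter_upwards [ev1, ev2, eventually_ge_atTop 1] with n h1 h2 hn1
  have : NeZero n := ⟨by omega⟩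
  have hn := ncast_pos n
  by_contra hcon
  push Not at hcon
  set m := ⌊κ * n⌋₊ with hm
  have hm1 : (m:ℝ) ≤ κ * n := Nat.floor_le (by positivity)
  have hm2 : κ * n - 1 < m := Nat.sub_one_lt_floor _
  have hmn : m ≤ n := by
    have : (m:ℝ) ≤ n := by nlinarith
    exact_mod_cast this
  obtain ⟨S, -, hS⟩ := Finset.exists_subset_card_eq (s := (univ : Finset (Fin n))) (n := m) (by simpa using hmn)
  have hcard := shift_card (q := q) S
  set F := univ.filter (fun τ : Fin n → Fin q => ((S.card / n : ℝ) * (1 - 1 / q)) ^ 2 ≤ V τ) with hF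
  have hsub : ∀ τ ∈ F, τ ∉ AA q β δ n := by
    intro τ hτ hA
    have h3 := hcon τ hA
    have h4 : ((S.card / n : ℝ) * (1 - 1 / q)) ^ 2 ≤ V τ := (Finset.mem_filter.1 hτ).2
    have h5 : κ / 2 ≤ (S.card / n : ℝ) := by
      rw [hS, le_div_iff₀ hn]
      rw [div_le_iff₀ hκ0] at h2
      nlinarith
    have : (κ / 2 * (1 - 1 / (q:ℝ))) ^ 2 ≤ ((S.card / n : ℝ) * (1 - 1 / q)) ^ 2 := by
      have : 0 ≤ 1 - 1 / (q:ℝ) := by linarith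
      gcongr
    linarith
  have hlow : (F.card : ℝ) * (1 / ((q:ℝ) ^ n * ((n:ℝ) + 1) ^ q)) ≤ C₁ * Real.exp (-C₂ * n) := by
    refine le_trans ?_ (h n)
    calc _ = ∑ τ ∈ F, (1 / ((q:ℝ) ^ n * ((n:ℝ) + 1) ^ q)) := by rw [Finset.sum_const, nsmul_eq_mul]
      _ ≤ ∑ τ ∈ F, ((AA q β δ n)ᶜ).indicator (pottsMeasure q n β) τ := by
        refine Finset.sum_le_sum fun τ hτ => ?_
        rw [Set.indicator_of_mem (by simpa using hsub τ hτ)]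
        exact mu_ge β hβ hb.le τ
      _ ≤ _ := Finset.sum_le_sum_of_subset_of_nonneg (Finset.subset_univ _) (fun τ _ _ =>
        Set.indicator_nonneg (fun _ _ => (mu_pos q n β _).le) _)
  have hcard' : (q:ℝ) ^ n ≤ q ^ m * F.card := by rw [hS] at hcard; exact_mod_cast hcard
  have hqm : (q:ℝ) ^ m ≤ Real.exp (C₂ / 4 * n) := by
    rw [← Real.exp_log (show (0:ℝ) < q ^ m by positivity), Real.log_pow]
    apply Real.exp_le_exp.2
    calc (m:ℝ) * Real.log q ≤ κ * n * Real.log q := by gcongr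
      _ = κ * Real.log q * n := by ring
      _ ≤ _ := by gcongr
  have hpe := poly_exp q (C₂ / 4) (by positivity) n
  rw [mul_one_div, div_le_iff₀ (by positivity)] at hlow
  have hD0 : 0 < D := by
    have : (0:ℝ) < ((n:ℝ) + 1) ^ q := by positivity
    have := lt_of_lt_of_le this hpe
    exact pos_of_mul_pos_left this (Real.exp_pos _).le
  have hfin : (q:ℝ) ^ n * 1 ≤ (q:ℝ) ^ n * (C₁ * D * Real.exp (-(C₂ / 2 * n))) := by
    calc (q:ℝ) ^ n * 1 ≤ q ^ m * F.card := by linarith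
      _ ≤ Real.exp (C₂ / 4 * n) * (C₁ * Real.exp (-C₂ * n) * ((q:ℝ) ^ n * (D * Real.exp (n * (C₂ / 4))))) := by
        gcongr
        refine hlow.trans ?_
        gcongr
      _ = (q:ℝ) ^ n * (C₁ * D * (Real.exp (C₂ / 4 * n) * Real.exp (-C₂ * n) * Real.exp (n * (C₂ / 4)))) := by ring
      _ = _ := by
        rw [← Real.exp_add, ← Real.exp_add]; congr 4; ring
  have h7 := le_of_mul_le_mul_left hfin (by positivity)
  rw [Real.exp_neg, ← div_eq_mul_inv, le_div_iff₀ (Real.exp_pos _)] at h7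
  linarith

end EM

namespace EM

lemma alpha_rho {q : ℕ} {β : ℝ} (hρ : 0 < rho q β) : alpha1 β q = 1 / (2 * rho q β) := rfl

lemma decay_up {q n : ℕ} [NeZero n] {β δ : ℝ} (h : Par q β δ) (γ : ℝ) (t : ℕ)
    (ht : alpha1 β q * n * Real.log n + γ * n ≤ t) :
    (1 - rho q β / n) ^ t ≤ Real.exp (-(rho q β * γ)) / √n := by
  have hn := ncast_pos n
  have hρ := h.hρ
  have hr := rho_div (n := n) h
  have h1 : (1 - rho q β / n) ^ t ≤ Real.exp (-(rho q β / n)) ^ t :=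
    pow_le_pow_left₀ (by linarith) (Real.one_sub_le_exp_neg _) t
  refine h1.trans ?_
  rw [← Real.exp_nat_mul, Real.sqrt_eq_rpow, Real.rpow_def_of_pos hn, ← Real.exp_sub]
  apply Real.exp_le_exp.2
  rw [alpha_rho hρ] at ht
  have := mul_le_mul_of_nonneg_left ht (show 0 ≤ rho q β / n by positivity)
  have e : rho q β / n * (1 / (2 * rho q β) * n * Real.log n + γ * n) = Real.log n * (1 / 2) + rho q β * γ := by
    field_simp
  rw [e] at this
  linarith

lemma AA_good {q n : ℕ} [NeZero q] [NeZero n] {β δ : ℝ} (h : Par q β δ) {σ : Fin n → Fin q}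
    (hσ : σ ∈ AA q β δ n) : V σ ≤ δ ^ 2 := by
  by_contra hcon
  have hn : 0 < n ^ 2 := by have := NeZero.pos n; positivity
  have h1 : ∑ t ∈ range (n ^ 2), Et β (ev σ) t (bad δ) ≤ δ := hσ
  have h2 := Finset.single_le_sum (f := fun t => Et β (ev σ) t (bad δ))
    (fun t _ => Et_bad_nonneg β δ (ev_state σ) t) (Finset.mem_range.2 hn)
  have h3 : Et β (ev σ) 0 (bad δ) = 1 := by
    rw [Et_zero]
    show bad δ σ = 1
    unfold bad
    rw [if_neg hcon]
  simp only [h3] at h2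
  linarith [h.hδ2]

lemma AA_sum {q n : ℕ} [NeZero q] [NeZero n] {β δ : ℝ} {σ : Fin n → Fin q}
    (hσ : σ ∈ AA q β δ n) (T : ℕ) (hT : T ≤ n ^ 2) :
    ∑ t ∈ range T, Et β (ev σ) t (bad δ) ≤ δ :=
  le_trans (Finset.sum_le_sum_of_subset_of_nonneg (Finset.range_mono hT)
    (fun t _ _ => Et_bad_nonneg β δ (ev_state σ) t)) hσ

lemma cls_card {q n : ℕ} (s : Fin n → Fin q) (v) : ((cls s v).card : ℝ) = cnt s (s v) := by
  unfold cls cnt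
  simp

/-- stationary second moment constant -/
noncomputable def CM (q : ℕ) (β : ℝ) : ℝ := C2 q β + q * (1 + aa q β * q + C1 q β) ^ 2 + 2 * (KK q β / rho q β)

lemma Par.aapos {q : ℕ} {β δ : ℝ} (h : Par q β δ) : 0 < aa q β := by
  unfold aa; have := h.Kpos; have := h.hρ; positivity

lemma Par.C1pos {q : ℕ} {β δ : ℝ} (h : Par q β δ) : 0 < C1 q β := by
  unfold C1; have := h.Kpos; have := h.hρ; have := h.aapos; positivity

lemma Par.C2pos {q : ℕ} {β δ : ℝ} (h : Par q β δ) : 0 < C2 q β := by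
  unfold C2; have := h.Kpos; have := h.hρ; positivity

lemma CM_pos {q : ℕ} {β δ : ℝ} (h : Par q β δ) : 0 < CM q β := by
  unfold CM; have := h.Kpos; have := h.hρ; have := h.C2pos; positivity

lemma EV_small {q n : ℕ} [NeZero q] [NeZero n] {β δ : ℝ} (h : Par q β δ) (hn2 : 2 ≤ n)
    {σ : Fin n → Fin q} (hσ : σ ∈ AA q β δ n) (γ : ℝ) (hγ : 0 ≤ γ) (t : ℕ) (htn : t ≤ n ^ 2)
    (ht : alpha1 β q * n * Real.log n + γ * n ≤ t) : Et β (ev σ) t V ≤ CM q β / n := by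
  have hn := ncast_pos n
  have hn1 := ncast_one_le n
  have hK := h.Kpos
  have hρ := h.hρ
  have ha := h.aapos
  have hc1 := h.C1pos
  have hs : 0 < √(n:ℝ) := Real.sqrt_pos.2 hn
  have hss : √(n:ℝ) * √n = n := Real.mul_self_sqrt hn.le
  have hs1 : 1 ≤ √(n:ℝ) := Real.one_le_sqrt.2 hn1
  refine (EV_bound h hn2 σ t (AA_sum hσ t htn) t le_rfl).trans ?_
  have hd : (1 - rho q β / n) ^ t ≤ 1 / √n := by
    refine (decay_up h γ t ht).trans ?_
    gcongr
    apply Real.exp_le_one_iff.2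
    have : 0 ≤ rho q β * γ := by positivity
    linarith
  have hd0 : 0 ≤ (1 - rho q β / n) ^ t := pow_nonneg (by linarith [(rho_div (n := n) h).2]) t
  have h1 : C1 q β / n ≤ C1 q β * (1 / √n) := by
    rw [mul_one_div]
    gcongr
    nlinarith
  have h2 : (1 - rho q β / n) ^ t * (1 + aa q β * q) + C1 q β / n ≤ (1 / √n) * (1 + aa q β * q + C1 q β) := by
    have := mul_le_mul_of_nonneg_right hd (show 0 ≤ 1 + aa q β * q by positivity)
    linarith
  have h3 := pow_le_pow_left₀ (show 0 ≤ (1 - rho q β / n) ^ t * (1 + aa q β * q) + C1 q β / n by positivity) h2 2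
  rw [mul_pow, div_pow, one_pow, Real.sq_sqrt hn.le] at h3
  unfold CM
  have : 0 ≤ 2 * (KK q β / rho q β) / n := by positivity
  calc _ ≤ C2 q β / n + q * (1 / n * (1 + aa q β * q + C1 q β) ^ 2) := by gcongr
    _ ≤ C2 q β / n + q * (1 / n * (1 + aa q β * q + C1 q β) ^ 2) + 2 * (KK q β / rho q β) / n := by linarith
    _ = _ := by ring

lemma piV_small {q n : ℕ} [NeZero q] [NeZero n] {β δ : ℝ} (h : Par q β δ)
    (hb : (n:ℝ) ^ 2 * muF q n β (bad δ) ≤ 1) : muF q n β V ≤ 2 * (KK q β / rho q β) / n := by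
  have hn := ncast_pos n
  have hn1 := ncast_one_le n
  have hK := h.Kpos
  have hρ := h.hρ
  have h1 : muF q n β (bad δ) ≤ 1 / n := by
    rw [le_div_iff₀ hn]
    have : 0 ≤ muF q n β (bad δ) := (muF_state q n β).1 _ (bad_nonneg δ)
    nlinarith [mul_nonneg this hn.le]
  calc _ ≤ _ := piV_bound h
    _ ≤ KK q β / rho q β * (1 / n + 1 / n) := by gcongr
    _ = _ := by ring

lemma up_p1 {l ε ω X M n m : ℝ} (hl : 2 ≤ l) (hlε : 2 / l ≤ ε / 4) (hω : 0 < ω) (hX : 0 ≤ X)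
    (hM : 0 < M) (hn : 1 ≤ n) (hm0 : 0 ≤ m) (hm : m ≤ ω * n)
    (hω2 : ω * (8 * l * ((X + 1) * (M + 1))) ≤ ε) :
    2 * (l * (m * (X * (M / n + 1 / n ^ 2))) + 1 / l) ≤ ε / 4 + ε / 4 := by
  have hn0 : 0 < n := by linarith
  have a : M / n + 1 / n ^ 2 ≤ (M + 1) / n := by
    rw [add_div]
    gcongr
    nlinarith
  have b : m * (X * (M / n + 1 / n ^ 2)) ≤ ω * ((X + 1) * (M + 1)) := by
    calc _ ≤ (ω * n) * ((X + 1) * ((M + 1) / n)) := by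
          gcongr
          linarith
      _ = _ := by field_simp
  have b' := mul_le_mul_of_nonneg_left b (show 0 ≤ l by linarith)
  have d : 2 * (1 / l) = 2 / l := by ring
  have e : ω * (8 * l * ((X + 1) * (M + 1))) = 8 * (l * (ω * ((X + 1) * (M + 1)))) := by ring
  linarith

lemma up_p2 {q n c ω m : ℝ} (hq : 0 < q) (hn : 0 < n) (hc0 : 0 < c) (hc1 : c ≤ 1) (hω0 : 0 < ω)
    (hm2 : ω * n - 1 < m) (hm0 : 0 ≤ m) :
    q / 2 * (√n * (1 / (1 + c * m)) + 1 / √n) ≤ q / 2 * (1 / (c * ω) + 1) / √n := by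
  have hs : 0 < √n := Real.sqrt_pos.2 hn
  have hss : √n * √n = n := Real.mul_self_sqrt hn.le
  have a : c * ω * n ≤ 1 + c * m := by nlinarith
  have b : √n * (1 / (1 + c * m)) ≤ 1 / (c * ω) / √n := by
    calc √n * (1 / (1 + c * m)) ≤ √n * (1 / (c * ω * n)) := by gcongr
      _ = √n / (c * ω * (√n * √n)) := by rw [hss]; ring
      _ = _ := by field_simp
  calc _ ≤ q / 2 * (1 / (c * ω) / √n + 1 / √n) := by gcongr
    _ = _ := by ring

lemma up_p4 {Q Q' N C s e ε : ℝ} (hQ : 0 ≤ Q) (hN : 0 ≤ N) (hs : 0 < s) (p2 : Q ≤ Q' / s)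
    (p3 : N ≤ s * e + 1) (he : Q' * |C| * e ≤ ε / 4) (h4 : Q' * |C| / s ≤ ε / 4) :
    Q * (C * N) ≤ ε / 4 + ε / 4 := by
  calc _ ≤ Q * (|C| * N) := by
        gcongr; exact le_abs_self _
    _ ≤ (Q' / s) * (|C| * (s * e + 1)) := by
        have := hQ.trans p2
        gcongr
    _ = Q' * |C| * e + Q' * |C| / s := by field_simp
    _ ≤ _ := by linarith

set_option maxHeartbeats 1000000 in
lemma upper_asym {q : ℕ} [NeZero q] {β δ : ℝ} (h : Par q β δ) (hδq : δ ≤ 1 / (2 * q))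
    (hb : ∀ᶠ n : ℕ in atTop, (n:ℝ) ^ 2 * muF q n β (bad δ) ≤ 1) (ε : ℝ) (hε : 0 < ε) :
    ∃ γ : ℝ, 0 < γ ∧ ∀ᶠ n : ℕ in atTop, ∃ t : ℕ, (t:ℝ) ≤ alpha1 β q * n * Real.log n + γ * n ∧
      ∀ σ ∈ AA q β δ n, ∀ f : (Fin n → Fin q) → ℝ, (∀ x, 0 ≤ f x) → (∀ x, f x ≤ 1) →
        |Et β (ev σ) t f - muF q n β f| ≤ ε := by
  have hq := ncast_pos q
  have hq1 := ncast_one_le q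
  have hρ := h.hρ
  have hCM := CM_pos h
  have hCX : 0 ≤ CX q β := by unfold CX; positivity
  have hα : 0 < alpha1 β q := by rw [alpha_rho hρ]; positivity
  set l : ℝ := 8 / ε + 2 with hl
  have hl2 : 2 ≤ l := by have : 0 < 8 / ε := by positivity
                         linarith
  have hlε : 2 / l ≤ ε / 4 := by
    rw [div_le_iff₀ (by linarith), hl]
    have : ε / 4 * (8 / ε + 2) = 2 + ε / 2 := by field_simp; ring
    rw [this]; linarith
  set ω : ℝ := min (1 / (4 * q)) (ε / (8 * l * ((CX q β + 1) * (CM q β + 1)))) with hω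
  have hω0 : 0 < ω := lt_min (by positivity) (by positivity)
  have hω1 : ω ≤ 1 / (4 * q) := min_le_left _ _
  have hω2 : ω * (8 * l * ((CX q β + 1) * (CM q β + 1))) ≤ ε := by
    have : ω ≤ ε / (8 * l * ((CX q β + 1) * (CM q β + 1))) := min_le_right _ _
    rwa [le_div_iff₀ (by positivity)] at this
  set c : ℝ := 1 / (8 * q) with hc
  have hc0 : 0 < c := by positivity
  have hc1 : c ≤ 1 := by rw [hc, div_le_one (by positivity)]; linarith
  set BL : ℝ := q / 2 * (1 / (c * ω) + 1) * |CC q β| with hBL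
  have hBL0 : 0 ≤ BL := by positivity
  obtain ⟨γ₁, hγ₁, hγε⟩ : ∃ γ₁ : ℝ, 0 ≤ γ₁ ∧ BL * Real.exp (-(rho q β * γ₁)) ≤ ε / 4 := by
    have : Tendsto (fun g : ℝ => BL * Real.exp (-(rho q β * g))) atTop (nhds (BL * 0)) := by
      apply Tendsto.const_mul
      exact Real.tendsto_exp_neg_atTop_nhds_zero.comp (tendsto_id.const_mul_atTop hρ)
    rw [mul_zero] at this
    obtain ⟨g, hg1, hg2⟩ := ((this.eventually_le_const (show 0 < ε / 4 by positivity)).and (eventually_ge_atTop 0)).exists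
    exact ⟨g, hg2, hg1⟩
  refine ⟨γ₁ + 2, by linarith, ?_⟩
  have ev3 : ∀ᶠ n : ℕ in atTop, alpha1 β q * Real.log n + (γ₁ + 2) ≤ n := by
    have h1 : Tendsto (fun x : ℝ => (alpha1 β q * Real.log x + (γ₁ + 2)) / x) atTop (nhds 0) := by
      have a := (Real.isLittleO_log_id_atTop.tendsto_div_nhds_zero).const_mul (alpha1 β q)
      have b : Tendsto (fun x : ℝ => (γ₁ + 2) / x) atTop (nhds 0) := tendsto_const_nhds.div_atTop tendsto_id
      have := a.add b
      simp only [mul_zero, add_zero] at this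
      refine this.congr fun x => ?_
      simp only [id]; ring
    have h2 := (h1.comp tendsto_natCast_atTop_atTop).eventually_le_const (show (0:ℝ) < 1 by norm_num)
    filter_upwards [h2, eventually_ge_atTop 1] with n hn hn1
    have : (0:ℝ) < n := by exact_mod_cast hn1
    simp only [Function.comp] at hn
    rwa [div_le_one this] at hn
  have ev4 : ∀ᶠ n : ℕ in atTop, BL / (ε / 4) ≤ √(n:ℝ) :=
    (Real.tendsto_sqrt_atTop.comp tendsto_natCast_atTop_atTop).eventually_ge_atTop _
  filter_upwards [hb, ev3, ev4, eventually_ge_atTop 2] with n hbn h3 h4 hn2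
  have : NeZero n := ⟨by omega⟩
  have hn := ncast_pos n
  have hn1 := ncast_one_le n
  have hlog : 0 ≤ Real.log n := Real.log_nonneg hn1
  have hs : 0 < √(n:ℝ) := Real.sqrt_pos.2 hn
  have hss : √(n:ℝ) * √n = n := Real.mul_self_sqrt hn.le
  set t1 := ⌈alpha1 β q * n * Real.log n + γ₁ * n⌉₊ with ht1
  set m := ⌊ω * n⌋₊ with hm
  have ht1a : alpha1 β q * n * Real.log n + γ₁ * n ≤ t1 := Nat.le_ceil _
  have ht1b : (t1:ℝ) < alpha1 β q * n * Real.log n + γ₁ * n + 1 := Nat.ceil_lt_add_one (by positivity)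
  have hm1 : (m:ℝ) ≤ ω * n := Nat.floor_le (by positivity)
  have hm2 : ω * n - 1 < m := Nat.sub_one_lt_floor _
  have hωle : ω ≤ 1 := hω1.trans (by rw [div_le_one (by positivity)]; linarith)
  have htot : ((t1 + m : ℕ):ℝ) ≤ alpha1 β q * n * Real.log n + (γ₁ + 2) * n := by
    push_cast
    nlinarith
  have htn : t1 + m ≤ n ^ 2 := by
    have : ((t1 + m : ℕ):ℝ) ≤ (n:ℝ) ^ 2 := by
      refine htot.trans ?_
      have := mul_le_mul_of_nonneg_left h3 hn.le
      nlinarith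
    exact_mod_cast this
  refine ⟨t1 + m, htot, fun σ hσ f f0 f1 => ?_⟩
  have hV := AA_good h hσ
  have hbb := AA_sum hσ t1 (by omega)
  have hπ : t1 * muF q n β (bad δ) ≤ 1 := by
    have h0 : 0 ≤ muF q n β (bad δ) := (muF_state q n β).1 _ (bad_nonneg δ)
    have : (t1:ℝ) ≤ (n:ℝ) ^ 2 := by exact_mod_cast (by omega : t1 ≤ n ^ 2)
    exact (mul_le_mul_of_nonneg_right this h0).trans hbn
  have hcls : ∀ v, (m : ℝ) + 2 * c * n ≤ (cls σ v).card := by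
    intro v
    rw [cls_card]
    have hx := (X_abs_le_sqrt σ (σ v)).trans (Real.sqrt_le_sqrt hV)
    rw [Real.sqrt_sq h.hδ.le] at hx
    have hx := (abs_le.1 hx).1
    unfold X at hx
    have h5 : 1 / (q:ℝ) - 1 / (2 * q) ≤ cnt σ (σ v) / n := by linarith
    rw [le_div_iff₀ hn] at h5
    have h6 : ω * n ≤ 1 / (4 * q) * n := by gcongr
    have e : (1 / (q:ℝ) - 1 / (2 * q)) * n = 1 / (4 * q) * n + 2 * c * n := by rw [hc]; field_simp; ring
    linarith
  have main := upper_det h σ t1 m (hbb.trans (by linarith [h.hδ2])) hπ l hl2 c hc0.le hcls (√n) hs (CM q β / n)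
    (fun t ht => EV_small h hn2 hσ γ₁ hγ₁ (t1 + t) (by omega) (by
      push_cast
      have : (0:ℝ) ≤ t := by positivity
      linarith))
    ((piV_small h hbn).trans (by
      gcongr
      unfold CM
      have := h.C2pos
      have : 0 ≤ q * (1 + aa q β * q + C1 q β) ^ 2 := by positivity
      linarith)) f f0 f1
  refine main.trans ?_
  have hmn : (0:ℝ) ≤ m := Nat.cast_nonneg m
  have p1 : 2 * (l * (m * (CX q β * (CM q β / n + 1 / n ^ 2))) + 1 / l) ≤ ε / 4 + ε / 4 :=
    up_p1 hl2 hlε hω0 hCX hCM hn1 hmn hm1 hω2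
  have p2 : q / 2 * (√n * (1 / (1 + c * m)) + 1 / √n) ≤ q / 2 * (1 / (c * ω) + 1) / √n :=
    up_p2 hq hn hc0 hc1 hω0 hm2 hmn
  have p3 : n * (1 - rho q β / n) ^ t1 + 1 ≤ √n * Real.exp (-(rho q β * γ₁)) + 1 := by
    have := decay_up h γ₁ t1 ht1a
    calc _ ≤ n * (Real.exp (-(rho q β * γ₁)) / √n) + 1 := by gcongr
      _ = (√n * √n) * (Real.exp (-(rho q β * γ₁)) / √n) + 1 := by rw [hss]
      _ = _ := by field_simp
  have hr0 : 0 ≤ (1 - rho q β / n) ^ t1 := pow_nonneg (by linarith [(rho_div (n := n) h).2]) t1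
  have p4 : (q / 2 * (√n * (1 / (1 + c * m)) + 1 / √n)) * (CC q β * (n * (1 - rho q β / n) ^ t1 + 1)) ≤ ε / 4 + ε / 4 := by
    have hQ : 0 ≤ (q:ℝ) / 2 * (√n * (1 / (1 + c * m)) + 1 / √n) := by positivity
    have hN : 0 ≤ (n:ℝ) * (1 - rho q β / n) ^ t1 + 1 := by positivity
    have h4b : BL / √n ≤ ε / 4 := by
      rw [div_le_iff₀ hs]
      rw [div_le_iff₀ (by positivity)] at h4
      linarith
    exact up_p4 hQ hN hs p2 p3 hγε h4b
  linarith

end EM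

namespace EM

lemma decay_lo {q n : ℕ} [NeZero n] {β δ : ℝ} (h : Par q β δ) (hn2 : 2 ≤ n) (γ : ℝ) (hγ : 0 ≤ γ) (t : ℕ)
    (ht : (t:ℝ) ≤ alpha1 β q * n * Real.log n - γ * n) :
    Real.exp (rho q β * γ - 1) / √n ≤ (1 - rho q β / n) ^ t := by
  have hn := ncast_pos n
  have hn1 := ncast_one_le n
  have hρ := h.hρ
  have hρ1 := h.rho_le
  have hn2' : (2:ℝ) ≤ n := by exact_mod_cast hn2
  set x := rho q β / n with hx
  have hx0 : 0 < x := by positivity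
  have hx2 : x ≤ 1 / 2 := by
    rw [hx, div_le_iff₀ hn]; linarith
  have hb : Real.exp (-(x + 2 * x ^ 2)) ≤ 1 - x := by
    have h1 : 1 / (1 - x) ≤ Real.exp (x + 2 * x ^ 2) := by
      have : 1 / (1 - x) ≤ (x + 2 * x ^ 2) + 1 := by
        rw [div_le_iff₀ (by linarith)]
        nlinarith [mul_nonneg hx0.le hx0.le, mul_nonneg (sq_nonneg x) (show 0 ≤ 1 / 2 - x by linarith)]
      exact this.trans (Real.add_one_le_exp _)
    rw [Real.exp_neg, inv_le_comm₀ (Real.exp_pos _) (by linarith)]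
    simpa using h1
  refine le_trans ?_ (pow_le_pow_left₀ (Real.exp_pos _).le hb t)
  rw [← Real.exp_nat_mul, Real.sqrt_eq_rpow, Real.rpow_def_of_pos hn, ← Real.exp_sub]
  apply Real.exp_le_exp.2
  rw [alpha_rho hρ] at ht
  have hlog : Real.log n ≤ n := (Real.log_le_sub_one_of_pos hn).trans (by linarith)
  have h1 := mul_le_mul_of_nonneg_right ht (show 0 ≤ x + 2 * x ^ 2 by positivity)
  have e : (1 / (2 * rho q β) * n * Real.log n - γ * n) * (x + 2 * x ^ 2) =
      Real.log n * (1 / 2) - rho q β * γ + rho q β * (Real.log n / n) - γ * n * (2 * x ^ 2) := by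
    rw [hx]; field_simp
    ring
  have h2 : 0 ≤ γ * n * (2 * x ^ 2) := by positivity
  have h3 : Real.log n / n ≤ 1 := by rw [div_le_one hn]; exact hlog
  have h4 : rho q β * (Real.log n / n) ≤ 1 := by nlinarith
  linarith

/-- constant for the lower bound -/
noncomputable def CD (q : ℕ) (β : ℝ) : ℝ := C2 q β + 2 * (KK q β / rho q β)

lemma lower_core {q n : ℕ} [NeZero q] [NeZero n] {β δ : ℝ} (h : Par q β δ) (hn2 : 2 ≤ n)
    (hb : (n:ℝ) ^ 2 * muF q n β (bad δ) ≤ 1)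
    {σ : Fin n → Fin q} (hσ : σ ∈ AA q β δ n) (t : ℕ) (htn : t ≤ n ^ 2) (k : Fin q) (s : ℝ) (hs : |s| = 1)
    (M : ℝ) (hM : 0 < M) (hm : M / √n ≤ s * Et β (ev σ) t (fun σ => X σ k)) :
    ∃ S : Finset (Fin n → Fin q), 1 - 4 * CD q β / M ^ 2 ≤
      Et β (ev σ) t (fun τ => if τ ∈ S then 1 else 0) - muF q n β (fun τ => if τ ∈ S then 1 else 0) := by
  classical
  have hn := ncast_pos n
  have hsq : 0 < √(n:ℝ) := Real.sqrt_pos.2 hn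
  set y : Fin q → ℝ := fun k => Et β (ev σ) t (fun σ => X σ k) with hy
  have hm' : M / √n ≤ s * y k := hm
  set m := s * y k with hmd
  have hm0 : 0 < m := lt_of_lt_of_le (by positivity) hm'
  have hs2 : s ^ 2 = 1 := by rw [← sq_abs, hs, one_pow]
  have hst := Et_state β (ev_state σ) t
  refine ⟨Finset.univ.filter (fun τ => m / 2 ≤ s * X τ k), ?_⟩
  simp only [Finset.mem_filter, Finset.mem_univ, true_and]
  set f : (Fin n → Fin q) → ℝ := fun τ => if m / 2 ≤ s * X τ k then 1 else 0 with hf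
  have hcoef : 4 / m ^ 2 ≤ 4 * n / M ^ 2 := by
    have h1 := pow_le_pow_left₀ (show 0 ≤ M / √n by positivity) hm' 2
    rw [div_pow, Real.sq_sqrt hn.le, div_le_iff₀ hn] at h1
    rw [div_le_div_iff₀ (by positivity) (by positivity)]
    linarith
  have a1 : 1 - Et β (ev σ) t f ≤ 4 / m ^ 2 * (C2 q β / n) := by
    have h1 : Et β (ev σ) t ((fun _ => 1) - f) ≤ Et β (ev σ) t ((4 / m ^ 2) • fy y) := by
      apply hst.mono
      intro τ
      simp only [Pi.sub_apply, Pi.smul_apply, smul_eq_mul, hf]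
      have h0 : (X τ k - y k) ^ 2 ≤ fy y τ :=
        Finset.single_le_sum (f := fun k => (X τ k - y k) ^ 2) (fun i _ => sq_nonneg _) (Finset.mem_univ k)
      split_ifs with hc
      · have : 0 ≤ fy y τ := (sq_nonneg _).trans h0
        rw [sub_self]; positivity
      · have h2 : (m / 2) ^ 2 ≤ (X τ k - y k) ^ 2 := by
          have e : (X τ k - y k) ^ 2 = (m - s * X τ k) ^ 2 := by
            rw [hmd, show s * y k - s * X τ k = s * (y k - X τ k) by ring, mul_pow, hs2]; ring
          rw [e]
          apply pow_le_pow_left₀ (by positivity)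
          linarith
        rw [sub_zero, div_mul_eq_mul_div, le_div_iff₀ (by positivity)]
        nlinarith
    rw [map_sub, map_smul, hst.const, smul_eq_mul] at h1
    exact h1.trans (mul_le_mul_of_nonneg_left (var_bound h hn2 σ t (AA_sum hσ t htn) t le_rfl) (by positivity))
  have a2 : muF q n β f ≤ 4 / m ^ 2 * (2 * (KK q β / rho q β) / n) := by
    have h1 : muF q n β f ≤ muF q n β ((4 / m ^ 2) • V) := by
      apply (muF_state q n β).mono
      intro τ
      simp only [Pi.smul_apply, smul_eq_mul, hf]
      have h0 := X_sq_le τ k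
      split_ifs with hc
      · have h2 : (m / 2) ^ 2 ≤ X τ k ^ 2 := by
          rw [show X τ k ^ 2 = (s * X τ k) ^ 2 by rw [mul_pow, hs2, one_mul]]
          exact pow_le_pow_left₀ (by positivity) hc 2
        rw [div_mul_eq_mul_div, le_div_iff₀ (by positivity)]
        nlinarith
      · have := V_nonneg τ
        positivity
    rw [map_smul, smul_eq_mul] at h1
    exact h1.trans (mul_le_mul_of_nonneg_left (piV_small h hb) (by positivity))
  have hCD : 0 < CD q β := by
    have := h.C2pos; have := h.Kpos; have := h.hρ; unfold CD; positivity
  have e : 4 / m ^ 2 * (C2 q β / n) + 4 / m ^ 2 * (2 * (KK q β / rho q β) / n) = 4 / m ^ 2 * (CD q β / n) := by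
    unfold CD; ring
  have e2 : 4 / m ^ 2 * (CD q β / n) ≤ 4 * CD q β / M ^ 2 := by
    calc _ ≤ 4 * n / M ^ 2 * (CD q β / n) := by gcongr
      _ = _ := by field_simp
  linarith

lemma lower_asym {q : ℕ} [NeZero q] {β δ : ℝ} (h : Par q β δ) (hδq : δ * (2 * aa q β * q) ≤ 1)
    (hb : ∀ᶠ n : ℕ in atTop, (n:ℝ) ^ 2 * muF q n β (bad δ) ≤ 1) (v0 : ℝ) (hv0 : 0 < v0)
    (hd : ∀ᶠ n : ℕ in atTop, ∃ σ ∈ AA q β δ n, v0 ≤ V σ) (ε : ℝ) (hε : 0 < ε) :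
    ∃ γ : ℝ, 0 < γ ∧ ∀ᶠ n : ℕ in atTop, ∃ σ ∈ AA q β δ n, ∀ t : ℕ,
      (t:ℝ) < alpha1 β q * n * Real.log n - γ * n → ∃ S : Finset (Fin n → Fin q),
        1 - ε < Et β (ev σ) t (fun τ => if τ ∈ S then 1 else 0) -
          muF q n β (fun τ => if τ ∈ S then 1 else 0) := by
  have hq := ncast_pos q
  have hρ := h.hρ
  have ha := h.aapos
  have hc1 := h.C1pos
  have hα : 0 < alpha1 β q := by rw [alpha_rho hρ]; positivity
  have hCD : 0 < CD q β := by
    have := h.C2pos; have := h.Kpos; unfold CD; positivity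
  set x0 : ℝ := √(v0 / q) / 2 with hx0
  have hx0p : 0 < x0 := by
    have := Real.sqrt_pos.2 (show 0 < v0 / q by positivity)
    positivity
  obtain ⟨γ, hγ, hM0, hMε⟩ : ∃ γ : ℝ, 0 < γ ∧ 0 < x0 * Real.exp (rho q β * γ - 1) - C1 q β ∧
      4 * CD q β / (x0 * Real.exp (rho q β * γ - 1) - C1 q β) ^ 2 < ε := by
    have h1 : Tendsto (fun γ : ℝ => x0 * Real.exp (rho q β * γ - 1) - C1 q β) atTop atTop := by
      apply tendsto_atTop_add_const_right
      apply Tendsto.const_mul_atTop hx0p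
      apply Real.tendsto_exp_atTop.comp
      apply tendsto_atTop_add_const_right
      exact tendsto_id.const_mul_atTop hρ
    have h2 : Tendsto (fun γ : ℝ => 4 * CD q β / (x0 * Real.exp (rho q β * γ - 1) - C1 q β) ^ 2) atTop (nhds 0) :=
      tendsto_const_nhds.div_atTop ((tendsto_pow_atTop two_ne_zero).comp h1)
    obtain ⟨g, g1, g2, g3⟩ := ((eventually_gt_atTop (0:ℝ)).and ((h1.eventually_gt_atTop 0).and
      (h2.eventually_lt_const hε))).exists
    exact ⟨g, g1, g2, g3⟩
  set M := x0 * Real.exp (rho q β * γ - 1) - C1 q β with hM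
  refine ⟨γ, hγ, ?_⟩
  have ev3 : ∀ᶠ n : ℕ in atTop, alpha1 β q * Real.log n ≤ n := by
    have h1 := (Real.isLittleO_log_id_atTop.tendsto_div_nhds_zero).const_mul (alpha1 β q)
    rw [mul_zero] at h1
    have h2 := (h1.comp tendsto_natCast_atTop_atTop).eventually_le_const (show (0:ℝ) < 1 by norm_num)
    filter_upwards [h2, eventually_ge_atTop 1] with n hn hn1
    have : (0:ℝ) < n := by exact_mod_cast hn1
    simp only [Function.comp, id] at hn
    rwa [← mul_div_assoc, div_le_one this] at hn
  filter_upwards [hb, hd, ev3, eventually_ge_atTop 2] with n hbn hdn h3 hn2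
  have : NeZero n := ⟨by omega⟩
  have hn := ncast_pos n
  have hn1 := ncast_one_le n
  have hs0 : 0 < √(n:ℝ) := Real.sqrt_pos.2 hn
  have hss : √(n:ℝ) * √n = n := Real.mul_self_sqrt hn.le
  have hs1 : 1 ≤ √(n:ℝ) := Real.one_le_sqrt.2 hn1
  obtain ⟨σ, hσ, hv⟩ := hdn
  refine ⟨σ, hσ, fun t ht => ?_⟩
  have htn : t ≤ n ^ 2 := by
    have : (t:ℝ) ≤ (n:ℝ) ^ 2 := by
      have := mul_le_mul_of_nonneg_left h3 hn.le
      nlinarith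
    exact_mod_cast this
  obtain ⟨k, -, hk⟩ := Finset.exists_max_image (Finset.univ : Finset (Fin q)) (fun k => |X σ k|) ⟨0, Finset.mem_univ _⟩
  obtain ⟨s, hs, hsx⟩ : ∃ s : ℝ, |s| = 1 ∧ s * X σ k = |X σ k| := by
    rcases le_total 0 (X σ k) with h0 | h0
    · exact ⟨1, by simp, by rw [abs_of_nonneg h0]; ring⟩
    · exact ⟨-1, by simp, by rw [abs_of_nonpos h0]; ring⟩
  set x := |X σ k| with hx
  have hx0' : 0 ≤ x := abs_nonneg _
  have hVq : V σ ≤ q * x ^ 2 := by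
    unfold V
    calc _ ≤ ∑ j : Fin q, x ^ 2 := by
          apply Finset.sum_le_sum
          intro j _
          rw [← sq_abs]
          exact pow_le_pow_left₀ (abs_nonneg _) (hk j (Finset.mem_univ _)) 2
      _ = _ := by simp
  have hxδ : x ≤ δ := by
    have := (X_abs_le_sqrt σ k).trans (Real.sqrt_le_sqrt (AA_good h hσ))
    rwa [Real.sqrt_sq h.hδ.le] at this
  have hxv : 2 * x0 ≤ x := by
    rw [hx0, mul_div_cancel₀ _ two_ne_zero]
    apply Real.sqrt_le_iff.2 ⟨hx0', ?_⟩
    rw [div_le_iff₀ hq]; linarith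
  have hst : x0 ≤ s * X σ k - aa q β * V σ := by
    rw [hsx]
    have h1 : aa q β * V σ ≤ aa q β * (q * x ^ 2) := by gcongr
    have h2 : aa q β * (q * x ^ 2) ≤ x / 2 := by
      have : x * (2 * aa q β * q) ≤ 1 := le_trans (by gcongr) hδq
      have := mul_le_mul_of_nonneg_left this hx0'
      linarith
    linarith
  have hml := mean_lower h (ev_state σ) t ((AA_sum hσ t htn).trans (by linarith [h.hδ2])) s hs k
  have hdl := decay_lo h hn2 γ hγ.le t ht.le
  have hmM : M / √n ≤ s * Et β (ev σ) t (fun σ => X σ k) := by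
    refine le_trans ?_ hml
    have h1 : C1 q β / n ≤ C1 q β / √n := by
      gcongr
      nlinarith
    have h2 : Real.exp (rho q β * γ - 1) / √n * x0 ≤ (1 - rho q β / n) ^ t * (s * X σ k - aa q β * V σ) := by
      gcongr
      exact le_trans (by positivity) hdl
    have e : M / √n = Real.exp (rho q β * γ - 1) / √n * x0 - C1 q β / √n := by rw [hM]; ring
    rw [e]
    exact sub_le_sub h2 h1
  obtain ⟨S, hS⟩ := lower_core h hn2 hbn hσ t htn k s hs M hM0 hmM
  exact ⟨S, by linarith⟩

end EM

namespace EM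

lemma tv_term {q n : ℕ} [NeZero q] (β : ℝ) (t : ℕ) (σ : Fin n → Fin q) (S : Finset (Fin n → Fin q)) :
    ∑ x ∈ S, (glauberKernel q n β ^ t) σ x - ∑ x ∈ S, pottsMeasure q n β x =
      Et β (ev σ) t (fun τ => if τ ∈ S then 1 else 0) - muF q n β (fun τ => if τ ∈ S then 1 else 0) := by
  have h1 : Et β (ev σ) t (fun τ => if τ ∈ S then 1 else 0) = ∑ x ∈ S, (glauberKernel q n β ^ t) σ x := by
    show (Pop q n β ^ t) (fun τ => if τ ∈ S then 1 else 0) σ = _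
    rw [← kernel_pow]
    simp [Matrix.mulVec, dotProduct, Finset.sum_ite_mem]
  have h2 : muF q n β (fun τ => if τ ∈ S then 1 else 0) = ∑ x ∈ S, pottsMeasure q n β x := by
    rw [muF_apply]
    simp [Finset.sum_ite_mem]
  rw [h1, h2]

lemma dist_le {q n : ℕ} [NeZero q] {β ε : ℝ} (hε : 0 ≤ ε) (A : Set (Fin n → Fin q)) (t : ℕ)
    (h : ∀ σ ∈ A, ∀ f : (Fin n → Fin q) → ℝ, (∀ x, 0 ≤ f x) → (∀ x, f x ≤ 1) →
        |Et β (ev σ) t f - muF q n β f| ≤ ε) : glauberDistRes q n β A t ≤ ε := by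
  unfold glauberDistRes
  apply Real.iSup_le _ hε
  intro σ
  unfold tvDist
  apply Real.iSup_le _ hε
  intro S
  rw [tv_term]
  apply h σ σ.2
  · intro x; split_ifs <;> norm_num
  · intro x; split_ifs <;> norm_num

lemma lt_dist {q n : ℕ} [NeZero q] {β c : ℝ} (A : Set (Fin n → Fin q)) (t : ℕ)
    (σ) (hσ : σ ∈ A) (S : Finset (Fin n → Fin q))
    (h : c < Et β (ev σ) t (fun τ => if τ ∈ S then 1 else 0) - muF q n β (fun τ => if τ ∈ S then 1 else 0)) :
    c < glauberDistRes q n β A t := by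
  rw [← tv_term] at h
  refine lt_of_lt_of_le h ((le_abs_self _).trans ?_)
  unfold glauberDistRes
  refine le_trans ?_ (le_ciSup (f := fun σ₀ : A => tvDist (fun τ => (glauberKernel q n β ^ t) (σ₀ : Fin n → Fin q) τ)
    (pottsMeasure q n β)) (Set.finite_range _).bddAbove ⟨σ, hσ⟩)
  unfold tvDist
  exact le_ciSup (f := fun A : Finset (Fin n → Fin q) => |∑ x ∈ A, (glauberKernel q n β ^ t) σ x -
    ∑ x ∈ A, pottsMeasure q n β x|) (Set.finite_range _).bddAbove S

lemma par_exists (q : ℕ) (hq : 3 ≤ q) (β : ℝ) (hβ0 : 0 ≤ β) (hb : β < bq q) :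
    ∃ δ : ℝ, Par q β δ ∧ δ ≤ 1 / (2 * q) ∧ δ * (2 * aa q β * q) ≤ 1 := by
  have hq0 : (0:ℝ) < q := by exact_mod_cast (by omega : 0 < q)
  have hρ : 0 < rho q β := by
    have := hb.trans (bq_le_two q hq)
    unfold rho
    rw [sub_pos, div_lt_one hq0]
    linarith
  have hK : 0 ≤ KK q β := by unfold KK; positivity
  have ha : 0 ≤ aa q β := by unfold aa; positivity
  set δ : ℝ := min (min (1 / 2) (1 / (2 * (q:ℝ)))) (min (rho q β / (128 * β ^ 2 + 1)) (1 / (2 * aa q β * q + 1))) with hδ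
  have d0 : 0 < δ := by
    refine lt_min (lt_min (by norm_num) (by positivity)) (lt_min (by positivity) (by positivity))
  have d1 : δ ≤ 1 / 2 := (min_le_left _ _).trans (min_le_left _ _)
  have d2 : δ ≤ 1 / (2 * q) := (min_le_left _ _).trans (min_le_right _ _)
  have d3 : δ ≤ rho q β / (128 * β ^ 2 + 1) := (min_le_right _ _).trans (min_le_left _ _)
  have d4 : δ ≤ 1 / (2 * aa q β * q + 1) := (min_le_right _ _).trans (min_le_right _ _)
  rw [le_div_iff₀ (by positivity)] at d3 d4
  exact ⟨δ, ⟨hβ0, d0, d1, hρ, by linarith⟩, d2, by linarith⟩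

lemma final (q : ℕ) (hq : 3 ≤ q) (β : ℝ)
    (hβ0 : 0 ≤ β) (hβ : β < betaC q) :
    ∃ C₁ C₂ : ℝ, 0 < C₁ ∧ 0 < C₂ ∧
      ∃ A : (n : ℕ) → Set (Fin n → Fin q),
        (∀ n : ℕ, ∑ σ : Fin n → Fin q, ((A n)ᶜ).indicator (pottsMeasure q n β) σ ≤
            C₁ * Real.exp (-C₂ * n)) ∧
        ∀ ε ∈ Set.Ioo (0 : ℝ) (1 / 2), ∃ γ : ℝ, 0 < γ ∧
          ∀ᶠ n : ℕ in atTop,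
            (mixingTimeRes q n β (A n) ε : ℝ) ≤ alpha1 β q * n * Real.log n + γ * n ∧
            alpha1 β q * n * Real.log n - γ * n ≤ (mixingTimeRes q n β (A n) (1 - ε) : ℝ) := by
  have : NeZero q := ⟨by omega⟩
  have hb : β < bq q := by
    unfold betaC at hβ
    unfold bq
    rw [if_neg (by omega)] at hβ ⊢
    exact hβ
  obtain ⟨δ, h, hδ1, hδ2⟩ := par_exists q hq β hβ0 hb
  obtain ⟨C₁, C₂, hC₁, hC₂, hA, hbad⟩ := AA_measure q β δ h.hδ hβ0 hb
  refine ⟨C₁, C₂, hC₁, hC₂, AA q β δ, hA, fun ε hε => ?_⟩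
  obtain ⟨v0, hv0, hdisp⟩ := displaced q (by omega) β δ hβ0 hb C₁ C₂ hC₁ hC₂ hA
  have hbe : ∀ᶠ n : ℕ in atTop, (n:ℝ) ^ 2 * muF q n β (bad δ) ≤ 1 := by
    have h1 : Tendsto (fun n : ℕ => C₁ * Real.exp (-(C₂ * n))) atTop (nhds (C₁ * 0)) := by
      apply Tendsto.const_mul
      exact Real.tendsto_exp_neg_atTop_nhds_zero.comp (tendsto_natCast_atTop_atTop.const_mul_atTop hC₂)
    rw [mul_zero] at h1
    filter_upwards [h1.eventually_le_const one_pos, eventually_ge_atTop 1] with n hn hn1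
    have := hbad n hn1
    rw [neg_mul] at this
    exact this.trans hn
  obtain ⟨γ₁, hγ₁, up⟩ := upper_asym h hδ1 hbe ε hε.1
  obtain ⟨γ₂, hγ₂, lo⟩ := lower_asym h hδ2 hbe v0 hv0 hdisp ε hε.1
  refine ⟨γ₁ + γ₂, by linarith, ?_⟩
  filter_upwards [up, lo] with n hu hl
  have hn0 : (0:ℝ) ≤ n := Nat.cast_nonneg n
  obtain ⟨t, ht, hut⟩ := hu
  have hdist := dist_le hε.1.le (AA q β δ n) t hut
  constructor
  · have h1 : mixingTimeRes q n β (AA q β δ n) ε ≤ t := Nat.sInf_le hdist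
    have h2 : (mixingTimeRes q n β (AA q β δ n) ε : ℝ) ≤ t := by exact_mod_cast h1
    have : 0 ≤ γ₂ * n := by positivity
    linarith
  · obtain ⟨σ, hσ, hS⟩ := hl
    have hmem : glauberDistRes q n β (AA q β δ n) (mixingTimeRes q n β (AA q β δ n) (1 - ε)) ≤ 1 - ε :=
      Nat.sInf_mem (s := {t | glauberDistRes q n β (AA q β δ n) t ≤ 1 - ε})
        ⟨t, hdist.trans (by linarith [hε.2])⟩
    by_contra hcon
    push Not at hcon
    have : 0 ≤ γ₁ * n := by positivity
    obtain ⟨S, hS⟩ := hS _ (show ((mixingTimeRes q n β (AA q β δ n) (1 - ε) : ℕ):ℝ) <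
      alpha1 β q * n * Real.log n - γ₂ * n by linarith)
    exact absurd hmem (not_le.2 (lt_dist _ _ σ hσ S hS))

end EM

/-- **Theorem D (essential mixing).** Let `q ≥ 3` and `0 ≤ β < β_c(q)`.
There exist `C₁, C₂ > 0` and sets `Σ̃_n ⊆ Σ_n` of stationary measure at least
`1 − C₁ e^{−C₂ n}` such that the dynamics started from `Σ̃_n` exhibits cutoff at
time `α₁(β,q) n log n` with window of order `n`. -/
theorem essential_mixing (q : ℕ) (hq : 3 ≤ q) (β : ℝ)
    (hβ0 : 0 ≤ β) (hβ : β < betaC q) :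
    ∃ C₁ C₂ : ℝ, 0 < C₁ ∧ 0 < C₂ ∧
      ∃ A : (n : ℕ) → Set (Fin n → Fin q),
        (∀ n : ℕ, ∑ σ : Fin n → Fin q, ((A n)ᶜ).indicator (pottsMeasure q n β) σ ≤
            C₁ * Real.exp (-C₂ * n)) ∧
        ∀ ε ∈ Set.Ioo (0 : ℝ) (1 / 2), ∃ γ : ℝ, 0 < γ ∧
          ∀ᶠ n : ℕ in atTop,
            (mixingTimeRes q n β (A n) ε : ℝ) ≤ alpha1 β q * n * Real.log n + γ * n ∧
            alpha1 β q * n * Real.log n - γ * n ≤ (mixingTimeRes q n β (A n) (1 - ε) : ℝ) := by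
  exact EM.final q hq β hβ0 hβ
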